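/- Let c be a real number with 1 < c < 4109054/1999527 and c ≠ 2, let ε > 0 be fixed and sufficiently small, and for a sufficiently large integer N set P = N^{1/c} and τ = P^{1-c-ε}. Define G(α) = Σ_{m ≤ N} (1/c)·m^{1/c - 1}·e(mα). Then sup_{|α| ≤ τ} |S(α) - G(α)| ≪ P·exp(-(log P)^{1/3}), with implied constant depending only on c and ε. -/

import Mathlib

open scoped Classical
open Finset Real

/-- `eC x = e(x) = e^{2πix}`. -/
noncomputable def eC (x : ℝ) : ℂ := Complex.exp ((2 * Real.pi * x : ℝ) * Complex.I)

/-- `SS c P α = S(α) = Σ_{p ≤ P} (log p) e([p^c]α)`, the sum over primes `p ≤ P`. -/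
noncomputable def SS (c P α : ℝ) : ℂ :=
  ∑ p ∈ (Finset.range (⌊P⌋₊ + 1)).filter Nat.Prime,
    (Real.log p : ℂ) * eC ((⌊(p : ℝ) ^ c⌋ : ℝ) * α)

/-- `G c N α = Σ_{1 ≤ m ≤ N} (1/c) m^{1/c-1} e(mα)`. -/
noncomputable def G (c : ℝ) (N : ℕ) (α : ℝ) : ℂ :=
  ∑ m ∈ Finset.Icc 1 N, ((1 / c * (m : ℝ) ^ (1 / c - 1) : ℝ) : ℂ) * eC ((m : ℝ) * α)

namespace PrimeExp

/-- The fractional part cut off to `(1, ∞)`. -/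
noncomputable def fractTail (t : ℝ) : ℂ := (Set.Ioi (1 : ℝ)).indicator (fun t => ((Int.fract t : ℝ) : ℂ)) t

lemma norm_fractTail_le (t : ℝ) : ‖fractTail t‖ ≤ (Set.Ioi (1 : ℝ)).indicator (fun _ => (1 : ℝ)) t := by
  unfold fractTail
  by_cases h : t ∈ Set.Ioi (1 : ℝ)
  · simp only [h, Set.indicator_of_mem, Complex.norm_real, Real.norm_eq_abs]
    rw [abs_of_nonneg (Int.fract_nonneg t)]
    exact (Int.fract_lt_one t).le
  · simp [h]

lemma measurable_fractTail : Measurable fractTail := by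
  unfold fractTail
  exact (Complex.measurable_ofReal.comp measurable_fract).indicator measurableSet_Ioi

lemma mellin_neg_eq_setIntegral {f : ℝ → ℂ} (s : ℂ) :
    mellin (fun t => (Set.Ioi (1 : ℝ)).indicator f t) (-s) =
      ∫ t in Set.Ioi (1 : ℝ), f t * (t : ℂ) ^ (-(s + 1)) := by
  unfold mellin
  have h1 : ∀ t : ℝ, (t : ℂ) ^ (-s - 1) • (Set.Ioi (1 : ℝ)).indicator f t
      = (Set.Ioi (1 : ℝ)).indicator (fun t => f t * (t : ℂ) ^ (-(s + 1))) t := by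
    intro t
    by_cases h : t ∈ Set.Ioi (1 : ℝ)
    · simp only [h, Set.indicator_of_mem, smul_eq_mul]
      rw [mul_comm]; congr 2; ring
    · simp [h]
  simp_rw [h1]
  rw [MeasureTheory.setIntegral_indicator measurableSet_Ioi]
  congr 1
  ext x; simp

lemma differentiableAt_mellin_fractTail {s : ℂ} (hs : 0 < s.re) :
    DifferentiableAt ℂ (fun s => mellin fractTail (-s)) s := by
  have : DifferentiableAt ℂ (mellin fractTail) (-s) := by
    apply mellin_differentiableAt_of_isBigO_rpow (a := 0) (b := -s.re - 1)
    · refine ((MeasureTheory.locallyIntegrable_const (1 : ℝ)).mono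
        measurable_fractTail.aestronglyMeasurable
        (Filter.Eventually.of_forall fun t => ?_)).locallyIntegrableOn _
      refine (norm_fractTail_le t).trans ?_
      by_cases h : t ∈ Set.Ioi (1 : ℝ) <;> simp [h]
    · refine Asymptotics.IsBigO.of_bound 1 (Filter.Eventually.of_forall fun t => ?_)
      have := norm_fractTail_le t
      simp only [neg_zero, Real.rpow_zero, norm_one, mul_one]
      refine this.trans ?_
      by_cases h : t ∈ Set.Ioi (1 : ℝ) <;> simp [h]
    · simpa using hs
    · refine Asymptotics.IsBigO.of_bound 1 ?_
      filter_upwards [mem_nhdsWithin_of_mem_nhds (Iio_mem_nhds (show (0 : ℝ) < 1 by norm_num))] with t ht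
      have : t ∉ Set.Ioi (1 : ℝ) := by simp; exact le_of_lt ht
      simp [fractTail, this]
    · simp
  exact this.comp s differentiableAt_id.neg

lemma riemannZeta₀_eq_of_one_lt {s : ℂ} (hs : 1 < s.re) :
    riemannZeta₀ s = 1 - s * mellin fractTail (-s) := by
  have hs1 : s ≠ 1 := by rintro rfl; simp at hs
  have h0 := LSeries_eq_mul_integral' (1 : ℕ → ℂ) (r := 1) zero_le_one hs (by
    simp only [Pi.one_apply, norm_one, sum_const, Nat.card_Icc, add_tsub_cancel_right, nsmul_eq_mul, mul_one, Real.rpow_one]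
    exact Asymptotics.isBigO_refl _ _)
  rw [LSeries_one_eq_riemannZeta hs] at h0
  have hz : riemannZeta₀ s = riemannZeta s - (s - 1)⁻¹ := by simp [riemannZeta₀, hs1]
  have hm : mellin fractTail (-s) = ∫ t in Set.Ioi (1 : ℝ), ((Int.fract t : ℝ) : ℂ) * (t : ℂ) ^ (-(s + 1)) :=
    mellin_neg_eq_setIntegral s
  have hre : (-s).re < -1 := by simpa using hs
  have hinteg1 : MeasureTheory.IntegrableOn (fun t : ℝ => (t : ℂ) ^ (-s)) (Set.Ioi 1) :=
    integrableOn_Ioi_cpow_of_lt hre one_pos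
  have hinteg2 : MeasureTheory.IntegrableOn (fun t : ℝ => ((Int.fract t : ℝ) : ℂ) * (t : ℂ) ^ (-(s + 1))) (Set.Ioi 1) := by
    refine MeasureTheory.Integrable.bdd_mul (c := 1) (integrableOn_Ioi_cpow_of_lt (by simp; linarith) one_pos) ?_ ?_
    · exact (Complex.measurable_ofReal.comp measurable_fract).aestronglyMeasurable
    · refine Filter.Eventually.of_forall fun t => ?_
      rw [Complex.norm_real, Real.norm_eq_abs, abs_of_nonneg (Int.fract_nonneg t)]
      exact (Int.fract_lt_one t).le
  have hsplit : ∫ t in Set.Ioi (1 : ℝ), (∑ k ∈ Icc 1 ⌊t⌋₊, (1 : ℕ → ℂ) k) * (t : ℂ) ^ (-(s + 1))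
      = (∫ t in Set.Ioi (1 : ℝ), (t : ℂ) ^ (-s)) -
        ∫ t in Set.Ioi (1 : ℝ), ((Int.fract t : ℝ) : ℂ) * (t : ℂ) ^ (-(s + 1)) := by
    rw [← MeasureTheory.integral_sub hinteg1 hinteg2]
    refine MeasureTheory.setIntegral_congr_fun measurableSet_Ioi fun t ht => ?_
    have ht : (1 : ℝ) < t := ht
    have ht0 : (t : ℂ) ≠ 0 := by exact_mod_cast (by linarith : t ≠ 0)
    have hfl : ((⌊t⌋₊ : ℕ) : ℂ) = t - ((Int.fract t : ℝ) : ℂ) := by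
      have := natCast_floor_eq_intCast_floor (show (0:ℝ) ≤ t by linarith)
      have h3 : ((⌊t⌋₊ : ℕ) : ℝ) = t - Int.fract t := by
        rw [this]; have := Int.self_sub_fract t; linarith
      exact_mod_cast h3
    simp only [Pi.one_apply, sum_const, Nat.card_Icc, add_tsub_cancel_right, nsmul_eq_mul, mul_one]
    rw [hfl, sub_mul]
    congr 1
    rw [show -s = -(s + 1) + 1 by ring, Complex.cpow_add _ _ ht0, Complex.cpow_one, mul_comm]
  rw [hsplit, ← hm, integral_Ioi_cpow_of_lt hre one_pos] at h0
  rw [hz, h0]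
  have : s - 1 ≠ 0 := sub_ne_zero.mpr hs1
  have h' : -s + 1 ≠ 0 := by intro h; apply this; linear_combination -h
  simp only [Complex.ofReal_one, Complex.one_cpow]
  have h'' : -1 / (-s + 1) = 1 / (s - 1) := by field_simp; ring
  rw [h'']
  field_simp; ring

lemma riemannZeta₀_eq {s : ℂ} (hs : 0 < s.re) :
    riemannZeta₀ s = 1 - s * mellin fractTail (-s) := by
  have hopen : IsOpen {s : ℂ | 0 < s.re} := isOpen_lt continuous_const Complex.continuous_re
  have hconv : Convex ℝ {s : ℂ | 0 < s.re} := convex_halfSpace_re_gt 0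
  have h1 : AnalyticOnNhd ℂ riemannZeta₀ {s : ℂ | 0 < s.re} :=
    (differentiable_riemannZeta₀.differentiableOn).analyticOnNhd hopen
  have h2 : AnalyticOnNhd ℂ (fun s => 1 - s * mellin fractTail (-s)) {s : ℂ | 0 < s.re} := by
    refine DifferentiableOn.analyticOnNhd (fun s hs => ?_) hopen
    have := differentiableAt_mellin_fractTail hs
    exact ((differentiableAt_const _).sub (differentiableAt_id.mul this)).differentiableWithinAt
  refine AnalyticOnNhd.eqOn_of_preconnected_of_eventuallyEq h1 h2 hconv.isPreconnected
    (z₀ := 2) (by simp) ?_ hs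
  filter_upwards [(isOpen_lt continuous_const Complex.continuous_re).mem_nhds
    (show (2 : ℂ) ∈ {s : ℂ | 1 < s.re} by simp)] with s hs
  exact riemannZeta₀_eq_of_one_lt hs

lemma norm_riemannZeta₀_le {s : ℂ} (hs : 0 < s.re) : ‖riemannZeta₀ s‖ ≤ 1 + ‖s‖ / s.re := by
  rw [riemannZeta₀_eq hs]
  have hm : mellin fractTail (-s) = ∫ t in Set.Ioi (1 : ℝ), ((Int.fract t : ℝ) : ℂ) * (t : ℂ) ^ (-(s + 1)) :=
    mellin_neg_eq_setIntegral s
  have hb : ‖mellin fractTail (-s)‖ ≤ 1 / s.re := by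
    rw [hm]
    have hinteg : MeasureTheory.IntegrableOn (fun t : ℝ => t ^ (-(s.re + 1))) (Set.Ioi 1) :=
      integrableOn_Ioi_rpow_of_lt (by linarith) one_pos
    calc _ ≤ ∫ t in Set.Ioi (1 : ℝ), t ^ (-(s.re + 1)) := by
          refine MeasureTheory.norm_integral_le_of_norm_le hinteg ?_
          filter_upwards [MeasureTheory.ae_restrict_mem measurableSet_Ioi] with t ht
          have ht : (1 : ℝ) < t := ht
          rw [norm_mul, Complex.norm_real, Complex.norm_cpow_eq_rpow_re_of_pos (by linarith),
            Real.norm_eq_abs, abs_of_nonneg (Int.fract_nonneg t)]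
          simp only [Complex.neg_re, Complex.add_re, Complex.one_re]
          exact mul_le_of_le_one_left (by positivity) (Int.fract_lt_one t).le
      _ = 1 / s.re := by
          rw [integral_Ioi_rpow_of_lt (by linarith) one_pos]
          simp
  calc _ ≤ ‖(1 : ℂ)‖ + ‖s * mellin fractTail (-s)‖ := norm_sub_le _ _
    _ ≤ _ := by
      rw [norm_mul, norm_one, div_eq_mul_one_div]
      gcongr

open ComplexConjugate in
lemma norm_half_disc_le {G : ℂ → ℂ} {R : ℝ} (hR : 0 < R) (k : ℕ)
    (hd : DifferentiableOn ℂ G {z | ‖z‖ < R ∧ 0 < z.re})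
    (hc : ContinuousOn G {z | ‖z‖ ≤ R ∧ 0 ≤ z.re})
    (h1 : ∀ z : ℂ, ‖z‖ ≤ R → z.re = 0 → ‖G z‖ ≤ 1)
    (h2 : ∀ z : ℂ, ‖z‖ = R → 0 ≤ z.re → ‖G z‖ ≤ Real.exp k)
    {x : ℝ} (hx0 : 0 < x) (hxR : x < R) : ‖G x‖ ≤ Real.exp (2 * k * x / R) := by
  set U : Set ℂ := {z | ‖z‖ < R ∧ 0 < z.re} with hU
  have hclosed : IsClosed {z : ℂ | ‖z‖ ≤ R ∧ 0 ≤ z.re} :=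
    (isClosed_le continuous_norm continuous_const).inter
      (isClosed_le continuous_const Complex.continuous_re)
  have hopen : IsOpen U :=
    (isOpen_lt continuous_norm continuous_const).inter
      (isOpen_lt continuous_const Complex.continuous_re)
  have hcl : closure U ⊆ {z : ℂ | ‖z‖ ≤ R ∧ 0 ≤ z.re} :=
    closure_minimal (fun z hz => ⟨hz.1.le, hz.2.le⟩) hclosed
  set H : ℂ → ℂ := fun z => G z * (1 + z ^ 2 / (R : ℂ) ^ 2) ^ k * Complex.exp (-(2 * k * z / R)) with hH
  have hbdd : Bornology.IsBounded U :=
    (Metric.isBounded_ball (x := (0 : ℂ)) (r := R)).subset fun z hz => by simpa using hz.1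
  have hdiff : DiffContOnCl ℂ H U := by
    refine ⟨?_, ?_⟩
    · exact (hd.mul (by fun_prop)).mul (by fun_prop)
    · exact ((hc.mono hcl).mul (by fun_prop)).mul (by fun_prop)
  have hRc : (R : ℂ) ≠ 0 := by exact_mod_cast hR.ne'
  have hexp : ∀ z : ℂ, ‖Complex.exp (-(2 * k * z / R))‖ = Real.exp (-(2 * k * (z.re / R))) := by
    intro z
    rw [Complex.norm_exp]
    congr 1
    rw [show -(2 * (k : ℂ) * z / R) = ((-(2 * k / R) : ℝ) : ℂ) * z by push_cast; ring,
      Complex.re_ofReal_mul]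
    ring
  have hfr : ∀ z ∈ frontier U, ‖H z‖ ≤ 1 := by
    intro z hz
    have hz1 := hcl hz.1
    have hz2 : ¬ (‖z‖ < R ∧ 0 < z.re) := by
      have := hz.2; rw [hopen.interior_eq] at this; exact this
    simp only [hH, norm_mul, norm_pow, hexp]
    by_cases hre : z.re = 0
    · have hz' : z ^ 2 = ((-(z.im ^ 2) : ℝ) : ℂ) := by
        apply Complex.ext <;> simp [pow_two, hre]
      have : ‖1 + z ^ 2 / (R : ℂ) ^ 2‖ ≤ 1 := by
        rw [hz', show (1 : ℂ) + ((-(z.im ^ 2) : ℝ) : ℂ) / (R : ℂ) ^ 2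
          = ((1 - z.im ^ 2 / R ^ 2 : ℝ) : ℂ) by push_cast; ring, Complex.norm_real, Real.norm_eq_abs]
        have him : z.im ^ 2 / R ^ 2 ≤ 1 := by
          rw [div_le_one (by positivity)]
          have := (Complex.abs_im_le_norm z).trans hz1.1
          exact sq_le_sq' (by linarith [abs_le.mp this]) (abs_le.mp this).2
        have : 0 ≤ z.im ^ 2 / R ^ 2 := by positivity
        rw [abs_le]; constructor <;> linarith
      rw [hre]
      simp only [zero_div, mul_zero, neg_zero, Real.exp_zero, mul_one]
      exact mul_le_one₀ (h1 z hz1.1 hre) (by positivity) (pow_le_one₀ (norm_nonneg _) this)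
    · have hre' : 0 < z.re := lt_of_le_of_ne hz1.2 (Ne.symm hre)
      have hn : ‖z‖ = R := by
        by_contra h; exact hz2 ⟨lt_of_le_of_ne hz1.1 h, hre'⟩
      have hfac : ‖1 + z ^ 2 / (R : ℂ) ^ 2‖ = 2 * (z.re / R) := by
        have hzz : (R : ℂ) ^ 2 = z * conj z := by
          rw [Complex.mul_conj, Complex.normSq_eq_norm_sq, hn]; push_cast; rfl
        have : 1 + z ^ 2 / (R : ℂ) ^ 2 = z * ((2 * z.re : ℝ) : ℂ) / (R : ℂ) ^ 2 := by
          field_simp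
          rw [hzz, ← Complex.add_conj]; ring
        rw [this, norm_div, norm_mul, hn, norm_pow, Complex.norm_real, Complex.norm_real,
          Real.norm_eq_abs, Real.norm_eq_abs, abs_of_pos hR, abs_of_pos (by positivity)]
        field_simp
      rw [hfac]
      have hu : 0 < z.re / R := by positivity
      have key : 2 * (z.re / R) ≤ Real.exp (2 * (z.re / R) - 1) := by
        have := Real.add_one_le_exp (2 * (z.re / R) - 1); linarith
      calc ‖G z‖ * (2 * (z.re / R)) ^ k * Real.exp (-(2 * k * (z.re / R)))
          ≤ Real.exp k * (Real.exp (2 * (z.re / R) - 1)) ^ k * Real.exp (-(2 * k * (z.re / R))) := by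
            gcongr
            exact h2 z hn hre'.le
        _ = 1 := by
            rw [← Real.exp_nat_mul, ← Real.exp_add, ← Real.exp_add,
              show (k : ℝ) + k * (2 * (z.re / R) - 1) + -(2 * k * (z.re / R)) = 0 by ring,
              Real.exp_zero]
  have hxU : (x : ℂ) ∈ U := by
    refine ⟨?_, by simpa using hx0⟩
    rw [Complex.norm_real, Real.norm_eq_abs, abs_of_pos hx0]; exact hxR
  have hfin := Complex.norm_le_of_forall_mem_frontier_norm_le hbdd hdiff hfr (subset_closure hxU)
  simp only [hH, norm_mul, norm_pow, hexp, Complex.ofReal_re] at hfin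
  have hone : 1 ≤ ‖1 + (x : ℂ) ^ 2 / (R : ℂ) ^ 2‖ := by
    rw [show (1 : ℂ) + (x : ℂ) ^ 2 / (R : ℂ) ^ 2 = ((1 + x ^ 2 / R ^ 2 : ℝ) : ℂ) by push_cast; ring,
      Complex.norm_real, Real.norm_eq_abs, abs_of_pos (by positivity)]
    have : 0 ≤ x ^ 2 / R ^ 2 := by positivity
    linarith
  have h3 : ‖G x‖ * Real.exp (-(2 * k * (x / R))) ≤ 1 := by
    refine le_trans ?_ hfin
    gcongr
    exact le_mul_of_one_le_right (norm_nonneg _) (one_le_pow₀ hone)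
  rw [Real.exp_neg, ← div_eq_mul_inv, div_le_one (Real.exp_pos _)] at h3
  rwa [show 2 * (k : ℝ) * x / R = 2 * k * (x / R) by ring]

open ComplexConjugate in
/-- The reflection `z ↦ conj (f (-conj z))`. -/
noncomputable def reflect (f : ℂ → ℂ) (z : ℂ) : ℂ := conj (f (-conj z))

open ComplexConjugate in
lemma differentiable_reflect {f : ℂ → ℂ} (hf : Differentiable ℂ f) : Differentiable ℂ (reflect f) := by
  have h1 : Differentiable ℂ (fun z => f (-z)) := hf.comp differentiable_neg
  intro z
  have h2 : DifferentiableAt ℂ (fun z => f (-z)) (conj z) := h1 _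
  have h3 := h2.conj_conj
  rw [Complex.conj_conj] at h3
  exact h3

lemma norm_reflect_of_re_eq_zero (f : ℂ → ℂ) {z : ℂ} (hz : z.re = 0) : ‖reflect f z‖ = ‖f z‖ := by
  have : -(starRingEnd ℂ) z = z := by apply Complex.ext <;> simp [hz]
  simp [reflect, this]

lemma hasDerivAt_log_norm {f : ℂ → ℂ} (hf : DifferentiableAt ℂ f 0) (h0 : f 0 ≠ 0) :
    HasDerivAt (fun x : ℝ => Real.log ‖f x‖) (deriv f 0 / f 0).re 0 := by
  have h1 : HasDerivAt (fun x : ℝ => f x) (deriv f 0) 0 := by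
    have := hf.hasDerivAt
    have h2 : HasDerivAt f (deriv f 0) ((0 : ℝ) : ℂ) := by simpa using this
    exact h2.comp_ofReal
  have h2 := h1.norm_sq
  have hne : ‖f ((0 : ℝ) : ℂ)‖ ^ 2 ≠ 0 := by simpa using h0
  have h3 := (h2.log hne).const_mul (1 / 2)
  have hfun : (fun x : ℝ => Real.log ‖f x‖) = fun x : ℝ => 1 / 2 * Real.log (‖f x‖ ^ 2) := by
    ext x; rw [Real.log_pow]; push_cast; ring
  rw [hfun]
  refine h3.congr_deriv ?_
  simp only [Complex.ofReal_zero]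
  rw [Complex.inner, ← Complex.normSq_eq_norm_sq, Complex.div_re, Complex.mul_re, Complex.conj_re,
    Complex.conj_im]
  field_simp
  ring

lemma nonneg_of_hasDerivAt_zero {g : ℝ → ℝ} {d δ : ℝ} (hδ : 0 < δ) (hg : HasDerivAt g d 0)
    (h0 : g 0 = 0) (hpos : ∀ x, 0 < x → x < δ → 0 ≤ g x) : 0 ≤ d := by
  refine ge_of_tendsto hg.tendsto_slope_zero_right ?_
  filter_upwards [Ioo_mem_nhdsGT hδ] with x hx
  simp only [zero_add, h0, sub_zero, smul_eq_mul]
  exact mul_nonneg (by have := hx.1; positivity) (hpos x hx.1 hx.2)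

lemma hasDerivAt_log_norm_neg {f : ℂ → ℂ} (hf : DifferentiableAt ℂ f 0) (h0 : f 0 ≠ 0) :
    HasDerivAt (fun x : ℝ => Real.log ‖f (-x : ℂ)‖) (-(deriv f 0 / f 0).re) 0 := by
  have h : HasDerivAt (fun x : ℝ => Real.log ‖f x‖) (deriv f 0 / f 0).re (-(0 : ℝ)) := by
    simpa using hasDerivAt_log_norm hf h0
  have h2 := h.scomp (0 : ℝ) (hasDerivAt_neg (0 : ℝ))
  have hfun : (fun x : ℝ => Real.log ‖f (-x : ℂ)‖) =
      (fun x : ℝ => Real.log ‖f x‖) ∘ fun x : ℝ => -x := by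
    ext x; simp
  rw [hfun]
  refine h2.congr_deriv ?_
  simp

lemma exists_ne_zero_near {f : ℂ → ℂ} (hf : Differentiable ℂ f) (h0 : f 0 ≠ 0) :
    ∃ δ > 0, ∀ x : ℝ, 0 < x → x < δ → f (-x : ℂ) ≠ 0 := by
  have h1 : ∀ᶠ z in nhds (0 : ℂ), f z ≠ 0 := hf.continuous.continuousAt.eventually_ne h0
  obtain ⟨δ, hδ, h⟩ := Metric.eventually_nhds_iff.mp h1
  refine ⟨δ, hδ, fun x hx hxδ => h ?_⟩
  rw [dist_zero_right, norm_neg, Complex.norm_real, Real.norm_eq_abs, abs_of_pos hx]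
  exact hxδ

/-- Lower bound for the real part of the logarithmic derivative at the centre of a disc whose
right half contains no zeros. -/
lemma re_logDeriv_ge {f : ℂ → ℂ} (hf : Differentiable ℂ f) {R : ℝ} (hR : 0 < R) (k : ℕ)
    (hne : ∀ z : ℂ, ‖z‖ ≤ R → 0 ≤ z.re → f z ≠ 0)
    (hb : ∀ z : ℂ, ‖z‖ = R → 0 ≤ z.re → ‖reflect f z‖ ≤ Real.exp k * ‖f z‖) :
    -(k / R) ≤ (deriv f 0 / f 0).re := by
  have hf0 : f 0 ≠ 0 := hne 0 (by simpa using hR.le) (by simp)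
  have hmain : ∀ x : ℝ, 0 < x → x < R → ‖f (-x : ℂ)‖ / ‖f x‖ ≤ Real.exp (2 * k * x / R) := by
    intro x hx0 hxR
    have := norm_half_disc_le (G := fun z => reflect f z / f z) hR k
      (fun z hz => ((differentiable_reflect hf z).div (hf z) (hne z hz.1.le hz.2.le)).differentiableWithinAt)
      ((differentiable_reflect hf).continuous.continuousOn.div hf.continuous.continuousOn
        fun z hz => hne z hz.1 hz.2)
      (fun z hz hz0 => by
        rw [norm_div, norm_reflect_of_re_eq_zero f hz0]; exact div_self_le_one _)
      (fun z hz hz0 => by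
        rw [norm_div, div_le_iff₀ (norm_pos_iff.mpr (hne z hz.le hz0))]; exact hb z hz hz0) hx0 hxR
    simpa [reflect] using this
  have hder : HasDerivAt (fun x : ℝ => 2 * k / R * x - Real.log ‖f (-x : ℂ)‖ + Real.log ‖f x‖)
      (2 * k / R - -(deriv f 0 / f 0).re + (deriv f 0 / f 0).re) 0 := by
    have h1 : HasDerivAt (fun x : ℝ => 2 * k / R * x) (2 * k / R) 0 := by
      simpa using (hasDerivAt_id (0 : ℝ)).const_mul (2 * k / R)
    exact (h1.sub (hasDerivAt_log_norm_neg (hf 0) hf0)).add (hasDerivAt_log_norm (hf 0) hf0)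
  obtain ⟨δ, hδ, hδne⟩ := exists_ne_zero_near hf hf0
  have := nonneg_of_hasDerivAt_zero (lt_min hR hδ) hder (by simp) (fun x hx0 hxR => by
    have hxR' := hxR.trans_le (min_le_left _ _)
    have h1 := hmain x hx0 hxR'
    have hx1 : 0 < ‖f x‖ := norm_pos_iff.mpr (hne x (by
      rw [Complex.norm_real, Real.norm_eq_abs, abs_of_pos hx0]; exact hxR'.le) (by simpa using hx0.le))
    have hz : 0 < ‖f (-x : ℂ)‖ := norm_pos_iff.mpr (hδne x hx0 (hxR.trans_le (min_le_right _ _)))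
    have h2 := Real.log_le_log (by positivity) h1
    rw [Real.log_exp, Real.log_div hz.ne' hx1.ne'] at h2
    have : 2 * k * x / R = 2 * k / R * x := by ring
    linarith)
  have h3 : (2 : ℝ) * k / R = 2 * (k / R) := by ring
  linarith

/-- Lower bound for the real part of the logarithmic derivative at the centre of a disc whose
right half contains no zeros, taking into account a zero on the horizontal radius to the left. -/
lemma re_logDeriv_ge_of_zero {f : ℂ → ℂ} (hf : Differentiable ℂ f) {R : ℝ} (hR : 0 < R) (k : ℕ)
    (hne : ∀ z : ℂ, ‖z‖ ≤ R → 0 ≤ z.re → f z ≠ 0)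
    (hb : ∀ z : ℂ, ‖z‖ = R → 0 ≤ z.re → ‖reflect f z‖ ≤ Real.exp k * ‖f z‖)
    {a : ℝ} (ha : 0 < a) (haR : a ≤ R / 2) (hfa : f (-a : ℂ) = 0) :
    1 / a - ((k + 2 : ℕ) / R) ≤ (deriv f 0 / f 0).re := by
  have hf0 : f 0 ≠ 0 := hne 0 (by simpa using hR.le) (by simp)
  set q : ℂ → ℂ := dslope (reflect f) a with hq
  have hqd : Differentiable ℂ q := by
    have := (Complex.differentiableOn_dslope (s := Set.univ) (c := (a : ℂ)) (f := reflect f)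
      Filter.univ_mem).mpr (differentiable_reflect hf).differentiableOn
    exact differentiableOn_univ.mp this
  have hra : reflect f a = 0 := by simp [reflect, hfa]
  have hqz : ∀ z : ℂ, z ≠ a → q z = reflect f z / (z - a) := by
    intro z hz
    rw [hq, dslope_of_ne _ hz, slope_def_field, hra, sub_zero]
  have hqn : ∀ z : ℂ, z ≠ a → ‖q z‖ * ‖z - a‖ = ‖reflect f z‖ := by
    intro z hz
    rw [hqz z hz, norm_div, div_mul_cancel₀]
    exact norm_ne_zero_iff.mpr (sub_ne_zero.mpr hz)
  have hmain : ∀ x : ℝ, 0 < x → x < a →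
      ‖f (-x : ℂ)‖ / (a - x) * (a + x) / ‖f x‖ ≤ Real.exp (2 * (k + 2 : ℕ) * x / R) := by
    intro x hx0 hxa
    have := norm_half_disc_le (G := fun z => q z * (z + a) / f z) hR (k + 2)
      (fun z hz => (((hqd z).mul (by fun_prop)).div (hf z)
        (hne z hz.1.le hz.2.le)).differentiableWithinAt)
      ((hqd.continuous.continuousOn.mul (by fun_prop)).div hf.continuous.continuousOn
        fun z hz => hne z hz.1 hz.2)
      (fun z hz hz0 => by
        have hza : z ≠ a := by
          intro h; rw [h] at hz0; simp at hz0; exact ha.ne' hz0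
        have h1 : ‖z + a‖ = ‖z - a‖ := by
          rw [← sq_eq_sq₀ (norm_nonneg _) (norm_nonneg _), ← Complex.normSq_eq_norm_sq,
            ← Complex.normSq_eq_norm_sq, Complex.normSq_apply, Complex.normSq_apply]
          simp [hz0]
        rw [norm_div, norm_mul, h1, hqn z hza, norm_reflect_of_re_eq_zero f hz0]
        exact div_self_le_one _)
      (fun z hz hz0 => by
        have h1 : ‖z + a‖ ≤ R + a := by
          refine (norm_add_le _ _).trans ?_
          rw [hz, Complex.norm_real, Real.norm_eq_abs, abs_of_pos ha]
        have h2 : R - a ≤ ‖z - a‖ := by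
          refine le_trans ?_ (norm_sub_norm_le _ _)
          rw [hz, Complex.norm_real, Real.norm_eq_abs, abs_of_pos ha]
        have hza : z ≠ a := by
          intro h; rw [h] at h2; simp at h2; linarith
        have hexp2 : (3 : ℝ) ≤ Real.exp 2 := by
          have := Real.add_one_le_exp (2 : ℝ); linarith
        have h3 : ‖z + a‖ ≤ Real.exp 2 * ‖z - a‖ := by nlinarith
        rw [norm_div, norm_mul, div_le_iff₀ (norm_pos_iff.mpr (hne z hz.le hz0))]
        calc ‖q z‖ * ‖z + a‖ ≤ ‖q z‖ * (Real.exp 2 * ‖z - a‖) := by gcongr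
          _ = Real.exp 2 * ‖reflect f z‖ := by rw [← hqn z hza]; ring
          _ ≤ Real.exp 2 * (Real.exp k * ‖f z‖) := by gcongr; exact hb z hz hz0
          _ = Real.exp (k + 2 : ℕ) * ‖f z‖ := by push_cast; rw [Real.exp_add]; ring)
        hx0 (by linarith)
    have hxa' : (x : ℂ) ≠ a := by exact_mod_cast hxa.ne
    refine le_trans (le_of_eq ?_) this
    rw [norm_div, norm_mul, hqz _ hxa', norm_div, ← Complex.ofReal_sub, ← Complex.ofReal_add,
      Complex.norm_real, Complex.norm_real, Real.norm_eq_abs, Real.norm_eq_abs,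
      abs_of_neg (by linarith), abs_of_pos (by linarith), neg_sub, add_comm x a]
    simp [reflect]
  have hder : HasDerivAt (fun x : ℝ => 2 * (k + 2 : ℕ) / R * x + Real.log (a - x) - Real.log (a + x)
      - Real.log ‖f (-x : ℂ)‖ + Real.log ‖f x‖)
      (2 * (k + 2 : ℕ) / R + (-1) / (a - 0) - 1 / (a + 0) - -(deriv f 0 / f 0).re
        + (deriv f 0 / f 0).re) 0 := by
    have h1 : HasDerivAt (fun x : ℝ => 2 * (k + 2 : ℕ) / R * x) (2 * (k + 2 : ℕ) / R) 0 := by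
      simpa using (hasDerivAt_id (0 : ℝ)).const_mul (2 * ((k + 2 : ℕ) : ℝ) / R)
    have h2 : HasDerivAt (fun x : ℝ => Real.log (a - x)) ((-1) / (a - 0)) 0 :=
      ((hasDerivAt_id (0 : ℝ)).const_sub a).log (by simpa using ha.ne')
    have h3 : HasDerivAt (fun x : ℝ => Real.log (a + x)) (1 / (a + 0)) 0 :=
      ((hasDerivAt_id (0 : ℝ)).const_add a).log (by simpa using ha.ne')
    exact (((h1.add h2).sub h3).sub (hasDerivAt_log_norm_neg (hf 0) hf0)).add
      (hasDerivAt_log_norm (hf 0) hf0)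
  obtain ⟨δ, hδ, hδne⟩ := exists_ne_zero_near hf hf0
  have := nonneg_of_hasDerivAt_zero (lt_min ha hδ) hder (by simp) (fun x hx0 hxR => by
    have hxa := hxR.trans_le (min_le_left _ _)
    have h1 := hmain x hx0 hxa
    have hx1 : 0 < ‖f x‖ := norm_pos_iff.mpr (hne x (by
      rw [Complex.norm_real, Real.norm_eq_abs, abs_of_pos hx0]; linarith) (by simpa using hx0.le))
    have hz : 0 < ‖f (-x : ℂ)‖ := norm_pos_iff.mpr (hδne x hx0 (hxR.trans_le (min_le_right _ _)))
    have hax : 0 < a - x := by linarith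
    have h2 := Real.log_le_log (by positivity) h1
    rw [Real.log_exp, Real.log_div (by positivity) hx1.ne', Real.log_mul (by positivity)
      (by positivity), Real.log_div hz.ne' hax.ne'] at h2
    have : 2 * ((k + 2 : ℕ) : ℝ) * x / R = 2 * ((k + 2 : ℕ) : ℝ) / R * x := by ring
    linarith)
  have h3 : (2 : ℝ) * ((k + 2 : ℕ) : ℝ) / R = 2 * (((k + 2 : ℕ) : ℝ) / R) := by ring
  have h4 : (-1) / (a - 0) = -(1 / a) := by rw [sub_zero]; ring
  rw [add_zero, h4, h3] at this
  linarith

lemma riemannZeta₁_eq_mul {s : ℂ} (hs : s ≠ 1) : riemannZeta₁ s = (s - 1) * riemannZeta s := by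
  rw [riemannZeta_eq_inv_sub_mul hs, ← mul_assoc, mul_inv_cancel₀ (sub_ne_zero.mpr hs), one_mul]

lemma riemannZeta₁_ne_zero_of_one_le_re {s : ℂ} (hs : 1 ≤ s.re) : riemannZeta₁ s ≠ 0 := by
  by_cases h : s = 1
  · rw [h, riemannZeta₁_one]; exact one_ne_zero
  · rw [riemannZeta₁_eq_mul h]
    exact mul_ne_zero (sub_ne_zero.mpr h) (riemannZeta_ne_zero_of_one_le_re hs)

lemma norm_riemannZeta₁_le {s : ℂ} {V : ℝ} (h1 : 1 / 2 ≤ s.re) (h2 : s.re ≤ 3) (hV : 3 + |s.im| ≤ V) :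
    ‖riemannZeta₁ s‖ ≤ V ^ 3 := by
  have h0 := norm_riemannZeta₀_le (s := s) (by linarith)
  have hn : ‖s‖ ≤ V := by
    have := Complex.norm_le_abs_re_add_abs_im s
    rw [abs_of_pos (by linarith : 0 < s.re)] at this
    linarith
  have hn1 : ‖s - 1‖ ≤ V := by
    have := Complex.norm_le_abs_re_add_abs_im (s - 1)
    simp only [Complex.sub_re, Complex.one_re, Complex.sub_im, Complex.one_im, sub_zero] at this
    have h3 : |s.re - 1| ≤ 3 := abs_le.mpr ⟨by linarith, by linarith⟩
    linarith
  have hV3 : 3 ≤ V := by linarith [abs_nonneg s.im]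
  have h4 : ‖riemannZeta₀ s‖ ≤ 1 + 2 * V := by
    refine h0.trans ?_
    have : ‖s‖ / s.re ≤ 2 * V := by
      rw [div_le_iff₀ (by linarith)]
      nlinarith
    linarith
  calc ‖riemannZeta₁ s‖ ≤ 1 + ‖s - 1‖ * ‖riemannZeta₀ s‖ := by
        unfold riemannZeta₁
        refine (norm_add_le _ _).trans ?_
        rw [norm_one, norm_mul]
    _ ≤ 1 + V * (1 + 2 * V) := by gcongr
    _ ≤ V ^ 3 := by nlinarith [mul_nonneg (sub_nonneg.mpr hV3) (sq_nonneg V)]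

lemma norm_riemannZeta_ofReal_le {σ : ℝ} (h1 : 1 < σ) (h2 : σ ≤ 2) :
    ‖riemannZeta σ‖ ≤ 3 / (σ - 1) := by
  have hne : (σ : ℂ) ≠ 1 := by exact_mod_cast h1.ne'
  have h0 := norm_riemannZeta₀_le (s := (σ : ℂ)) (by simpa using by linarith)
  have h3 : riemannZeta σ = riemannZeta₀ σ + ((σ : ℂ) - 1)⁻¹ := by
    rw [riemannZeta₀, if_neg hne]; ring
  have hpos : 0 < σ - 1 := by linarith
  rw [Complex.norm_real, Complex.ofReal_re, Real.norm_eq_abs, abs_of_pos (by linarith),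
    div_self (by linarith)] at h0
  rw [h3]
  refine (norm_add_le _ _).trans ?_
  rw [norm_inv, ← Complex.ofReal_one, ← Complex.ofReal_sub, Complex.norm_real, Real.norm_eq_abs,
    abs_of_pos hpos, le_div_iff₀ hpos, add_mul, inv_mul_cancel₀ hpos.ne']
  nlinarith

lemma norm_riemannZeta_ge {s : ℂ} (h1 : 1 < s.re) (h2 : s.re ≤ 2) :
    (s.re - 1) / 3 ≤ ‖riemannZeta s‖ := by
  have hmul := ArithmeticFunction.LSeries_zeta_mul_Lseries_moebius h1
  rw [ArithmeticFunction.LSeries_zeta_eq_riemannZeta h1] at hmul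
  have hsum := ArithmeticFunction.LSeriesSummable_zeta_iff.mpr
    (show 1 < ((s.re : ℝ) : ℂ).re by simpa using h1)
  have hle : ‖LSeries (fun n => ((ArithmeticFunction.moebius n : ℤ) : ℂ)) s‖ ≤ 3 / (s.re - 1) := by
    refine le_trans ?_ (norm_riemannZeta_ofReal_le h1 h2)
    have hterm : ∀ n, ‖LSeries.term (fun n => ((ArithmeticFunction.moebius n : ℤ) : ℂ)) s n‖ ≤
        ‖LSeries.term (fun n => ((ArithmeticFunction.zeta n : ℕ) : ℂ)) s.re n‖ := by
      intro n
      rcases Nat.eq_zero_or_pos n with rfl | hn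
      · simp
      rw [LSeries.norm_term_eq, LSeries.norm_term_eq, if_neg hn.ne', if_neg hn.ne', Complex.ofReal_re]
      gcongr
      rw [ArithmeticFunction.zeta_apply, if_neg hn.ne', Complex.norm_intCast]
      simpa using by exact_mod_cast ArithmeticFunction.abs_moebius_le_one (n := n)
    have h3 : ∀ n, LSeries.term (fun n => ((ArithmeticFunction.zeta n : ℕ) : ℂ)) s.re n =
        ((‖LSeries.term (fun n => ((ArithmeticFunction.zeta n : ℕ) : ℂ)) s.re n‖ : ℝ) : ℂ) := by
      intro n
      rcases Nat.eq_zero_or_pos n with rfl | hn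
      · simp
      rw [LSeries.norm_term_eq, if_neg hn.ne', LSeries.term_of_ne_zero hn.ne',
        ArithmeticFunction.zeta_apply, if_neg hn.ne', Complex.ofReal_re]
      push_cast [Complex.ofReal_cpow (Nat.cast_nonneg n)]
      simp
    rw [← ArithmeticFunction.LSeries_zeta_eq_riemannZeta (by simpa using h1)]
    unfold LSeries
    have hs2 : Summable fun n => ‖LSeries.term (fun n => ((ArithmeticFunction.zeta n : ℕ) : ℂ)) s.re n‖ :=
      hsum.norm
    rw [tsum_congr h3, ← Complex.ofReal_tsum, Complex.norm_real,
      Real.norm_eq_abs, abs_of_nonneg (tsum_nonneg fun _ => norm_nonneg _)]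
    have hs3 := Summable.of_nonneg_of_le (fun _ => norm_nonneg _) hterm hs2
    exact (norm_tsum_le_tsum_norm hs3).trans (hs3.tsum_le_tsum hterm hs2)
  have h4 : 1 = ‖riemannZeta s‖ * ‖LSeries (fun n => ((ArithmeticFunction.moebius n : ℤ) : ℂ)) s‖ := by
    rw [← norm_mul, hmul, norm_one]
  have hpos : 0 < s.re - 1 := by linarith
  have h5 : 1 ≤ ‖riemannZeta s‖ * (3 / (s.re - 1)) :=
    h4.le.trans (mul_le_mul_of_nonneg_left hle (norm_nonneg _))
  rw [div_le_iff₀ (by norm_num)]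
  rw [mul_div_assoc', le_div_iff₀ hpos] at h5
  linarith

lemma norm_riemannZeta₁_ge {s : ℂ} {δ : ℝ} (hδ : 0 < δ) (h1 : 1 + δ ≤ s.re) (h2 : s.re ≤ 2) :
    δ ^ 2 / 3 ≤ ‖riemannZeta₁ s‖ := by
  have hne : s ≠ 1 := by rintro rfl; simp at h1; linarith
  rw [riemannZeta₁_eq_mul hne, norm_mul]
  have h3 := norm_riemannZeta_ge (s := s) (by linarith) h2
  have h4 : δ ≤ ‖s - 1‖ := by
    have := Complex.abs_re_le_norm (s - 1)
    simp only [Complex.sub_re, Complex.one_re] at this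
    have h5 := le_abs_self (s.re - 1)
    linarith
  calc δ ^ 2 / 3 = δ * (δ / 3) := by ring
    _ ≤ ‖s - 1‖ * ‖riemannZeta s‖ := by
      gcongr; linarith

/-- The logarithmic derivative of `(s - 1) ζ(s)`. -/
noncomputable def logDerivZeta₁ (s : ℂ) : ℂ := deriv riemannZeta₁ s / riemannZeta₁ s

lemma LSeries_vonMangoldt_eq {s : ℂ} (hs : 1 < s.re) :
    LSeries (fun n => (ArithmeticFunction.vonMangoldt n : ℂ)) s = 1 / (s - 1) - logDerivZeta₁ s := by
  have hne : s ≠ 1 := by rintro rfl; simp at hs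
  have hne' : s - 1 ≠ 0 := sub_ne_zero.mpr hne
  have hz := riemannZeta_ne_zero_of_one_le_re hs.le
  rw [ArithmeticFunction.LSeries_vonMangoldt_eq_deriv_riemannZeta_div hs, logDerivZeta₁]
  have hd : deriv riemannZeta₁ s = riemannZeta s + (s - 1) * deriv riemannZeta s := by
    have h1 : riemannZeta₁ =ᶠ[nhds s] fun z => (z - 1) * riemannZeta z := by
      filter_upwards [isOpen_ne.mem_nhds hne] with z hz using riemannZeta₁_eq_mul hz
    rw [h1.deriv_eq]
    have h2 := ((hasDerivAt_id s).sub_const 1).mul (differentiableAt_riemannZeta hne).hasDerivAt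
    have h3 := h2.deriv
    simp only [id_eq, one_mul] at h3
    exact h3
  rw [hd, riemannZeta₁_eq_mul hne]
  field_simp
  ring

lemma three_four_one (σ t : ℝ) (hσ : 1 < σ) :
    0 ≤ 3 * (LSeries (fun n => (ArithmeticFunction.vonMangoldt n : ℂ)) σ).re
      + 4 * (LSeries (fun n => (ArithmeticFunction.vonMangoldt n : ℂ)) (σ + t * Complex.I)).re
      + (LSeries (fun n => (ArithmeticFunction.vonMangoldt n : ℂ)) (σ + 2 * t * Complex.I)).re := by
  have hs : ∀ u : ℂ, 1 < u.re →
      Summable (LSeries.term (fun n => (ArithmeticFunction.vonMangoldt n : ℂ)) u) :=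
    fun u hu => ArithmeticFunction.LSeriesSummable_vonMangoldt hu
  have h1 := hs σ (by simpa using hσ)
  have h2 := hs (σ + t * Complex.I) (by simpa using hσ)
  have h3 := hs (σ + 2 * t * Complex.I) (by simpa using hσ)
  unfold LSeries
  rw [Complex.re_tsum h1, Complex.re_tsum h2, Complex.re_tsum h3]
  have h1' := (Complex.reCLM.summable h1)
  have h2' := (Complex.reCLM.summable h2)
  have h3' := (Complex.reCLM.summable h3)
  simp only [Complex.reCLM_apply] at h1' h2' h3'
  rw [← tsum_mul_left, ← tsum_mul_left, ← (h1'.mul_left 3).tsum_add (h2'.mul_left 4),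
    ← ((h1'.mul_left 3).add (h2'.mul_left 4)).tsum_add h3']
  refine tsum_nonneg fun n => ?_
  rcases Nat.eq_zero_or_pos n with rfl | hn
  · simp
  have hnc : (n : ℂ) ≠ 0 := by exact_mod_cast hn.ne'
  rw [LSeries.term_of_ne_zero hn.ne', LSeries.term_of_ne_zero hn.ne', LSeries.term_of_ne_zero hn.ne']
  set w : ℂ := (n : ℂ) ^ (-(t * Complex.I)) with hw
  have e1 : ((n : ℂ) ^ (σ + t * Complex.I))⁻¹ = ((n ^ (-σ) : ℝ) : ℂ) * w := by
    rw [← Complex.cpow_neg, neg_add, Complex.cpow_add _ _ hnc, hw,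
      Complex.ofReal_cpow (Nat.cast_nonneg n)]
    simp
  have e0 : ((n : ℂ) ^ (σ : ℂ))⁻¹ = ((n ^ (-σ) : ℝ) : ℂ) := by
    rw [← Complex.cpow_neg, Complex.ofReal_cpow (Nat.cast_nonneg n)]
    simp
  have e2 : ((n : ℂ) ^ (σ + 2 * t * Complex.I))⁻¹ = ((n ^ (-σ) : ℝ) : ℂ) * w ^ 2 := by
    rw [← Complex.cpow_neg, neg_add, Complex.cpow_add _ _ hnc, hw,
      Complex.ofReal_cpow (Nat.cast_nonneg n), ← Complex.cpow_nat_mul]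
    simp; left; congr 1; ring
  have hwn : w.re ^ 2 + w.im ^ 2 = 1 := by
    have : ‖w‖ = 1 := by
      rw [hw, Complex.norm_natCast_cpow_of_pos hn]; simp
    rw [pow_two, pow_two, ← Complex.normSq_apply, Complex.normSq_eq_norm_sq, this]; norm_num
  rw [div_eq_mul_inv, div_eq_mul_inv, div_eq_mul_inv, e0, e1, e2, ← mul_assoc, ← mul_assoc,
    ← Complex.ofReal_mul, Complex.re_ofReal_mul, Complex.re_ofReal_mul, Complex.ofReal_re]
  have hA : 0 ≤ ArithmeticFunction.vonMangoldt n * (n : ℝ) ^ (-σ) :=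
    mul_nonneg ArithmeticFunction.vonMangoldt_nonneg (by positivity)
  have hre2 : (w ^ 2).re = w.re ^ 2 - w.im ^ 2 := by rw [pow_two, Complex.mul_re]; ring
  rw [hre2]
  nlinarith [mul_nonneg hA (sq_nonneg (1 + w.re))]

section
variable {δ γ : ℝ} {k : ℕ}

lemma translate_zeta_hyps (hδ : 0 < δ) (hδ2 : δ ≤ 1 / 2)
    (hk : (|γ| + 4) ^ 3 ≤ Real.exp k * (δ ^ 2 / 3)) :
    Differentiable ℂ (fun z => riemannZeta₁ (((1 + δ : ℝ) + γ * Complex.I) + z)) ∧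
    (∀ z : ℂ, ‖z‖ ≤ 1 / 2 → 0 ≤ z.re → riemannZeta₁ (((1 + δ : ℝ) + γ * Complex.I) + z) ≠ 0) ∧
    (∀ z : ℂ, ‖z‖ = 1 / 2 → 0 ≤ z.re →
      ‖reflect (fun z => riemannZeta₁ (((1 + δ : ℝ) + γ * Complex.I) + z)) z‖ ≤
        Real.exp k * ‖riemannZeta₁ (((1 + δ : ℝ) + γ * Complex.I) + z)‖) := by
  refine ⟨differentiable_riemannZeta₁.comp (by fun_prop), fun z _ hz => ?_, fun z hz hz0 => ?_⟩
  · refine riemannZeta₁_ne_zero_of_one_le_re ?_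
    simp; linarith
  · have h1 := Complex.abs_re_le_norm z
    have h2 := Complex.abs_im_le_norm z
    rw [hz] at h1 h2
    have h1' := abs_le.mp h1
    have h2' := abs_le.mp h2
    have hlow : δ ^ 2 / 3 ≤ ‖riemannZeta₁ (((1 + δ : ℝ) + γ * Complex.I) + z)‖ := by
      refine norm_riemannZeta₁_ge hδ ?_ ?_
      · simp; linarith
      · simp; linarith
    have hup : ‖reflect (fun z => riemannZeta₁ (((1 + δ : ℝ) + γ * Complex.I) + z)) z‖ ≤
        (|γ| + 4) ^ 3 := by
      unfold reflect
      rw [Complex.norm_conj]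
      refine norm_riemannZeta₁_le ?_ ?_ ?_
      · simp; linarith
      · simp; linarith
      · simp
        have := abs_add_le γ z.im
        linarith
    calc _ ≤ _ := hup
      _ ≤ _ := hk
      _ ≤ _ := by gcongr

lemma re_logDerivZeta₁_ge (hδ : 0 < δ) (hδ2 : δ ≤ 1 / 2)
    (hk : (|γ| + 4) ^ 3 ≤ Real.exp k * (δ ^ 2 / 3)) :
    -(2 * k) ≤ (logDerivZeta₁ ((1 + δ : ℝ) + γ * Complex.I)).re := by
  obtain ⟨h1, h2, h3⟩ := translate_zeta_hyps hδ hδ2 hk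
  have := re_logDeriv_ge h1 (by norm_num : (0 : ℝ) < 1 / 2) k h2 h3
  rw [deriv_comp_const_add, add_zero] at this
  unfold logDerivZeta₁
  linarith

lemma re_logDerivZeta₁_ge_of_zero (hδ : 0 < δ) (hδ2 : δ ≤ 1 / 2)
    (hk : (|γ| + 4) ^ 3 ≤ Real.exp k * (δ ^ 2 / 3)) {a : ℝ} (ha : 0 < a) (ha2 : a ≤ 1 / 4)
    (hz : riemannZeta₁ ((1 + δ : ℝ) + γ * Complex.I + (-a : ℂ)) = 0) :
    1 / a - 2 * (k + 2) ≤ (logDerivZeta₁ ((1 + δ : ℝ) + γ * Complex.I)).re := by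
  obtain ⟨h1, h2, h3⟩ := translate_zeta_hyps hδ hδ2 hk
  have := re_logDeriv_ge_of_zero h1 (by norm_num : (0 : ℝ) < 1 / 2) k h2 h3 ha (by linarith) hz
  rw [deriv_comp_const_add, add_zero] at this
  unfold logDerivZeta₁
  push_cast at this ⊢
  linarith

end

lemma re_inv_le {δ γ : ℝ} (hδ : 0 < δ) (hγ : 1 ≤ |γ|) :
    (1 / (((1 + δ : ℝ) : ℂ) + γ * Complex.I - 1)).re ≤ δ := by
  have : ((1 + δ : ℝ) : ℂ) + γ * Complex.I - 1 = (δ : ℂ) + γ * Complex.I := by push_cast; ring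
  rw [this, Complex.div_re]
  simp only [Complex.one_re, Complex.one_im, Complex.normSq_apply]
  simp
  have h1 : 1 ≤ γ ^ 2 := by rw [← sq_abs]; nlinarith
  rw [div_le_iff₀ (by nlinarith)]
  nlinarith [mul_pos hδ hδ]

/-- The zero-free region away from the real axis, in terms of a parameter. -/
lemma re_le_of_zero {δ γ β : ℝ} {k : ℕ} (hδ : 0 < δ) (hδ2 : δ ≤ 1 / 8) (hγ : 1 ≤ |γ|)
    (hk : (2 * |γ| + 4) ^ 3 ≤ Real.exp k * (δ ^ 2 / 3))
    (hδk : δ * (16 * k + 17) ≤ 1 / 2)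
    (hz : riemannZeta₁ (β + γ * Complex.I) = 0) : β ≤ 1 - δ / 7 := by
  by_contra! hβ
  have hβ1 : β < 1 := by
    by_contra! h
    exact riemannZeta₁_ne_zero_of_one_le_re (s := β + γ * Complex.I) (by simpa using h) hz
  have ha : 0 < 1 + δ - β := by linarith
  have h341 := three_four_one (1 + δ) γ (by linarith)
  have hγ0 := abs_nonneg γ
  have hp0 := re_logDerivZeta₁_ge (γ := 0) hδ (by linarith) (k := k) (by
    refine le_trans ?_ hk; gcongr; simp)
  have hp1 := re_logDerivZeta₁_ge_of_zero (γ := γ) hδ (by linarith) (k := k) (by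
    refine le_trans ?_ hk; gcongr; linarith) ha (by linarith) (by
      rw [← hz]; congr 1; push_cast; ring)
  have hp2 := re_logDerivZeta₁_ge (γ := 2 * γ) hδ (by linarith) (k := k) (by
    refine le_trans ?_ hk; rw [abs_mul]; gcongr; simp)
  rw [LSeries_vonMangoldt_eq (by simpa using hδ), LSeries_vonMangoldt_eq (by simpa using hδ),
    LSeries_vonMangoldt_eq (by simpa using hδ), Complex.sub_re, Complex.sub_re, Complex.sub_re] at h341
  have hr1 := re_inv_le hδ hγ
  have hr2 := re_inv_le (γ := 2 * γ) hδ (by rw [abs_mul]; norm_num; linarith)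
  have hr0 : (1 / (((1 + δ : ℝ) : ℂ) - 1)).re = 1 / δ := by
    rw [← Complex.ofReal_one, ← Complex.ofReal_sub, ← Complex.ofReal_div, Complex.ofReal_re]
    congr 1; ring
  push_cast at h341 hr0 hr1 hr2 hp0 hp1 hp2
  rw [zero_mul, add_zero] at hp0
  have h4 : 4 * (1 / (1 + δ - β)) ≤ 3 * (1 / δ) + 16 * k + 16 + 5 * δ := by linarith
  have h5 : 1 / (8 * δ / 7) ≤ 1 / (1 + δ - β) := by
    apply one_div_le_one_div_of_le ha; linarith
  have h5' : 1 / (8 * δ / 7) = 7 / 8 * (1 / δ) := by field_simp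
  have h6 : (1 / δ) * δ = 1 := by field_simp
  have h7 : 7 / 2 * (1 / δ) ≤ 3 * (1 / δ) + 16 * k + 16 + 5 * δ := by linarith
  have h8 : 1 / 2 * (1 / δ) * δ < 1 / 2 := by
    calc 1 / 2 * (1 / δ) * δ ≤ (16 * k + 16 + 5 * δ) * δ := by gcongr; linarith
      _ < (16 * k + 17) * δ := mul_lt_mul_of_pos_right (by linarith) hδ
      _ ≤ 1 / 2 := by linarith
  linarith

lemma exists_zeroFree_low : ∃ η > 0, ∀ s : ℂ, |s.im| ≤ 1 → 1 - η ≤ s.re → riemannZeta₁ s ≠ 0 := by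
  set K : Set ℂ := (Set.Icc (0 : ℝ) 1 ×ℂ Set.Icc (-1 : ℝ) 1) ∩ {s | riemannZeta₁ s = 0} with hK
  have hKc : IsCompact K := (isCompact_Icc.reProdIm isCompact_Icc).inter_right
    (isClosed_eq differentiable_riemannZeta₁.continuous continuous_const)
  rcases K.eq_empty_or_nonempty with h | h
  · refine ⟨1, one_pos, fun s h1 h2 h3 => ?_⟩
    have : s ∈ K := by
      refine ⟨⟨⟨by linarith, ?_⟩, abs_le.mp h1⟩, h3⟩
      by_contra! h4; exact riemannZeta₁_ne_zero_of_one_le_re h4.le h3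
    rw [h] at this; exact this
  · obtain ⟨s₀, hs₀, hmax⟩ := hKc.exists_isMaxOn h Complex.continuous_re.continuousOn
    have hs1 : s₀.re < 1 := by
      by_contra! h4; exact riemannZeta₁_ne_zero_of_one_le_re h4 hs₀.2
    have hs0 : 0 ≤ s₀.re := hs₀.1.1.1
    refine ⟨(1 - s₀.re) / 2, by linarith, fun s h1 h2 h3 => ?_⟩
    have : s ∈ K := by
      refine ⟨⟨⟨by linarith, ?_⟩, abs_le.mp h1⟩, h3⟩
      by_contra! h4; exact riemannZeta₁_ne_zero_of_one_le_re h4.le h3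
    have := hmax this
    simp only [Set.mem_ofPred_eq] at this
    linarith

/-- The classical zero-free region. -/
lemma exists_zeroFree : ∃ η > 0, η ≤ 1 / 8 ∧ ∀ s : ℂ, 1 - η / Real.log (|s.im| + 3) ≤ s.re →
    riemannZeta₁ s ≠ 0 := by
  obtain ⟨η₀, hη₀, hlow⟩ := exists_zeroFree_low
  set κ := Real.exp (-10) with hκ
  have hκ0 : 0 < κ := Real.exp_pos _
  have hκ1 : κ ≤ 1 / 1024 := by
    have h1 : (2 : ℝ) ≤ Real.exp 1 := by
      have := Real.add_one_le_exp (1 : ℝ); linarith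
    have h2 : (1024 : ℝ) ≤ Real.exp 10 := by
      calc (1024 : ℝ) = 2 ^ 10 := by norm_num
        _ ≤ (Real.exp 1) ^ 10 := by gcongr
        _ = Real.exp 10 := by rw [← Real.exp_nat_mul]; norm_num
    rw [hκ, Real.exp_neg, inv_le_comm₀ (Real.exp_pos _) (by norm_num)]
    simpa using h2
  have hL1 : ∀ t : ℝ, 1 ≤ Real.log (|t| + 3) := by
    intro t
    rw [Real.le_log_iff_exp_le (by positivity)]
    have := Real.exp_one_lt_d9
    have := abs_nonneg t
    linarith
  refine ⟨min η₀ (κ / 8), by positivity, by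
    refine (min_le_right _ _).trans ?_; linarith, fun s hs hz => ?_⟩
  have hL := hL1 s.im
  set L := Real.log (|s.im| + 3) with hLdef
  by_cases h1 : |s.im| ≤ 1
  · refine hlow s h1 (le_trans ?_ hs) hz
    have : min η₀ (κ / 8) / L ≤ η₀ := by
      rw [div_le_iff₀ (by linarith)]
      calc min η₀ (κ / 8) ≤ η₀ := min_le_left _ _
        _ ≤ η₀ * L := by nlinarith
    linarith
  · push Not at h1
    have hW0 : 0 < |s.im| + 3 := by positivity
    have hWe : Real.exp L = |s.im| + 3 := Real.exp_log hW0
    have := re_le_of_zero (δ := κ / L) (γ := s.im) (β := s.re) (k := ⌈9 * L + 20⌉₊) (by positivity)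
      (by rw [div_le_iff₀ (by linarith)]; nlinarith) h1.le (by
        have hk : 9 * L + 20 ≤ (⌈9 * L + 20⌉₊ : ℝ) := Nat.le_ceil _
        have hLW : L ≤ Real.exp L := by linarith [Real.add_one_le_exp L]
        calc (2 * |s.im| + 4) ^ 3 ≤ (Real.exp L ^ 2) ^ 3 := by
              gcongr; rw [hWe]; nlinarith [abs_nonneg s.im]
          _ = Real.exp (9 * L + 20) * (κ / Real.exp L) ^ 2 / Real.exp L := by
              rw [hκ, ← Real.exp_sub, ← Real.exp_nat_mul, ← Real.exp_nat_mul, ← Real.exp_nat_mul,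
                ← Real.exp_add, ← Real.exp_sub]
              congr 1; push_cast; ring
          _ ≤ Real.exp (⌈9 * L + 20⌉₊ : ℝ) * (κ / L) ^ 2 / 3 := by
              gcongr
              rw [hWe]; linarith [abs_nonneg s.im]
          _ = _ := by ring) (by
        have hk : (⌈9 * L + 20⌉₊ : ℝ) < 9 * L + 20 + 1 := Nat.ceil_lt_add_one (by linarith)
        rw [div_mul_eq_mul_div, div_le_iff₀ (by linarith)]
        nlinarith) (by rw [Complex.re_add_im]; exact hz)
    have h2 : min η₀ (κ / 8) / L ≤ κ / 8 / L := by gcongr; exact min_le_right _ _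
    have h3 : κ / 8 / L < κ / L / 7 := by
      have : 0 < κ / L := by positivity
      have e : κ / 8 / L = κ / L / 8 := by ring
      rw [e]; linarith
    linarith

/-- Bound for the logarithmic derivative of a function without zeros on a disc. -/
lemma norm_logDeriv_le_of_ne_zero {f : ℂ → ℂ} (hf : Differentiable ℂ f) {c : ℂ} {ρ M : ℝ}
    (hρ : 0 < ρ) (hM : 0 < M) (hne : ∀ w ∈ Metric.ball c (4 * ρ), f w ≠ 0)
    (hb : ∀ w ∈ Metric.ball c (4 * ρ), ‖f w‖ ≤ Real.exp M * ‖f c‖) {s : ℂ} (hs : ‖s - c‖ ≤ 2 * ρ) :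
    ‖deriv f s / f s‖ ≤ 6 * M / ρ := by
  set B := Metric.ball c (4 * ρ) with hB
  have hcB : c ∈ B := Metric.mem_ball_self (by linarith)
  have hKd : DifferentiableOn ℂ (fun w => deriv f w / f w) B := by
    have h1 : DifferentiableOn ℂ (deriv f) B :=
      (hf.differentiableOn (s := Set.univ)).deriv isOpen_univ |>.mono (Set.subset_univ _)
    exact h1.div hf.differentiableOn hne
  obtain ⟨F₀, hF₀⟩ := hKd.isExactOn_ball
  set F : ℂ → ℂ := fun w => F₀ w - F₀ c with hFdef
  have hF : ∀ w ∈ B, HasDerivAt F (deriv f w / f w) w := fun w hw => (hF₀ w hw).sub_const _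
  have hFc : F c = 0 := by simp [hFdef]
  have hconst : ∀ w ∈ B, f w * Complex.exp (-F w) = f c := by
    intro w hw
    have hd : ∀ z ∈ B, HasDerivAt (fun w => f w * Complex.exp (-F w)) 0 z := by
      intro z hz
      have h1 := (hf z).hasDerivAt.mul ((hF z hz).neg.cexp)
      refine h1.congr_deriv ?_
      have := hne z hz
      field_simp
      ring
    have := Metric.isOpen_ball.is_const_of_deriv_eq_zero (Metric.isConnected_ball (by linarith)).isPreconnected
      (fun z hz => (hd z hz).differentiableAt.differentiableWithinAt)
      (fun z hz => (hd z hz).deriv) hw hcB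
    simpa [hFc] using this
  have hRe : ∀ w ∈ B, (F w).re ≤ M := by
    intro w hw
    have h1 : ‖f w‖ = Real.exp (F w).re * ‖f c‖ := by
      rw [← hconst w hw, norm_mul, Complex.norm_exp, Complex.neg_re, Real.exp_neg]
      field_simp
    have h2 := hb w hw
    rw [h1] at h2
    exact Real.exp_le_exp.mp (le_of_mul_le_mul_right h2 (norm_pos_iff.mpr (hne c hcB)))
  have hmem : ∀ z : ℂ, z ∈ Metric.ball (0 : ℂ) (4 * ρ) → c + z ∈ B := by
    intro z hz; simpa [hB] using hz
  have hbc : ∀ w, ‖w - c‖ ≤ 3 * ρ → ‖F w‖ ≤ 6 * M := by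
    intro w hw
    have hz : w - c ∈ Metric.ball (0 : ℂ) (4 * ρ) := by
      rw [mem_ball_zero_iff]; linarith
    have := Complex.borelCaratheodory_zero (f := fun z => F (c + z)) (M := M) (R := 4 * ρ) (z := w - c)
      hM (fun z hz => ((hF _ (hmem z hz)).differentiableAt.comp z
        (by fun_prop)).differentiableWithinAt)
      (fun z hz => hRe _ (hmem z hz)) (by linarith) hz (by simpa using hFc)
    rw [add_sub_cancel] at this
    refine this.trans ?_
    rw [div_le_iff₀ (by linarith)]
    nlinarith
  have hsB : s ∈ B := by
    rw [hB, mem_ball_iff_norm]; linarith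
  rw [← (hF s hsB).deriv]
  refine Complex.norm_deriv_le_of_forall_mem_sphere_norm_le hρ ?_ ?_
  · have hcb : Metric.closedBall s ρ ⊆ B := by
      intro w hw
      rw [hB, mem_ball_iff_norm]
      rw [mem_closedBall_iff_norm] at hw
      calc ‖w - c‖ = ‖(w - s) + (s - c)‖ := by congr 1; ring
        _ ≤ ‖w - s‖ + ‖s - c‖ := norm_add_le _ _
        _ < 4 * ρ := by linarith
    refine DifferentiableOn.diffContOnCl ?_
    intro w hw
    exact (hF w (hcb (Metric.closure_ball_subset_closedBall hw))).differentiableAt.differentiableWithinAt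
  · intro w hw
    refine hbc w ?_
    rw [mem_sphere_iff_norm] at hw
    calc ‖w - c‖ = ‖(w - s) + (s - c)‖ := by congr 1; ring
      _ ≤ ‖w - s‖ + ‖s - c‖ := norm_add_le _ _
      _ ≤ 3 * ρ := by linarith

lemma one_le_log_abs_add_three (t : ℝ) : 1 ≤ Real.log (|t| + 3) := by
  rw [Real.le_log_iff_exp_le (by positivity)]
  have := Real.exp_one_lt_d9
  have := abs_nonneg t
  linarith

/-- The zero-free region together with a bound for the logarithmic derivative. -/
lemma exists_logDerivZeta₁_bound : ∃ η > 0, η ≤ 1 / 8 ∧ ∃ C > 0, ∀ s : ℂ,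
    1 - η / Real.log (|s.im| + 3) ≤ s.re → s.re ≤ 3 / 2 →
      riemannZeta₁ s ≠ 0 ∧ ‖logDerivZeta₁ s‖ ≤ C * Real.log (|s.im| + 3) ^ 2 := by
  obtain ⟨η₁, hη₁, hη₁', hzf⟩ := exists_zeroFree
  set η := η₁ / 8 with hη
  have hη0 : 0 < η := by positivity
  refine ⟨η, hη0, by linarith, 6 * (|Real.log (3 / η ^ 2)| + 8) / η, by positivity, fun s h1 h2 => ?_⟩
  have hL := one_le_log_abs_add_three s.im
  set L := Real.log (|s.im| + 3) with hLdef
  have hL0 : 0 < L := by linarith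
  have hWe : Real.exp L = |s.im| + 3 := Real.exp_log (by positivity)
  have hdiv : η / L ≤ η := div_le_self hη0.le hL
  have hdiv0 : 0 < η / L := by positivity
  have hne0 : riemannZeta₁ s ≠ 0 := by
    refine hzf s (le_trans ?_ h1)
    have : η / L ≤ η₁ / L := by gcongr; linarith
    linarith
  refine ⟨hne0, ?_⟩
  set c : ℂ := s + (2 * (η / L) : ℝ) with hc
  have hcre : c.re = s.re + 2 * (η / L) := by simp [hc]
  have hcim : c.im = s.im := by simp [hc]
  have hball : ∀ w ∈ Metric.ball c (4 * (η / L)), 1 - 3 * (η / L) ≤ w.re ∧ w.re ≤ 3 ∧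
      |w.im| ≤ |s.im| + 1 := by
    intro w hw
    rw [mem_ball_iff_norm] at hw
    have hr := abs_le.mp ((Complex.abs_re_le_norm (w - c)).trans hw.le)
    have hi := (Complex.abs_im_le_norm (w - c)).trans hw.le
    rw [Complex.sub_re, hcre] at hr
    rw [Complex.sub_im, hcim] at hi
    refine ⟨by linarith, by linarith, ?_⟩
    have := abs_sub_abs_le_abs_sub w.im s.im
    linarith
  have hlow : (η / L) ^ 2 / 3 ≤ ‖riemannZeta₁ c‖ :=
    norm_riemannZeta₁_ge hdiv0 (by linarith) (by linarith)
  have hlogV : Real.log (|s.im| + 4) ≤ 2 * L := by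
    rw [hLdef, ← Real.log_rpow (by positivity)]
    refine Real.log_le_log (by positivity) ?_
    norm_num
    nlinarith [abs_nonneg s.im]
  have hM : Real.log (3 * (|s.im| + 4) ^ 3 / (η / L) ^ 2) ≤ (|Real.log (3 / η ^ 2)| + 8) * L := by
    have e : 3 * (|s.im| + 4) ^ 3 / (η / L) ^ 2 = (3 / η ^ 2) * ((|s.im| + 4) ^ 3 * L ^ 2) := by
      field_simp
    rw [e, Real.log_mul (by positivity) (by positivity), Real.log_mul (by positivity) (by positivity),
      Real.log_pow, Real.log_pow]
    have h3 : Real.log L ≤ L := (Real.log_le_sub_one_of_pos hL0).trans (by linarith)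
    have h4 : Real.log (3 / η ^ 2) ≤ |Real.log (3 / η ^ 2)| * L :=
      (le_abs_self _).trans (le_mul_of_one_le_right (abs_nonneg _) hL)
    push_cast
    nlinarith
  have := norm_logDeriv_le_of_ne_zero differentiable_riemannZeta₁ (c := c) (ρ := η / L)
    (M := (|Real.log (3 / η ^ 2)| + 8) * L) hdiv0 (by positivity) (fun w hw => ?_) (fun w hw => ?_)
    (s := s) ?_
  · refine this.trans (le_of_eq ?_)
    field_simp
  · obtain ⟨a1, a2, a3⟩ := hball w hw
    refine hzf w (le_trans ?_ a1)
    have h5 : Real.log (|w.im| + 3) ≤ 2 * L :=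
      (Real.log_le_log (by positivity) (by linarith)).trans hlogV
    have h6 : η₁ / (2 * L) ≤ η₁ / Real.log (|w.im| + 3) := by
      have := one_le_log_abs_add_three w.im
      gcongr
    have h7 : η₁ / (2 * L) = 4 * (η / L) := by rw [hη]; field_simp; norm_num
    linarith
  · obtain ⟨a1, a2, a3⟩ := hball w hw
    have h5 : ‖riemannZeta₁ w‖ ≤ (|s.im| + 4) ^ 3 :=
      norm_riemannZeta₁_le (by linarith) a2 (by linarith)
    calc ‖riemannZeta₁ w‖ ≤ (3 * (|s.im| + 4) ^ 3 / (η / L) ^ 2) * ((η / L) ^ 2 / 3) := by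
          refine h5.trans (le_of_eq ?_)
          field_simp
      _ ≤ Real.exp ((|Real.log (3 / η ^ 2)| + 8) * L) * ‖riemannZeta₁ c‖ := by
          gcongr
          rw [← Real.log_le_iff_le_exp (by positivity)]
          exact hM
  · rw [hc, sub_add_cancel_left, norm_neg, Complex.norm_real, Real.norm_eq_abs, abs_of_pos (by positivity)]

/-- The error term `ψ(t) - t + 1`. -/
noncomputable def psiErr (t : ℝ) : ℝ := Chebyshev.psi t - t + 1

/-- The logarithmic average of `psiErr`. -/
noncomputable def psiErrAvg (y : ℝ) : ℝ := ∫ t in Set.Ioo 1 y, psiErr t / t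

lemma measurable_psiErr : Measurable psiErr :=
  (Chebyshev.psi_mono.measurable.sub measurable_id).add_const 1

lemma abs_psiErr_le {t : ℝ} (ht : 1 ≤ t) : |psiErr t| ≤ 8 * t := by
  have h1 := Chebyshev.psi_le_const_mul_self (x := t) (by linarith)
  have h2 := Chebyshev.psi_nonneg t
  have h3 : Real.log 4 ≤ 2 := by
    have := Real.log_two_lt_d9
    rw [show (4 : ℝ) = 2 ^ 2 by norm_num, Real.log_pow]; push_cast; linarith
  unfold psiErr
  rw [abs_le]
  constructor <;> nlinarith

lemma integral_psiErr_mul_cpow {s : ℂ} (hs : 1 < s.re) :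
    ∫ t in Set.Ioi (1 : ℝ), (psiErr t : ℂ) * (t : ℂ) ^ (-(s + 1)) = -logDerivZeta₁ s / s := by
  have hs0 : s ≠ 0 := by rintro rfl; simp at hs; linarith
  have hs1 : s - 1 ≠ 0 := by
    intro h; rw [sub_eq_zero] at h; rw [h] at hs; simp at hs
  have hψeq : ∀ t : ℝ, (∑ k ∈ Finset.Icc 1 ⌊t⌋₊, ((ArithmeticFunction.vonMangoldt k : ℝ) : ℂ)) =
      (Chebyshev.psi t : ℂ) := by
    intro t
    rw [Chebyshev.psi_eq_sum_Icc, ← Complex.ofReal_sum]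
    congr 1
    refine Finset.sum_subset (Finset.Icc_subset_Icc_left (Nat.zero_le _)) fun k hk hk' => ?_
    have : k = 0 := by
      simp only [Finset.mem_Icc] at hk hk'; omega
    rw [this]; simp
  have hO : (fun n : ℕ => ∑ k ∈ Finset.Icc 1 n, (ArithmeticFunction.vonMangoldt k : ℝ))
      =O[Filter.atTop] fun n : ℕ => (n : ℝ) ^ (1 : ℝ) := by
    refine Asymptotics.IsBigO.of_bound (Real.log 4 + 4) (Filter.Eventually.of_forall fun n => ?_)
    have h1 := hψeq n
    rw [Nat.floor_natCast, ← Complex.ofReal_sum] at h1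
    rw [Complex.ofReal_injective h1, Real.rpow_one, Real.norm_eq_abs, Real.norm_eq_abs,
      abs_of_nonneg (Chebyshev.psi_nonneg _), abs_of_nonneg (Nat.cast_nonneg n)]
    exact Chebyshev.psi_le_const_mul_self (Nat.cast_nonneg n)
  have h1 := LSeries_eq_mul_integral_of_nonneg (fun n => ArithmeticFunction.vonMangoldt n)
    zero_le_one hs hO fun n => ArithmeticFunction.vonMangoldt_nonneg
  simp_rw [hψeq] at h1
  rw [LSeries_vonMangoldt_eq hs] at h1
  have hi : ∀ a : ℂ, a.re < -1 → MeasureTheory.IntegrableOn (fun t : ℝ => (t : ℂ) ^ a) (Set.Ioi 1) :=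
    fun a ha => integrableOn_Ioi_cpow_of_lt ha one_pos
  have hi1 := hi (-(s + 1)) (by simp; linarith)
  have hi2 := hi (-s) (by simp; linarith)
  have hi3 : MeasureTheory.IntegrableOn (fun t : ℝ => (psiErr t : ℂ) * (t : ℂ) ^ (-(s + 1)))
      (Set.Ioi 1) := by
    have hdom : MeasureTheory.IntegrableOn (fun t : ℝ => 8 * t ^ (-s.re)) (Set.Ioi 1) :=
      (integrableOn_Ioi_rpow_of_lt (by linarith) one_pos).const_mul 8
    refine hdom.mono' ?_ ?_
    · exact ((Complex.measurable_ofReal.comp measurable_psiErr).aestronglyMeasurable).mul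
        hi1.aestronglyMeasurable
    · filter_upwards [MeasureTheory.ae_restrict_mem measurableSet_Ioi] with t ht
      have ht : 1 < t := ht
      have ht0 : 0 < t := by linarith
      rw [norm_mul, Complex.norm_real, Complex.norm_cpow_eq_rpow_re_of_pos ht0, Real.norm_eq_abs]
      calc |psiErr t| * t ^ (-(s + 1)).re ≤ 8 * t * t ^ (-(s + 1)).re := by
            gcongr; exact abs_psiErr_le ht.le
        _ = 8 * t ^ (-s.re) := by
            rw [mul_assoc, ← Real.rpow_one_add' ht0.le (by simp; linarith)]
            congr 2; simp
  have hsplit : ∫ t in Set.Ioi (1 : ℝ), (Chebyshev.psi t : ℂ) * (t : ℂ) ^ (-(s + 1)) =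
      (∫ t in Set.Ioi (1 : ℝ), (psiErr t : ℂ) * (t : ℂ) ^ (-(s + 1)))
      + (∫ t in Set.Ioi (1 : ℝ), (t : ℂ) ^ (-s)) - ∫ t in Set.Ioi (1 : ℝ), (t : ℂ) ^ (-(s + 1)) := by
    have hi4 : MeasureTheory.IntegrableOn
        (fun t : ℝ => (psiErr t : ℂ) * (t : ℂ) ^ (-(s + 1)) + (t : ℂ) ^ (-s)) (Set.Ioi 1) := hi3.add hi2
    rw [← MeasureTheory.integral_add hi3 hi2, ← MeasureTheory.integral_sub hi4 hi1]
    refine MeasureTheory.setIntegral_congr_fun measurableSet_Ioi fun t ht => ?_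
    have ht : 1 < t := ht
    have ht0 : (t : ℂ) ≠ 0 := by exact_mod_cast (by linarith : t ≠ 0)
    have e : (t : ℂ) ^ (-s) = t * (t : ℂ) ^ (-(s + 1)) := by
      rw [show -s = 1 + -(s + 1) by ring, Complex.cpow_add _ _ ht0, Complex.cpow_one]
    simp only [e, psiErr]
    push_cast
    ring
  rw [hsplit, integral_Ioi_cpow_of_lt (by simp; linarith) one_pos,
    integral_Ioi_cpow_of_lt (by simp; linarith) one_pos] at h1
  simp only [Complex.ofReal_one, Complex.one_cpow] at h1
  have hs1' : -s + 1 ≠ 0 := by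
    intro h; apply hs1; rw [← neg_eq_zero]; rw [← h]; ring
  have hs2' : -(s + 1) + 1 ≠ 0 := by
    intro h; apply hs0; rw [← neg_eq_zero]; rw [← h]; ring
  set I := ∫ t in Set.Ioi (1 : ℝ), (psiErr t : ℂ) * (t : ℂ) ^ (-(s + 1)) with hI
  rw [eq_div_iff hs0]
  have e1 : (-1 : ℂ) / (-s + 1) = 1 / (s - 1) := by
    rw [div_eq_div_iff hs1' hs1]; ring
  have e2 : (-1 : ℂ) / (-(s + 1) + 1) = 1 / s := by
    rw [div_eq_div_iff hs2' hs0]; ring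
  rw [e1, e2] at h1
  have e3 : s * (I + 1 / (s - 1) - 1 / s) = s * I + 1 / (s - 1) := by
    field_simp; ring
  rw [e3] at h1
  linear_combination -h1

lemma mellin_psiErrAvg {s : ℂ} (hs : 1 < s.re) :
    MellinConvergent (fun t => (psiErrAvg t : ℂ)) (-s) ∧
      mellin (fun t => (psiErrAvg t : ℂ)) (-s) = -logDerivZeta₁ s / s ^ 2 := by
  have hs0 : s ≠ 0 := by rintro rfl; simp at hs; linarith
  set μ := MeasureTheory.volume.restrict (Set.Ioi (1 : ℝ)) with hμ
  set h : ℝ → ℝ → ℂ := fun y t => if t < y then ((psiErr t / t : ℝ) : ℂ) * (y : ℂ) ^ (-(s + 1)) else 0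
    with hh
  have hcp : ∀ t : ℝ, 1 ≤ t → MeasureTheory.IntegrableOn (fun y : ℝ => (y : ℂ) ^ (-(s + 1))) (Set.Ioi t) :=
    fun t ht => integrableOn_Ioi_cpow_of_lt (by simp; linarith) (by linarith)
  have hsec : ∀ t : ℝ, (fun y => h y t) = (Set.Ioi t).indicator
      fun y : ℝ => ((psiErr t / t : ℝ) : ℂ) * (y : ℂ) ^ (-(s + 1)) := by
    intro t; ext y; simp [hh, Set.indicator_apply]
  have hmeas : MeasureTheory.AEStronglyMeasurable (Function.uncurry h) (μ.prod μ) := by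
    have h1 : Measurable fun p : ℝ × ℝ => ((psiErr p.2 / p.2 : ℝ) : ℂ) * (p.1 : ℂ) ^ (-(s + 1)) := by
      refine Measurable.mul ?_ ?_
      · exact Complex.measurable_ofReal.comp
          ((measurable_psiErr.comp measurable_snd).div measurable_snd)
      · exact (Complex.measurable_ofReal.comp measurable_fst).pow_const _
    exact (Measurable.ite (measurableSet_lt measurable_snd measurable_fst) h1
      measurable_const).aestronglyMeasurable
  have hinteg : MeasureTheory.Integrable (Function.uncurry h) (μ.prod μ) := by
    rw [MeasureTheory.integrable_prod_iff' hmeas]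
    constructor
    · filter_upwards [MeasureTheory.ae_restrict_mem measurableSet_Ioi] with t ht
      have ht : 1 < t := ht
      simp only [Function.uncurry_apply_pair]
      rw [hsec t, MeasureTheory.integrable_indicator_iff measurableSet_Ioi]
      refine MeasureTheory.IntegrableOn.mono_measure ?_ MeasureTheory.Measure.restrict_le_self
      exact (hcp t ht.le).const_mul _
    · have hdom : MeasureTheory.IntegrableOn (fun t : ℝ => 8 / s.re * t ^ (-s.re)) (Set.Ioi 1) :=
        (integrableOn_Ioi_rpow_of_lt (by linarith) one_pos).const_mul _
      refine hdom.mono' ?_ ?_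
      · exact hmeas.norm.prod_swap.integral_prod_right'
      · filter_upwards [MeasureTheory.ae_restrict_mem measurableSet_Ioi] with t ht
        have ht : 1 < t := ht
        have ht0 : 0 < t := by linarith
        rw [Real.norm_eq_abs, abs_of_nonneg (MeasureTheory.integral_nonneg fun _ => norm_nonneg _)]
        simp only [Function.uncurry_apply_pair]
        have e1 : (fun y => ‖h y t‖) = (Set.Ioi t).indicator
            fun y : ℝ => |psiErr t / t| * ‖(y : ℂ) ^ (-(s + 1))‖ := by
          ext y
          rw [congrFun (hsec t) y, norm_indicator_eq_indicator_norm]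
          simp [Set.indicator_apply, abs_div]
        rw [e1, hμ, MeasureTheory.setIntegral_indicator measurableSet_Ioi,
          Set.Ioi_inter_Ioi, max_eq_right ht.le, MeasureTheory.integral_const_mul]
        have e2 : ∫ y in Set.Ioi t, ‖(y : ℂ) ^ (-(s + 1))‖ = t ^ (-s.re) / s.re := by
          rw [MeasureTheory.setIntegral_congr_fun (g := fun y : ℝ => y ^ (-(s.re + 1))) measurableSet_Ioi
            fun y hy => ?_, integral_Ioi_rpow_of_lt (by linarith) ht0]
          · rw [show -(s.re + 1) + 1 = -s.re by ring, neg_div_neg_eq]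
          · have hy : t < y := hy
            have := Complex.norm_cpow_eq_rpow_re_of_pos (by linarith : 0 < y) (-(s + 1))
            simpa using this
        rw [e2]
        have h3 : |psiErr t / t| ≤ 8 := by
          rw [abs_div, abs_of_pos ht0, div_le_iff₀ ht0]; exact abs_psiErr_le ht.le
        calc |psiErr t / t| * (t ^ (-s.re) / s.re) ≤ 8 * (t ^ (-s.re) / s.re) := by gcongr
          _ = 8 / s.re * t ^ (-s.re) := by ring
  have hinner : ∀ y : ℝ, ∫ t, h y t ∂μ = (psiErrAvg y : ℂ) * (y : ℂ) ^ (-(s + 1)) := by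
    intro y
    have e1 : (fun t => h y t) = (Set.Iio y).indicator
        fun t : ℝ => ((psiErr t / t : ℝ) : ℂ) * (y : ℂ) ^ (-(s + 1)) := by
      ext t; simp [hh, Set.indicator_apply]
    rw [e1, hμ, MeasureTheory.setIntegral_indicator measurableSet_Iio, Set.Ioi_inter_Iio,
      MeasureTheory.integral_mul_const, psiErrAvg, integral_complex_ofReal]
  have hind : ∀ y : ℝ, (psiErrAvg y : ℂ) = (Set.Ioi (1 : ℝ)).indicator (fun t => (psiErrAvg t : ℂ)) y := by
    intro y
    by_cases hy : y ∈ Set.Ioi (1 : ℝ)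
    · rw [Set.indicator_of_mem hy]
    · rw [Set.indicator_of_notMem hy, psiErrAvg, Set.Ioo_eq_empty (by simpa using hy)]; simp
  constructor
  · have h1 := hinteg.integral_prod_left
    simp only [Function.uncurry_apply_pair, hinner] at h1
    unfold MellinConvergent
    have h2 : MeasureTheory.Integrable ((Set.Ioi (1 : ℝ)).indicator
        fun y : ℝ => (psiErrAvg y : ℂ) * (y : ℂ) ^ (-(s + 1))) :=
      (MeasureTheory.integrable_indicator_iff measurableSet_Ioi).mpr h1
    refine h2.integrableOn.congr_fun (fun y _ => ?_) measurableSet_Ioi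
    simp only
    by_cases hy : y ∈ Set.Ioi (1 : ℝ)
    · rw [Set.indicator_of_mem hy, smul_eq_mul, mul_comm]; congr 2; ring
    · rw [hind y, Set.indicator_of_notMem hy, Set.indicator_of_notMem hy]; simp
  · rw [show (fun t => (psiErrAvg t : ℂ)) = (fun t => (Set.Ioi (1 : ℝ)).indicator
      (fun t => (psiErrAvg t : ℂ)) t) from funext hind, mellin_neg_eq_setIntegral]
    have hswap := MeasureTheory.integral_integral_swap hinteg
    simp_rw [hinner] at hswap
    rw [hswap]
    have e1 : ∀ t ∈ Set.Ioi (1 : ℝ), ∫ y, h y t ∂μ = (psiErr t : ℂ) * (t : ℂ) ^ (-(s + 1)) * (1 / s) := by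
      intro t ht
      have ht : 1 < t := ht
      have ht0 : 0 < t := by linarith
      have htc : (t : ℂ) ≠ 0 := by exact_mod_cast ht0.ne'
      rw [hsec t, hμ, MeasureTheory.setIntegral_indicator measurableSet_Ioi,
          Set.Ioi_inter_Ioi, max_eq_right ht.le, MeasureTheory.integral_const_mul,
          integral_Ioi_cpow_of_lt (by simp; linarith) ht0]
      have e2 : (t : ℂ) ^ (-(s + 1) + 1) = t * (t : ℂ) ^ (-(s + 1)) := by
        rw [Complex.cpow_add _ _ htc, Complex.cpow_one, mul_comm]
      rw [e2, show -(s + 1) + 1 = -s by ring]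
      push_cast
      field_simp
    rw [MeasureTheory.setIntegral_congr_fun measurableSet_Ioi e1, MeasureTheory.integral_mul_const,
      integral_psiErr_mul_cpow hs]
    field_simp

lemma exists_logDerivZeta₁_div_sq_bound : ∃ η > 0, η ≤ 1 / 8 ∧ ∃ C > 0, ∀ s : ℂ,
    1 - η / Real.log (|s.im| + 3) ≤ s.re → s.re ≤ 3 / 2 →
      riemannZeta₁ s ≠ 0 ∧ ‖-logDerivZeta₁ s / s ^ 2‖ ≤ C * (1 + ‖s.im‖) ^ (-(3 / 2) : ℝ) := by
  obtain ⟨η, hη, hη8, C, hC, h⟩ := exists_logDerivZeta₁_bound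
  refine ⟨η, hη, hη8, 256 * C, by positivity, fun s h1 h2 => ⟨(h s h1 h2).1, ?_⟩⟩
  have hb := (h s h1 h2).2
  have hL := one_le_log_abs_add_three s.im
  have hre : 1 / 2 ≤ s.re := by
    have : η / Real.log (|s.im| + 3) ≤ η := div_le_self hη.le hL
    linarith
  rw [Real.norm_eq_abs]
  set t := |s.im| with ht
  have ht0 : 0 ≤ t := abs_nonneg _
  have hu : (0 : ℝ) < 1 + t := by positivity
  have hlog : Real.log (t + 3) ^ 2 ≤ 32 * (1 + t) ^ (1 / 2 : ℝ) := by
    have h3 := Real.log_le_rpow_div (x := t + 3) (by positivity) (by norm_num : (0 : ℝ) < 1 / 4)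
    have h4 : (t + 3) ^ (1 / 4 : ℝ) ≤ (4 * (1 + t)) ^ (1 / 4 : ℝ) := by
      gcongr; linarith
    have h5 : ((4 * (1 + t)) ^ (1 / 4 : ℝ)) ^ 2 = 2 * (1 + t) ^ (1 / 2 : ℝ) := by
      rw [← Real.rpow_natCast, ← Real.rpow_mul (by positivity), Real.mul_rpow (by norm_num) hu.le]
      have h4 : (4 : ℝ) ^ (1 / 4 * ((2 : ℕ) : ℝ)) = 2 := by
        rw [show (4 : ℝ) = 2 ^ (2 : ℝ) by norm_num, ← Real.rpow_mul (by norm_num)]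
        norm_num
      rw [h4]
      norm_num
    calc Real.log (t + 3) ^ 2 ≤ ((4 * (1 + t)) ^ (1 / 4 : ℝ) / (1 / 4)) ^ 2 := by
          have := h3.trans (div_le_div_of_nonneg_right h4 (by norm_num : (0 : ℝ) ≤ 1 / 4))
          gcongr
      _ = 16 * ((4 * (1 + t)) ^ (1 / 4 : ℝ)) ^ 2 := by ring
      _ = 32 * (1 + t) ^ (1 / 2 : ℝ) := by rw [h5]; ring
  have hs : (1 + t) ^ 2 / 8 ≤ ‖s‖ ^ 2 := by
    rw [← Complex.normSq_eq_norm_sq, Complex.normSq_apply]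
    have : s.im * s.im = t * t := by rw [ht, abs_mul_abs_self]
    rw [this]
    nlinarith [sq_nonneg (t - 1)]
  have hnorm : 0 < ‖s‖ ^ 2 := lt_of_lt_of_le (by positivity) hs
  rw [norm_div, norm_neg, norm_pow, div_le_iff₀ hnorm]
  have e : (1 + t) ^ (-(3 / 2) : ℝ) * (1 + t) ^ 2 = (1 + t) ^ (1 / 2 : ℝ) := by
    rw [← Real.rpow_natCast, ← Real.rpow_add hu]; norm_num
  calc ‖logDerivZeta₁ s‖ ≤ C * (32 * (1 + t) ^ (1 / 2 : ℝ)) := hb.trans (by gcongr)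
    _ = 256 * C * (1 + t) ^ (-(3 / 2) : ℝ) * ((1 + t) ^ 2 / 8) := by rw [← e]; ring
    _ ≤ _ := by gcongr

/-- The integrand of the inverse Mellin transform. -/
noncomputable def perronKernel (x : ℝ) (s : ℂ) : ℂ := (x : ℂ) ^ s * (-logDerivZeta₁ s / s ^ 2)

lemma differentiableAt_perronKernel {x : ℝ} (hx : 0 < x) {s : ℂ} (h1 : riemannZeta₁ s ≠ 0) (h2 : s ≠ 0) :
    DifferentiableAt ℂ (perronKernel x) s := by
  have hx' : (x : ℂ) ≠ 0 := by exact_mod_cast hx.ne'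
  have hd : DifferentiableAt ℂ (deriv riemannZeta₁) s :=
    (((differentiable_riemannZeta₁.differentiableOn (s := Set.univ)).deriv isOpen_univ) s
      (Set.mem_univ s)).differentiableAt Filter.univ_mem
  unfold perronKernel logDerivZeta₁
  have h3 : DifferentiableAt ℂ (fun s : ℂ => (x : ℂ) ^ s) s :=
    differentiableAt_id.const_cpow (Or.inl hx')
  exact h3.mul (((hd.div (differentiable_riemannZeta₁ s) h1).neg).div (by fun_prop)
    (pow_ne_zero 2 h2))

lemma continuousAt_psiErrAvg {x : ℝ} (hx : 1 < x) : ContinuousAt psiErrAvg x := by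
  have hii : ∀ a b : ℝ, 1 ≤ a → 1 ≤ b →
      IntervalIntegrable (fun t => psiErr t / t) MeasureTheory.volume a b := by
    intro a b ha hb
    rw [intervalIntegrable_iff]
    refine MeasureTheory.Measure.integrableOn_of_bounded (M := 8) (by simp)
      (measurable_psiErr.div measurable_id).aestronglyMeasurable ?_
    filter_upwards [MeasureTheory.ae_restrict_mem measurableSet_uIoc] with t ht
    have ht1 : 1 ≤ t := (le_min ha hb).trans ht.1.le
    rw [Real.norm_eq_abs, abs_div, abs_of_pos (by linarith : 0 < t), div_le_iff₀ (by linarith)]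
    exact abs_psiErr_le ht1
  have h1 : ContinuousOn (fun y => ∫ t in (1 : ℝ)..y, psiErr t / t) (Set.uIcc 1 (x + 1)) :=
    intervalIntegral.continuousOn_primitive_interval' (hii 1 (x + 1) le_rfl (by linarith)) (by simp)
  have h2 : ContinuousAt (fun y => ∫ t in (1 : ℝ)..y, psiErr t / t) x := by
    refine h1.continuousAt ?_
    rw [Set.uIcc_of_le (by linarith)]
    exact Icc_mem_nhds hx (by linarith)
  refine h2.congr ?_
  filter_upwards [lt_mem_nhds hx] with y hy
  rw [intervalIntegral.integral_of_le hy.le, psiErrAvg, MeasureTheory.integral_Ioc_eq_integral_Ioo]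

lemma psiErrAvg_eq_integral {σ C x : ℝ} (hσ : 1 < σ) (hx : 1 < x)
    (hb : ∀ t : ℝ, ‖-logDerivZeta₁ (σ + t * Complex.I) / (σ + t * Complex.I) ^ 2‖ ≤
      C * (1 + ‖t‖) ^ (-(3 / 2) : ℝ)) :
    MeasureTheory.Integrable (fun t : ℝ => perronKernel x (σ + t * Complex.I)) ∧
    (psiErrAvg x : ℂ) = (1 / (2 * Real.pi)) • ∫ t : ℝ, perronKernel x (σ + t * Complex.I) := by
  have hx0 : 0 < x := by linarith
  have hne : ∀ t : ℝ, (σ : ℂ) + t * Complex.I ≠ 0 := by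
    intro t h
    have := congrArg Complex.re h
    simp at this; linarith
  have hdom : MeasureTheory.Integrable (fun t : ℝ => C * (1 + ‖t‖) ^ (-(3 / 2) : ℝ)) :=
    (integrable_one_add_norm (by simp; norm_num)).const_mul C
  have hcont : ∀ x : ℝ, 0 < x → Continuous fun t : ℝ => perronKernel x (σ + t * Complex.I) := by
    intro x hx
    rw [continuous_iff_continuousAt]
    intro t
    refine ContinuousAt.comp (f := fun t : ℝ => (σ : ℂ) + t * Complex.I) (g := perronKernel x)
      (differentiableAt_perronKernel hx
      (riemannZeta₁_ne_zero_of_one_le_re (by simpa using hσ.le)) (hne t)).continuousAt (by fun_prop)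
  have hinteg1 : MeasureTheory.Integrable
      (fun t : ℝ => -logDerivZeta₁ (σ + t * Complex.I) / (σ + t * Complex.I) ^ 2) := by
    refine hdom.mono' ?_ (Filter.Eventually.of_forall hb)
    have := hcont 1 one_pos
    simp only [perronKernel, Complex.ofReal_one, Complex.one_cpow, one_mul] at this
    exact this.aestronglyMeasurable
  have hinteg : MeasureTheory.Integrable (fun t : ℝ => perronKernel x (σ + t * Complex.I)) := by
    refine (hdom.const_mul (x ^ σ)).mono' (hcont x hx0).aestronglyMeasurable
      (Filter.Eventually.of_forall fun t => ?_)
    rw [perronKernel, norm_mul, Complex.norm_cpow_eq_rpow_re_of_pos hx0]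
    simp only [Complex.add_re, Complex.ofReal_re, Complex.mul_re, Complex.I_re, mul_zero,
      Complex.ofReal_im, Complex.I_im, mul_one, sub_self, add_zero]
    gcongr
    exact hb t
  refine ⟨hinteg, ?_⟩
  have hmt : ∀ y : ℝ, mellin (fun t => (psiErrAvg t : ℂ)) (((-σ : ℝ) : ℂ) + y * Complex.I) =
      -logDerivZeta₁ (σ + (-y : ℝ) * Complex.I) / (σ + (-y : ℝ) * Complex.I) ^ 2 := by
    intro y
    have := (mellin_psiErrAvg (s := σ + (-y : ℝ) * Complex.I) (by simpa using hσ)).2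
    rw [← this]
    congr 1; push_cast; ring
  have hmc : MellinConvergent (fun t => (psiErrAvg t : ℂ)) ((-σ : ℝ) : ℂ) := by
    have := (mellin_psiErrAvg (s := σ) (by simpa using hσ)).1
    rwa [Complex.ofReal_neg]
  have hv : Complex.VerticalIntegrable (mellin (fun t => (psiErrAvg t : ℂ))) (-σ)
      MeasureTheory.volume := by
    unfold Complex.VerticalIntegrable
    simp_rw [hmt]
    exact hinteg1.comp_neg
  have hinv := mellinInv_mellin_eq (-σ) (fun t => (psiErrAvg t : ℂ)) hx0 hmc hv
    (Complex.continuous_ofReal.continuousAt.comp (continuousAt_psiErrAvg hx))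
  rw [← hinv, mellinInv]
  congr 1
  rw [← MeasureTheory.integral_neg_eq_self]
  refine MeasureTheory.integral_congr_ae (Filter.Eventually.of_forall fun y => ?_)
  simp only [hmt, perronKernel, smul_eq_mul]
  congr 2 <;> push_cast <;> ring_nf

lemma exists_psiErrAvg_le : ∃ η > 0, ∃ C > 0, ∀ x T : ℝ, Real.exp 2 ≤ x → 1 ≤ T →
    |psiErrAvg x| ≤ C * (x * T ^ (-(1 / 4) : ℝ) + x ^ (1 - η / Real.log (T + 3))) := by
  obtain ⟨η, hη, hη8, C, hC, hK⟩ := exists_logDerivZeta₁_div_sq_bound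
  set A := ∫ t : ℝ, (1 + ‖t‖) ^ (-(5 / 4) : ℝ) with hA
  have hAint : MeasureTheory.Integrable (fun t : ℝ => (1 + ‖t‖) ^ (-(5 / 4) : ℝ)) :=
    integrable_one_add_norm (by simp; norm_num)
  have hA0 : 0 ≤ A := MeasureTheory.integral_nonneg fun t => by positivity
  refine ⟨η, hη, C * (3 * A + 6), by positivity, fun x T hx hT => ?_⟩
  have hx0 : 0 < x := lt_of_lt_of_le (Real.exp_pos _) hx
  have hlx : 2 ≤ Real.log x := (Real.le_log_iff_exp_le hx0).mpr hx
  have hx1 : 1 < x := by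
    have := Real.add_one_le_exp (2 : ℝ); linarith
  set σ₀ := 1 + 1 / Real.log x with hσ₀
  have hlx' : 1 / Real.log x ≤ 1 / 2 := one_div_le_one_div_of_le (by norm_num) hlx
  have hlx'' : 0 < 1 / Real.log x := by positivity
  have hxσ : x ^ σ₀ ≤ 3 * x := by
    rw [hσ₀, Real.rpow_add hx0, Real.rpow_one, Real.rpow_def_of_pos hx0, mul_one_div_cancel (by linarith)]
    nlinarith [Real.exp_one_lt_d9]
  have hLT : 1 ≤ Real.log (T + 3) := by
    have := one_le_log_abs_add_three T
    rwa [abs_of_pos (by linarith)] at this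
  set σ₁ := 1 - η / Real.log (T + 3) with hσ₁
  have hσ₁' : η / Real.log (T + 3) ≤ 1 / 8 := (div_le_self hη.le hLT).trans hη8
  have hσ₁0 : 0 < η / Real.log (T + 3) := by positivity
  have hreg : ∀ s : ℂ, |s.im| ≤ T → σ₁ ≤ s.re → 1 - η / Real.log (|s.im| + 3) ≤ s.re := by
    intro s h1 h2
    refine le_trans ?_ h2
    rw [hσ₁]
    have := one_le_log_abs_add_three s.im
    gcongr
  have hkb : ∀ s : ℂ, 1 - η / Real.log (|s.im| + 3) ≤ s.re → s.re ≤ 3 / 2 →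
      ‖perronKernel x s‖ ≤ x ^ s.re * (C * (1 + ‖s.im‖) ^ (-(3 / 2) : ℝ)) := by
    intro s h1 h2
    rw [perronKernel, norm_mul, Complex.norm_cpow_eq_rpow_re_of_pos hx0]
    gcongr
    exact (hK s h1 h2).2
  have hσ₀reg : ∀ t : ℝ, 1 - η / Real.log (|t| + 3) ≤ σ₀ := by
    intro t
    have := one_le_log_abs_add_three t
    have : 0 < η / Real.log (|t| + 3) := by positivity
    linarith
  obtain ⟨hinteg, hD⟩ := psiErrAvg_eq_integral (σ := σ₀) (x := x) (C := C) (by linarith) hx1 (fun t => by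
    have := (hK (σ₀ + t * Complex.I) (by simpa using hσ₀reg t) (by simp; linarith)).2
    simpa using this)
  have h54 : ∀ t : ℝ, (1 + ‖t‖) ^ (-(3 / 2) : ℝ) = (1 + ‖t‖) ^ (-(5 / 4) : ℝ) * (1 + ‖t‖) ^ (-(1 / 4) : ℝ) := by
    intro t
    rw [← Real.rpow_add (by positivity)]; norm_num
  have hTle : ∀ t : ℝ, T ≤ |t| → (1 + ‖t‖) ^ (-(1 / 4) : ℝ) ≤ T ^ (-(1 / 4) : ℝ) := by
    intro t ht
    refine Real.rpow_le_rpow_of_nonpos (by linarith) ?_ (by norm_num)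
    rw [Real.norm_eq_abs]; linarith
  have hone : ∀ (t r : ℝ), 0 ≤ r → (1 + ‖t‖) ^ (-r) ≤ 1 := by
    intro t r hr
    exact Real.rpow_le_one_of_one_le_of_nonpos (by linarith [norm_nonneg t]) (by linarith)
  -- the tails
  set S := Set.Ioc (-T) T with hS
  have htail : ‖∫ t in Sᶜ, perronKernel x (σ₀ + t * Complex.I)‖ ≤ x ^ σ₀ * C * T ^ (-(1 / 4) : ℝ) * A := by
    have h1 : ‖∫ t in Sᶜ, perronKernel x (σ₀ + t * Complex.I)‖ ≤
        ∫ t in Sᶜ, x ^ σ₀ * C * T ^ (-(1 / 4) : ℝ) * (1 + ‖t‖) ^ (-(5 / 4) : ℝ) := by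
      refine MeasureTheory.norm_integral_le_of_norm_le (hAint.const_mul _).integrableOn ?_
      filter_upwards [MeasureTheory.ae_restrict_mem measurableSet_Ioc.compl] with t ht
      have ht' : T ≤ |t| := by
        by_contra! h
        rw [abs_lt] at h
        exact ht ⟨h.1, h.2.le⟩
      have h2 := hkb (σ₀ + t * Complex.I) (by simpa using hσ₀reg t) (by simp; linarith)
      simp only [Complex.add_re, Complex.ofReal_re, Complex.mul_re, Complex.I_re, mul_zero,
        Complex.ofReal_im, Complex.I_im, mul_one, sub_self, add_zero, Complex.add_im, Complex.mul_im,
        zero_add, h54] at h2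
      refine h2.trans ?_
      calc x ^ σ₀ * (C * ((1 + ‖t‖) ^ (-(5 / 4) : ℝ) * (1 + ‖t‖) ^ (-(1 / 4) : ℝ)))
          ≤ x ^ σ₀ * (C * ((1 + ‖t‖) ^ (-(5 / 4) : ℝ) * T ^ (-(1 / 4) : ℝ))) := by
            have h3 := hTle t ht'
            generalize (1 + ‖t‖) ^ (-(1 / 4) : ℝ) = v at h3 ⊢
            gcongr
        _ = _ := by ring
    refine h1.trans ?_
    rw [MeasureTheory.integral_const_mul]
    gcongr
    exact MeasureTheory.setIntegral_le_integral hAint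
      (Filter.Eventually.of_forall fun t => by positivity)
  -- the left edge
  have hleft : ‖∫ t in (-T)..T, perronKernel x (σ₁ + t * Complex.I)‖ ≤ x ^ σ₁ * C * A := by
    rw [intervalIntegral.integral_of_le (by linarith)]
    have h1 : ‖∫ t in S, perronKernel x (σ₁ + t * Complex.I)‖ ≤
        ∫ t in S, x ^ σ₁ * C * (1 + ‖t‖) ^ (-(5 / 4) : ℝ) := by
      refine MeasureTheory.norm_integral_le_of_norm_le (hAint.const_mul _).integrableOn ?_
      filter_upwards [MeasureTheory.ae_restrict_mem measurableSet_Ioc] with t ht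
      have h2 := hkb (σ₁ + t * Complex.I) (hreg _ (by
        simpa using abs_le.mpr ⟨ht.1.le, ht.2⟩) (by simp)) (by simp; linarith)
      simp only [Complex.add_re, Complex.ofReal_re, Complex.mul_re, Complex.I_re, mul_zero,
        Complex.ofReal_im, Complex.I_im, mul_one, sub_self, add_zero, Complex.add_im, Complex.mul_im,
        zero_add, h54] at h2
      refine h2.trans ?_
      calc x ^ σ₁ * (C * ((1 + ‖t‖) ^ (-(5 / 4) : ℝ) * (1 + ‖t‖) ^ (-(1 / 4) : ℝ)))
          ≤ x ^ σ₁ * (C * ((1 + ‖t‖) ^ (-(5 / 4) : ℝ) * 1)) := by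
            gcongr; exact hone t _ (by norm_num)
        _ = _ := by ring
    refine h1.trans ?_
    rw [MeasureTheory.integral_const_mul]
    gcongr
    exact MeasureTheory.setIntegral_le_integral hAint
      (Filter.Eventually.of_forall fun t => by positivity)
  -- the horizontal edges
  have hhor : ∀ t : ℝ, |t| = T → ‖∫ u in σ₁..σ₀, perronKernel x (u + t * Complex.I)‖ ≤
      x ^ σ₀ * C * T ^ (-(1 / 4) : ℝ) := by
    intro t ht
    have h1 := intervalIntegral.norm_integral_le_of_norm_le_const (a := σ₁) (b := σ₀)
      (f := fun u : ℝ => perronKernel x (u + t * Complex.I)) (C := x ^ σ₀ * C * T ^ (-(1 / 4) : ℝ))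
      (fun u hu => by
        rw [Set.uIoc_of_le (by linarith)] at hu
        have h2 := hkb (u + t * Complex.I) (hreg _ (by simpa using ht.le) (by simpa using hu.1.le))
          (by simp; linarith [hu.2])
        simp only [Complex.add_re, Complex.ofReal_re, Complex.mul_re, Complex.I_re, mul_zero,
          Complex.ofReal_im, Complex.I_im, mul_one, sub_self, add_zero, Complex.add_im, Complex.mul_im,
          zero_add, h54] at h2
        refine h2.trans ?_
        calc x ^ u * (C * ((1 + ‖t‖) ^ (-(5 / 4) : ℝ) * (1 + ‖t‖) ^ (-(1 / 4) : ℝ)))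
            ≤ x ^ σ₀ * (C * (1 * T ^ (-(1 / 4) : ℝ))) := by
              have h3 := hTle t ht.ge
              have h4 := hone t (5 / 4) (by norm_num)
              have h5 : 0 ≤ (1 + ‖t‖) ^ (-(1 / 4) : ℝ) := by positivity
              generalize (1 + ‖t‖) ^ (-(1 / 4) : ℝ) = v at h3 h5 ⊢
              gcongr
              · exact hx1.le
              · exact hu.2
          _ = _ := by ring)
    refine h1.trans ?_
    have h3 : |σ₀ - σ₁| ≤ 1 := by
      rw [abs_of_pos (by linarith)]; linarith
    exact mul_le_of_le_one_right (by positivity) h3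
  have hrect := Complex.integral_boundary_rect_eq_zero_of_differentiableOn (perronKernel x)
    (⟨σ₁, -T⟩ : ℂ) (⟨σ₀, T⟩ : ℂ) (by
      intro s hs
      simp only [Complex.mem_reProdIm] at hs
      rw [Set.uIcc_of_le (by linarith), Set.uIcc_of_le (by linarith)] at hs
      have h1 : |s.im| ≤ T := abs_le.mpr hs.2
      refine (differentiableAt_perronKernel hx0 (hK s (hreg s h1 hs.1.1)
        (by linarith [hs.1.2])).1 ?_).differentiableWithinAt
      rintro rfl
      have := hs.1.1
      simp at this; linarith)
  simp only [smul_eq_mul] at hrect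
  have hmid : ‖∫ t in (-T)..T, perronKernel x (σ₀ + t * Complex.I)‖ ≤
      x ^ σ₁ * C * A + 2 * (x ^ σ₀ * C * T ^ (-(1 / 4) : ℝ)) := by
    have h1 := hhor T (abs_of_pos (by linarith))
    have h2 := hhor (-T) (by rw [abs_neg, abs_of_pos (by linarith)])
    set I₀ := ∫ t in (-T)..T, perronKernel x (σ₀ + t * Complex.I)
    set I₁ := ∫ t in (-T)..T, perronKernel x (σ₁ + t * Complex.I)
    set J₁ := ∫ u in σ₁..σ₀, perronKernel x (u + T * Complex.I)
    set J₂ := ∫ u in σ₁..σ₀, perronKernel x (u + (-T : ℝ) * Complex.I)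
    have e : I₀ = I₁ + Complex.I * (J₂ - J₁) := by
      have hI : Complex.I * Complex.I = -1 := Complex.I_mul_I
      linear_combination (-Complex.I) * hrect + (I₀ - I₁) * hI
    rw [e]
    refine (norm_add_le _ _).trans ?_
    rw [norm_mul, Complex.norm_I, one_mul]
    have := norm_sub_le J₂ J₁
    linarith
  have hfull : ‖∫ t : ℝ, perronKernel x (σ₀ + t * Complex.I)‖ ≤
      x ^ σ₁ * C * A + x ^ σ₀ * C * T ^ (-(1 / 4) : ℝ) * (A + 2) := by
    rw [← MeasureTheory.integral_add_compl (measurableSet_Ioc (a := -T) (b := T)) hinteg,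
      ← intervalIntegral.integral_of_le (by linarith)]
    refine (norm_add_le _ _).trans ?_
    linarith
  have hDn : |psiErrAvg x| ≤ ‖∫ t : ℝ, perronKernel x (σ₀ + t * Complex.I)‖ := by
    rw [← Real.norm_eq_abs, ← Complex.norm_real, hD, norm_smul, Real.norm_eq_abs,
      abs_of_pos (by positivity)]
    refine mul_le_of_le_one_left (norm_nonneg _) ?_
    rw [div_le_one (by positivity)]
    linarith [Real.pi_gt_three]
  have hT4 : 0 ≤ T ^ (-(1 / 4) : ℝ) := by positivity
  have hxs1 : 0 ≤ x ^ σ₁ := by positivity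
  calc |psiErrAvg x| ≤ x ^ σ₁ * C * A + x ^ σ₀ * C * T ^ (-(1 / 4) : ℝ) * (A + 2) := hDn.trans hfull
    _ ≤ x ^ σ₁ * C * (3 * A + 6) + 3 * x * C * T ^ (-(1 / 4) : ℝ) * (A + 2) := by
      gcongr; linarith
    _ = C * (3 * A + 6) * (x * T ^ (-(1 / 4) : ℝ) + x ^ σ₁) := by ring

lemma exists_psiErrAvg_le_exp : ∃ b > 0, b ≤ 1 ∧ ∃ C > 0, ∀ x : ℝ, 4 ≤ Real.log x → 0 < x →
    |psiErrAvg x| ≤ C * (x * Real.exp (-(b * √(Real.log x)))) := by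
  obtain ⟨η, hη, C, hC, h⟩ := exists_psiErrAvg_le
  refine ⟨min (1 / 4) (η / 2), by positivity, (min_le_left _ _).trans (by norm_num), 2 * C,
    by positivity, fun x hx hx0 => ?_⟩
  set b := min (1 / 4) (η / 2) with hb
  set u := √(Real.log x) with hu
  have hu2 : u ^ 2 = Real.log x := Real.sq_sqrt (by linarith)
  have hu0 : 2 ≤ u := by
    rw [hu]; exact Real.le_sqrt_of_sq_le (by linarith)
  have hT7 : 3 ≤ Real.exp u := by
    have := Real.add_one_le_exp u; linarith
  have h1 := h x (Real.exp u) (by rw [← Real.le_log_iff_exp_le hx0]; linarith) (by linarith)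
  have hL : Real.log (Real.exp u + 3) ≤ 2 * u := by
    rw [Real.log_le_iff_le_exp (by positivity), two_mul, Real.exp_add]
    nlinarith
  have hL0 : 0 < Real.log (Real.exp u + 3) := Real.log_pos (by linarith)
  have e1 : Real.exp u ^ (-(1 / 4) : ℝ) ≤ Real.exp (-(b * u)) := by
    rw [← Real.exp_mul]
    refine Real.exp_le_exp.mpr ?_
    have : b ≤ 1 / 4 := min_le_left _ _
    nlinarith
  have e2 : x ^ (1 - η / Real.log (Real.exp u + 3)) ≤ x * Real.exp (-(b * u)) := by
    rw [sub_eq_add_neg, Real.rpow_add hx0, Real.rpow_one, Real.rpow_def_of_pos hx0, ← hu2]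
    gcongr
    rw [mul_neg, neg_le_neg_iff, mul_div_assoc', le_div_iff₀ hL0]
    have h2 : b ≤ η / 2 := min_le_right _ _
    calc b * u * Real.log (Real.exp u + 3) ≤ η / 2 * u * (2 * u) := by gcongr
      _ = _ := by ring
  calc |psiErrAvg x| ≤ _ := h1
    _ ≤ C * (x * Real.exp (-(b * u)) + x * Real.exp (-(b * u))) := by gcongr
    _ = _ := by ring

lemma integrableOn_psiErr_div {a b : ℝ} (ha : 1 ≤ a) :
    MeasureTheory.IntegrableOn (fun t => psiErr t / t) (Set.Ico a b) := by
  refine MeasureTheory.Measure.integrableOn_of_bounded (M := 8) (by simp)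
    (measurable_psiErr.div measurable_id).aestronglyMeasurable ?_
  filter_upwards [MeasureTheory.ae_restrict_mem measurableSet_Ico] with t ht
  have ht1 : 1 ≤ t := ha.trans ht.1
  rw [Real.norm_eq_abs, abs_div, abs_of_pos (by linarith : 0 < t), div_le_iff₀ (by linarith)]
  exact abs_psiErr_le ht1

lemma psiErrAvg_sub {a b : ℝ} (ha : 1 < a) (hab : a ≤ b) :
    psiErrAvg b - psiErrAvg a = ∫ t in Set.Ico a b, psiErr t / t := by
  have h : Set.Ioo 1 b = Set.Ioo 1 a ∪ Set.Ico a b := (Set.Ioo_union_Ico_eq_Ioo ha hab).symm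
  rw [psiErrAvg, h, MeasureTheory.setIntegral_union, psiErrAvg]
  · ring
  · rw [Set.disjoint_left]
    intro t h1 h2
    exact absurd h1.2 (not_lt.mpr h2.1)
  · exact measurableSet_Ico
  · exact (integrableOn_psiErr_div le_rfl).mono_set Set.Ioo_subset_Ico_self
  · exact integrableOn_psiErr_div ha.le

lemma psi_le_of_psiErrAvg {x h : ℝ} (hx : 1 < x) (hh : 0 < h) :
    Chebyshev.psi x ≤ (1 + h) * x +
      (1 + h) / h * (psiErrAvg (x * (1 + h)) - psiErrAvg x) := by
  have hxh : 0 < x * h := by positivity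
  have hle : x ≤ x * (1 + h) := by nlinarith
  rw [psiErrAvg_sub hx hle]
  have h1 : ∫ t in Set.Ico x (x * (1 + h)), (Chebyshev.psi x / (x * (1 + h)) - 1) ≤
      ∫ t in Set.Ico x (x * (1 + h)), psiErr t / t := by
    refine MeasureTheory.setIntegral_mono_on (by simp) (integrableOn_psiErr_div hx.le)
      measurableSet_Ico fun t ht => ?_
    have ht0 : 0 < t := by linarith [ht.1]
    have h2 : Chebyshev.psi x / (x * (1 + h)) ≤ Chebyshev.psi t / t := by
      have := Chebyshev.psi_mono ht.1
      have := Chebyshev.psi_nonneg t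
      have := ht.2.le
      gcongr
    have h3 : psiErr t / t = Chebyshev.psi t / t - 1 + 1 / t := by
      unfold psiErr; field_simp
    have : 0 ≤ 1 / t := by positivity
    rw [h3]; linarith
  rw [MeasureTheory.setIntegral_const] at h1
  simp only [smul_eq_mul, MeasureTheory.measureReal_def, Real.volume_Ico] at h1
  rw [ENNReal.toReal_ofReal (by linarith)] at h1
  have h2 : (1 + h) / h * ((x * (1 + h) - x) * (Chebyshev.psi x / (x * (1 + h)) - 1)) =
      Chebyshev.psi x - (1 + h) * x := by
    field_simp
    ring
  have h3 := mul_le_mul_of_nonneg_left h1 (by positivity : 0 ≤ (1 + h) / h)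
  linarith

lemma le_psi_of_psiErrAvg {x h : ℝ} (hh : 0 < h) (hh1 : h < 1) (hx : 1 < x * (1 - h)) :
    (1 - h) * x + (1 - h) / h * (psiErrAvg x - psiErrAvg (x * (1 - h))) ≤
      Chebyshev.psi x + 1 := by
  have h1h : 0 < 1 - h := by linarith
  have hx0 : 0 < x := by
    by_contra! hc
    nlinarith
  have hle : x * (1 - h) ≤ x := by nlinarith
  rw [psiErrAvg_sub hx hle]
  have h1 : ∫ t in Set.Ico (x * (1 - h)) x, psiErr t / t ≤
      ∫ t in Set.Ico (x * (1 - h)) x, ((Chebyshev.psi x + 1) / (x * (1 - h)) - 1) := by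
    refine MeasureTheory.setIntegral_mono_on (integrableOn_psiErr_div hx.le) (by simp)
      measurableSet_Ico fun t ht => ?_
    have ht0 : 0 < t := by linarith [ht.1]
    have h2 : (Chebyshev.psi t + 1) / t ≤ (Chebyshev.psi x + 1) / (x * (1 - h)) := by
      have := Chebyshev.psi_mono ht.2.le
      have := Chebyshev.psi_nonneg x
      have := ht.1
      gcongr
    have h3 : psiErr t / t = (Chebyshev.psi t + 1) / t - 1 := by
      unfold psiErr; field_simp; ring
    rw [h3]; linarith
  rw [MeasureTheory.setIntegral_const] at h1
  simp only [smul_eq_mul, MeasureTheory.measureReal_def, Real.volume_Ico] at h1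
  rw [ENNReal.toReal_ofReal (by linarith)] at h1
  have h2 : (1 - h) / h * ((x - x * (1 - h)) * ((Chebyshev.psi x + 1) / (x * (1 - h)) - 1)) =
      Chebyshev.psi x + 1 - (1 - h) * x := by
    field_simp
    ring
  have h3 := mul_le_mul_of_nonneg_left h1 (by positivity : 0 ≤ (1 - h) / h)
  linarith

lemma exists_theta_sub_le_of_large : ∃ b > 0, b ≤ 1 ∧ ∃ C > 0, ∀ x : ℝ, 8 ≤ Real.log x → 0 < x →
    |Chebyshev.theta x - x| ≤ C * (x * Real.exp (-(b * √(Real.log x)))) := by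
  obtain ⟨b, hb, hb1, C, hC, h⟩ := exists_psiErrAvg_le_exp
  refine ⟨b / 4, by positivity, by linarith, 20 * C + 10, by positivity, fun x hx hx0 => ?_⟩
  set u := √(Real.log x) with hu
  have hu2 : u ^ 2 = Real.log x := Real.sq_sqrt (by linarith)
  have hu0 : 2 ≤ u := by
    rw [hu]; exact Real.le_sqrt_of_sq_le (by linarith)
  set E := Real.exp (-(b / 4 * u)) with hE
  have hE0 : 0 < E := Real.exp_pos _
  have hE1 : E ≤ 1 := by
    rw [hE]; exact Real.exp_le_one_iff.mpr (by rw [Left.neg_nonpos_iff]; positivity)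
  have hx8 : 9 ≤ x := by
    rw [Real.le_log_iff_exp_le hx0] at hx
    linarith [Real.add_one_le_exp (8 : ℝ)]
  have hD : ∀ y, x / 2 ≤ y → y ≤ 2 * x → |psiErrAvg y| ≤ 2 * C * x * E ^ 2 := by
    intro y h1 h2
    have hy0 : 0 < y := by linarith
    have hly : Real.log x / 4 + 4 ≤ Real.log y + 1 := by
      have h3 : Real.log (x / 2) ≤ Real.log y := Real.log_le_log (by linarith) h1
      rw [Real.log_div hx0.ne' (by norm_num)] at h3
      linarith [Real.log_two_lt_d9]
    have hsq : u / 2 ≤ √(Real.log y) := by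
      refine Real.le_sqrt_of_sq_le ?_
      rw [div_pow, hu2]; linarith
    have hle4 : 4 ≤ Real.log y := by
      have h3 : Real.log (x / 2) ≤ Real.log y := Real.log_le_log (by linarith) h1
      rw [Real.log_div hx0.ne' (by norm_num)] at h3
      linarith [Real.log_two_lt_d9]
    refine (h y hle4 hy0).trans ?_
    have e : E ^ 2 = Real.exp (-(b * (u / 2))) := by
      rw [hE, ← Real.exp_nat_mul]; congr 1; push_cast; ring
    rw [e]
    calc C * (y * Real.exp (-(b * √(Real.log y)))) ≤ C * (2 * x * Real.exp (-(b * (u / 2)))) := by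
          gcongr
      _ = _ := by ring
  have hA := hD x (by linarith) (by linarith)
  have hB := hD (x * (1 + E / 2)) (by nlinarith) (by nlinarith)
  have hB' := hD (x * (1 - E / 2)) (by nlinarith) (by nlinarith)
  have h1 := psi_le_of_psiErrAvg (x := x) (h := E / 2) (by linarith) (by positivity)
  have h2 := le_psi_of_psiErrAvg (x := x) (h := E / 2) (by positivity) (by linarith) (by nlinarith)
  have hxE : 1 ≤ x * E := by
    have : x = Real.exp (u ^ 2) := by rw [hu2, Real.exp_log hx0]
    rw [this, hE, ← Real.exp_add]
    exact Real.one_le_exp (by nlinarith)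
  have h3 : (1 + E / 2) / (E / 2) * (psiErrAvg (x * (1 + E / 2)) - psiErrAvg x) ≤ 12 * C * (x * E) := by
    have h4 : psiErrAvg (x * (1 + E / 2)) - psiErrAvg x ≤ 4 * C * x * E ^ 2 := by
      linarith [le_abs_self (psiErrAvg (x * (1 + E / 2))), neg_abs_le (psiErrAvg x)]
    calc _ ≤ (1 + E / 2) / (E / 2) * (4 * C * x * E ^ 2) := by gcongr
      _ = (1 + E / 2) * (8 * C * x * E) := by field_simp; ring
      _ ≤ (3 / 2) * (8 * C * x * E) := by gcongr; linarith
      _ = _ := by ring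
  have h3' : -(12 * C * (x * E)) ≤ (1 - E / 2) / (E / 2) * (psiErrAvg x - psiErrAvg (x * (1 - E / 2))) := by
    have h4 : -(4 * C * x * E ^ 2) ≤ psiErrAvg x - psiErrAvg (x * (1 - E / 2)) := by
      linarith [le_abs_self (psiErrAvg (x * (1 - E / 2))), neg_abs_le (psiErrAvg x)]
    have h5 : 0 ≤ (1 - E / 2) / (E / 2) := div_nonneg (by linarith) (by linarith)
    calc -(12 * C * (x * E)) ≤ -((1 - E / 2) * (8 * C * x * E)) := by
          have : (1 - E / 2) * (8 * C * x * E) ≤ 1 * (8 * C * x * E) := by gcongr; linarith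
          have : 0 ≤ C * (x * E) := by positivity
          linarith
      _ = (1 - E / 2) / (E / 2) * (-(4 * C * x * E ^ 2)) := by field_simp; ring
      _ ≤ _ := by gcongr
  have h4 := Chebyshev.theta_le_psi x
  have h5 : Chebyshev.psi x - Chebyshev.theta x ≤ 8 * (x * E) := by
    refine (Chebyshev.psi_sub_theta_le (by linarith)).trans ?_
    have h6 := Real.log_le_rpow_div hx0.le (by norm_num : (0 : ℝ) < 1 / 4)
    calc 2 * √x * Real.log x ≤ 2 * √x * (x ^ (1 / 4 : ℝ) / (1 / 4)) := by gcongr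
      _ = 8 * x ^ (3 / 4 : ℝ) := by
        rw [Real.sqrt_eq_rpow, show (3 / 4 : ℝ) = 1 / 2 + 1 / 4 by norm_num, Real.rpow_add hx0]; ring
      _ ≤ 8 * (x * E) := by
        have : x = Real.exp (u ^ 2) := by rw [hu2, Real.exp_log hx0]
        rw [this, hE, ← Real.exp_add, ← Real.exp_mul]
        gcongr
        nlinarith
  have h6 : 0 ≤ C * (x * E) := by positivity
  rw [abs_le]
  constructor <;> nlinarith

/-- The prime number theorem with de la Vallée Poussin error term. -/
lemma exists_theta_sub_le : ∃ b > 0, b ≤ 1 ∧ ∃ C > 0, ∀ x : ℝ, 1 ≤ x →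
    |Chebyshev.theta x - x| ≤ C * (x * Real.exp (-(b * √(Real.log x)))) := by
  obtain ⟨b, hb, hb1, C, hC, h⟩ := exists_theta_sub_le_of_large
  refine ⟨b, hb, hb1, C + 3 * Real.exp 3, by positivity, fun x hx => ?_⟩
  have hx0 : 0 < x := by linarith
  rcases le_total 8 (Real.log x) with h8 | h8
  · refine (h x h8 hx0).trans ?_
    gcongr
    linarith [Real.exp_pos 3]
  · have h1 : |Chebyshev.theta x - x| ≤ 3 * x := by
      have h2 := Chebyshev.theta_le_log4_mul_x hx0.le
      have h3 := Chebyshev.theta_nonneg x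
      have h4 : Real.log 4 ≤ 2 := by
        have := Real.log_two_lt_d9
        rw [show (4 : ℝ) = 2 ^ 2 by norm_num, Real.log_pow]; push_cast; linarith
      rw [abs_le]
      constructor <;> nlinarith
    have h2 : √(Real.log x) ≤ 3 := by
      rw [Real.sqrt_le_left (by norm_num)]; linarith
    have h3 : 1 ≤ Real.exp 3 * Real.exp (-(b * √(Real.log x))) := by
      rw [← Real.exp_add]
      refine Real.one_le_exp ?_
      nlinarith [Real.sqrt_nonneg (Real.log x)]
    calc |Chebyshev.theta x - x| ≤ 3 * x * 1 := by linarith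
      _ ≤ 3 * x * (Real.exp 3 * Real.exp (-(b * √(Real.log x)))) := by gcongr
      _ = 3 * Real.exp 3 * (x * Real.exp (-(b * √(Real.log x)))) := by ring
      _ ≤ _ := by gcongr; linarith

lemma norm_eC (x : ℝ) : ‖eC x‖ = 1 := by
  rw [eC, Complex.norm_exp_ofReal_mul_I]

lemma eC_add (x y : ℝ) : eC (x + y) = eC x * eC y := by
  rw [eC, eC, eC, ← Complex.exp_add]; congr 1; push_cast; ring

lemma eC_neg (x : ℝ) : eC (-x) = (starRingEnd ℂ) (eC x) := by
  rw [eC, eC, ← Complex.exp_conj, map_mul, Complex.conj_ofReal, Complex.conj_I]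
  congr 1; push_cast; ring

/-- Abel's inequality. -/
lemma norm_sum_antitone_mul_le {r : ℕ → ℝ} {v : ℕ → ℂ} {n : ℕ} {B : ℝ}
    (hr : ∀ i, i + 1 < n → r (i + 1) ≤ r i) (hr0 : ∀ i < n, 0 ≤ r i)
    (hB : ∀ k ≤ n, ‖∑ i ∈ range k, v i‖ ≤ B) (hn : 0 < n) :
    ‖∑ i ∈ range n, (r i : ℂ) * v i‖ ≤ r 0 * B := by
  have key : ∀ k, k + 1 ≤ n → ‖∑ i ∈ range (k + 1), (r i : ℂ) * v i -
      (r k : ℂ) * ∑ i ∈ range (k + 1), v i‖ ≤ (r 0 - r k) * B := by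
    intro k
    induction k with
    | zero => intro _; simp
    | succ k ih =>
      intro hk
      have e : ∑ i ∈ range (k + 1 + 1), (r i : ℂ) * v i -
          (r (k + 1) : ℂ) * ∑ i ∈ range (k + 1 + 1), v i =
          (∑ i ∈ range (k + 1), (r i : ℂ) * v i - (r k : ℂ) * ∑ i ∈ range (k + 1), v i) +
          ((r k - r (k + 1) : ℝ) : ℂ) * ∑ i ∈ range (k + 1), v i := by
        rw [sum_range_succ, sum_range_succ v]
        push_cast; ring
      rw [e]
      refine (norm_add_le _ _).trans ?_
      rw [norm_mul, Complex.norm_real, Real.norm_eq_abs,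
        abs_of_nonneg (by linarith [hr k (by omega)])]
      have h1 := ih (by omega)
      have h2 := mul_le_mul_of_nonneg_left (hB (k + 1) (by omega))
        (by linarith [hr k (by omega)] : 0 ≤ r k - r (k + 1))
      linarith
  obtain ⟨k, rfl⟩ : ∃ k, n = k + 1 := ⟨n - 1, by omega⟩
  have h1 := key k le_rfl
  have h2 : ‖(r k : ℂ) * ∑ i ∈ range (k + 1), v i‖ ≤ r k * B := by
    rw [norm_mul, Complex.norm_real, Real.norm_eq_abs, abs_of_nonneg (hr0 k (by omega))]
    exact mul_le_mul_of_nonneg_left (hB _ le_rfl) (hr0 k (by omega))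
  have h3 := norm_add_le (∑ i ∈ range (k + 1), (r i : ℂ) * v i -
      (r k : ℂ) * ∑ i ∈ range (k + 1), v i) ((r k : ℂ) * ∑ i ∈ range (k + 1), v i)
  rw [sub_add_cancel] at h3
  linarith

lemma one_add_cot_mul_one_sub_eC {δ : ℝ} (h : Real.sin (Real.pi * δ) ≠ 0) :
    (1 + ((Real.cos (Real.pi * δ) / Real.sin (Real.pi * δ) : ℝ) : ℂ) * Complex.I) / 2 *
      (1 - eC δ) = 1 := by
  set s := Real.sin (Real.pi * δ) with hs
  set k := Real.cos (Real.pi * δ) with hk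
  have he : eC δ = ((k : ℂ) + s * Complex.I) ^ 2 := by
    rw [eC, hs, hk, Complex.ofReal_cos, Complex.ofReal_sin, ← Complex.exp_mul_I,
      ← Complex.exp_nat_mul]
    congr 1; push_cast; ring
  have h1 : (s : ℂ) ^ 2 + (k : ℂ) ^ 2 = 1 := by
    have := Real.sin_sq_add_cos_sq (Real.pi * δ)
    rw [← hs, ← hk] at this
    exact_mod_cast this
  have h0 : (s : ℂ) ≠ 0 := by exact_mod_cast h
  rw [he]
  push_cast
  have hI : Complex.I ^ 2 = -1 := Complex.I_sq
  field_simp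
  linear_combination (-2 * (s : ℂ) * k ^ 2 - s ^ 3 - (k : ℂ) * s ^ 2 * Complex.I) * hI +
    ((s : ℂ) - k * Complex.I) * h1

/-- The Kusmin–Landau inequality. -/
lemma norm_sum_eC_le {f : ℕ → ℝ} {n : ℕ} {l : ℝ} (hl : 0 < l)
    (h1 : ∀ i < n, l ≤ f (i + 1) - f i) (h2 : ∀ i < n, f (i + 1) - f i ≤ 1 / 2)
    (h3 : ∀ i, i + 1 < n → f (i + 1) - f i ≤ f (i + 2) - f (i + 1)) :
    ‖∑ i ∈ range n, eC (f i)‖ ≤ 1 / l := by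
  rcases Nat.eq_zero_or_pos n with rfl | hn
  · simp; positivity
  set δ : ℕ → ℝ := fun i => f (i + 1) - f i with hδ
  set r : ℕ → ℝ := fun i => Real.cos (Real.pi * δ i) / Real.sin (Real.pi * δ i) with hr
  have hπ := Real.pi_pos
  have hδ0 : ∀ i < n, 0 < Real.pi * δ i := fun i hi => mul_pos hπ (hl.trans_le (h1 i hi))
  have hδ1 : ∀ i < n, Real.pi * δ i ≤ Real.pi / 2 := fun i hi => by
    have := mul_le_mul_of_nonneg_left (h2 i hi) hπ.le
    simp only [hδ]; linarith
  have hs : ∀ i < n, 0 < Real.sin (Real.pi * δ i) := fun i hi =>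
    Real.sin_pos_of_pos_of_lt_pi (hδ0 i hi) (by linarith [hδ1 i hi])
  have hc : ∀ i < n, 0 ≤ Real.cos (Real.pi * δ i) := fun i hi =>
    Real.cos_nonneg_of_mem_Icc ⟨by linarith [hδ0 i hi], hδ1 i hi⟩
  have hz : ∀ i ∈ range n, eC (f i) = (1 / 2 : ℂ) * (eC (f i) - eC (f (i + 1))) +
      (Complex.I / 2) * ((r i : ℂ) * (eC (f i) - eC (f (i + 1)))) := by
    intro i hi
    have hi' := mem_range.mp hi
    have h4 := one_add_cot_mul_one_sub_eC (hs i hi').ne'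
    have h5 : eC (f (i + 1)) = eC (f i) * eC (δ i) := by
      rw [← eC_add]; congr 1; simp only [hδ]; ring
    rw [h5]
    linear_combination (-eC (f i)) * h4
  have htel : ∀ k, ∑ i ∈ range k, (eC (f i) - eC (f (i + 1))) = eC (f 0) - eC (f k) :=
    fun k => sum_range_sub' _ _
  have hB : ∀ k, ‖∑ i ∈ range k, (eC (f i) - eC (f (i + 1)))‖ ≤ 2 := by
    intro k
    rw [htel]
    refine (norm_sub_le _ _).trans ?_
    rw [norm_eC, norm_eC]; norm_num
  have hA := norm_sum_antitone_mul_le (r := r) (v := fun i => eC (f i) - eC (f (i + 1)))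
    (n := n) (B := 2) (fun i hi => by
      have h4 : Real.pi * δ i ≤ Real.pi * δ (i + 1) := mul_le_mul_of_nonneg_left (h3 i hi) hπ.le
      have h5 : Real.cos (Real.pi * δ (i + 1)) ≤ Real.cos (Real.pi * δ i) :=
        Real.cos_le_cos_of_nonneg_of_le_pi (hδ0 i (by omega)).le
          (by linarith [hδ1 (i + 1) hi]) h4
      have h6 : Real.sin (Real.pi * δ i) ≤ Real.sin (Real.pi * δ (i + 1)) :=
        Real.sin_le_sin_of_le_of_le_pi_div_two (by linarith [hδ0 i (by omega)])
          (hδ1 (i + 1) hi) h4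
      exact div_le_div₀ (hc i (by omega)) h5 (hs i (by omega)) h6)
    (fun i hi => div_nonneg (hc i hi) (hs i hi).le) (fun k _ => hB k) hn
  have hr0 : r 0 ≤ 1 / (2 * l) := by
    have h4 := Real.mul_le_sin (hδ0 0 hn).le (hδ1 0 hn)
    have h5 : 2 * l ≤ Real.sin (Real.pi * δ 0) := by
      refine le_trans ?_ h4
      rw [← mul_assoc, div_mul_cancel₀ _ hπ.ne']
      linarith [h1 0 hn]
    exact div_le_div₀ zero_le_one (Real.cos_le_one _) (by positivity) h5
  have hl2 : 1 ≤ 1 / (2 * l) := by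
    rw [le_div_iff₀ (by positivity)]
    linarith [h1 0 hn, h2 0 hn]
  rw [sum_congr rfl hz, sum_add_distrib, ← mul_sum, ← mul_sum]
  refine (norm_add_le _ _).trans ?_
  rw [norm_mul, norm_mul]
  have e1 : ‖(1 / 2 : ℂ)‖ = 1 / 2 := by norm_num
  have e2 : ‖(Complex.I / 2 : ℂ)‖ = 1 / 2 := by simp
  rw [e1, e2]
  have e3 : 1 / l = 1 / (2 * l) + 1 / (2 * l) := by field_simp; norm_num
  linarith [hB n]

lemma mul_rpow_le_sub {c x y : ℝ} (hc : 1 ≤ c) (hx : 0 ≤ x) (hxy : x ≤ y) :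
    c * x ^ (c - 1) * (y - x) ≤ y ^ c - x ^ c ∧ y ^ c - x ^ c ≤ c * y ^ (c - 1) * (y - x) := by
  rcases hxy.eq_or_lt with rfl | hlt
  · simp
  have hd : ∀ z, HasDerivAt (fun z : ℝ => z ^ c) (c * z ^ (c - 1)) z := fun z =>
    Real.hasDerivAt_rpow_const (Or.inr hc)
  obtain ⟨z, hz, he⟩ := exists_hasDerivAt_eq_slope (fun z : ℝ => z ^ c) (fun z => c * z ^ (c - 1))
    hlt (fun z _ => (hd z).continuousAt.continuousWithinAt) (fun z _ => hd z)
  have hyx : 0 < y - x := by linarith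
  rw [eq_div_iff hyx.ne'] at he
  rw [← he]
  have hz0 : 0 ≤ z := hx.trans hz.1.le
  have h1 : x ^ (c - 1) ≤ z ^ (c - 1) := Real.rpow_le_rpow hx hz.1.le (by linarith)
  have h2 : z ^ (c - 1) ≤ y ^ (c - 1) := Real.rpow_le_rpow hz0 hz.2.le (by linarith)
  constructor <;> gcongr

/-- The Kusmin–Landau inequality for the phase `β m ^ c`. -/
lemma norm_sum_eC_mul_rpow_le {c β : ℝ} (hc : 1 < c) (hβ : 0 < β) {a b : ℕ} (ha : 0 < a)
    (hb : β * c * (b : ℝ) ^ (c - 1) ≤ 1 / 2) :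
    ‖∑ m ∈ Ico a b, eC (β * (m : ℝ) ^ c)‖ ≤ 1 / (β * c * (a : ℝ) ^ (c - 1)) := by
  have ha' : (0 : ℝ) < a := by exact_mod_cast ha
  rw [sum_Ico_eq_sum_range]
  have h0 : ∀ m : ℕ, c * (m : ℝ) ^ (c - 1) ≤ ((m + 1 : ℕ) : ℝ) ^ c - (m : ℝ) ^ c ∧
      ((m + 1 : ℕ) : ℝ) ^ c - (m : ℝ) ^ c ≤ c * ((m + 1 : ℕ) : ℝ) ^ (c - 1) := by
    intro m
    have := mul_rpow_le_sub (c := c) (x := m) (y := ((m + 1 : ℕ) : ℝ)) hc.le (by positivity)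
      (by push_cast; linarith)
    rw [show ((m + 1 : ℕ) : ℝ) - (m : ℝ) = 1 by push_cast; ring, mul_one, mul_one] at this
    exact this
  refine norm_sum_eC_le (f := fun i => β * ((a + i : ℕ) : ℝ) ^ c) (by positivity) ?_ ?_ ?_
  · intro i _
    have h1 := (h0 (a + i)).1
    have h2 : (a : ℝ) ^ (c - 1) ≤ ((a + i : ℕ) : ℝ) ^ (c - 1) := by
      refine Real.rpow_le_rpow ha'.le ?_ (by linarith)
      push_cast; linarith [(Nat.cast_nonneg i : (0 : ℝ) ≤ i)]
    rw [← mul_sub, mul_assoc]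
    gcongr
    refine le_trans ?_ h1
    gcongr
  · intro i hi
    have h1 := (h0 (a + i)).2
    have h2 : ((a + i + 1 : ℕ) : ℝ) ^ (c - 1) ≤ (b : ℝ) ^ (c - 1) := by
      refine Real.rpow_le_rpow (by positivity) ?_ (by linarith)
      exact_mod_cast (by omega : a + i + 1 ≤ b)
    refine le_trans ?_ hb
    rw [← mul_sub, mul_assoc]
    gcongr
    refine h1.trans ?_
    gcongr
  · intro i _
    have h1 := (h0 (a + i)).2
    have h2 := (h0 (a + i + 1)).1
    rw [← mul_sub, ← mul_sub]
    exact mul_le_mul_of_nonneg_left (h1.trans h2) hβ.le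

/-- The correlation of two columns of the bilinear form with phase `α (m n) ^ c`. -/
noncomputable def colCorr (c α : ℝ) (Q K M M' n₁ n₂ : ℕ) : ℂ :=
  ∑ m ∈ (Ico M M').filter
    (fun m => (Q < m * n₁ ∧ m * n₁ ≤ K) ∧ (Q < m * n₂ ∧ m * n₂ ≤ K)),
    eC (α * ((m * n₁ : ℕ) : ℝ) ^ c) * (starRingEnd ℂ) (eC (α * ((m * n₂ : ℕ) : ℝ) ^ c))

lemma norm_colCorr_swap (c α : ℝ) (Q K M M' n₁ n₂ : ℕ) :
    ‖colCorr c α Q K M M' n₁ n₂‖ = ‖colCorr c α Q K M M' n₂ n₁‖ := by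
  rw [← Complex.norm_conj, colCorr, colCorr, map_sum]
  congr 1
  refine sum_congr (by ext m; simp only [mem_filter]; tauto) fun m _ => ?_
  rw [map_mul, Complex.conj_conj, mul_comm]

lemma norm_colCorr_le_card (c α : ℝ) (Q K M M' n₁ n₂ : ℕ) :
    ‖colCorr c α Q K M M' n₁ n₂‖ ≤ (M' - M : ℕ) := by
  refine (norm_sum_le _ _).trans ?_
  have h : ∀ m ∈ (Ico M M').filter
      (fun m => (Q < m * n₁ ∧ m * n₁ ≤ K) ∧ (Q < m * n₂ ∧ m * n₂ ≤ K)),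
      ‖eC (α * ((m * n₁ : ℕ) : ℝ) ^ c) * (starRingEnd ℂ) (eC (α * ((m * n₂ : ℕ) : ℝ) ^ c))‖ = 1 := by
    intro m _
    rw [norm_mul, Complex.norm_conj, norm_eC, norm_eC, one_mul]
  rw [sum_congr rfl h, sum_const, nsmul_eq_mul, mul_one]
  exact_mod_cast (card_filter_le _ _).trans (by rw [Nat.card_Ico])

lemma norm_colCorr_le_of_lt {c α : ℝ} (hc : 1 < c) (hα : 0 < α) {Q K M M' n₁ n₂ : ℕ} (hQ : 0 < Q)
    (hn : n₂ < n₁) (hK : α * c ^ 2 * (n₁ - n₂ : ℝ) * (2 * K : ℝ) ^ (c - 1) ≤ 1 / 2) :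
    ‖colCorr c α Q K M M' n₁ n₂‖ ≤ 1 / (α * c ^ 2 * (Q : ℝ) ^ (c - 1) * (n₁ - n₂ : ℝ)) := by
  have hQ' : (0 : ℝ) < Q := by exact_mod_cast hQ
  have hn' : (0 : ℝ) < (n₁ : ℝ) - n₂ := by
    have : (n₂ : ℝ) < n₁ := by exact_mod_cast hn
    linarith
  have hRHS : 0 ≤ 1 / (α * c ^ 2 * (Q : ℝ) ^ (c - 1) * (n₁ - n₂ : ℝ)) := by positivity
  have hc1 : 0 ≤ c - 1 := by linarith
  by_cases hn2 : n₂ = 0 ∨ K < n₁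
  · rw [colCorr, filter_false_of_mem]
    · simpa using hRHS
    · rintro m - ⟨⟨h1, h2⟩, h3, h4⟩
      rcases hn2 with rfl | h
      · simp at h3
      · rcases Nat.eq_zero_or_pos m with rfl | hm
        · simp at h1
        · have := Nat.le_mul_of_pos_left n₁ hm
          omega
  push Not at hn2
  obtain ⟨h20, h1K⟩ := hn2
  have h20 : 0 < n₂ := Nat.pos_of_ne_zero h20
  have h10 : 0 < n₁ := by omega
  have hset : (Ico M M').filter
      (fun m => (Q < m * n₁ ∧ m * n₁ ≤ K) ∧ (Q < m * n₂ ∧ m * n₂ ≤ K)) =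
      Ico (max M (Q / n₂ + 1)) (min M' (K / n₁ + 1)) := by
    ext m
    simp only [mem_filter, mem_Ico, max_le_iff, lt_min_iff, Nat.succ_le_iff,
      Nat.div_lt_iff_lt_mul h20, Nat.lt_succ_iff, Nat.le_div_iff_mul_le h10]
    constructor
    · rintro ⟨⟨h1, h2⟩, ⟨h3, h4⟩, h5, h6⟩
      exact ⟨⟨h1, h5⟩, h2, h4⟩
    · rintro ⟨⟨h1, h5⟩, h2, h4⟩
      have h7 : m * n₂ ≤ m * n₁ := Nat.mul_le_mul_left _ hn.le
      exact ⟨⟨h1, h2⟩, ⟨h5.trans_le h7, h4⟩, h5, h7.trans h4⟩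
  set a := max M (Q / n₂ + 1)
  set b := min M' (K / n₁ + 1)
  have ha : 0 < a := lt_of_lt_of_le (Nat.succ_pos _) (le_max_right _ _)
  have ha2 : Q ≤ n₂ * a := by
    have h1 : Q < n₂ * (Q / n₂ + 1) := Nat.lt_mul_div_succ Q h20
    exact h1.le.trans (Nat.mul_le_mul_left _ (le_max_right _ _))
  have hb2 : n₁ * b ≤ 2 * K := by
    have h1 : n₁ * b ≤ n₁ * (K / n₁ + 1) := Nat.mul_le_mul_left _ (min_le_right _ _)
    have h2 := Nat.mul_div_le K n₁
    linarith [mul_add n₁ (K / n₁) 1]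
  set β := α * ((n₁ : ℝ) ^ c - (n₂ : ℝ) ^ c) with hβ
  obtain ⟨hl, hu⟩ := mul_rpow_le_sub (c := c) (x := n₂) (y := n₁) hc.le (by positivity) (by linarith)
  have h20' : (0 : ℝ) < n₂ := by exact_mod_cast h20
  have hβ0 : 0 < β := by
    refine mul_pos hα (lt_of_lt_of_le ?_ hl)
    positivity
  have hphase : colCorr c α Q K M M' n₁ n₂ = ∑ m ∈ Ico a b, eC (β * (m : ℝ) ^ c) := by
    rw [colCorr, hset]
    refine sum_congr rfl fun m _ => ?_
    rw [← eC_neg, ← eC_add]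
    congr 1
    push_cast
    rw [Real.mul_rpow (by positivity) (by positivity), Real.mul_rpow (by positivity) (by positivity)]
    ring
  rw [hphase]
  refine (norm_sum_eC_mul_rpow_le hc hβ0 ha ?_).trans ?_
  · refine le_trans ?_ hK
    calc β * c * (b : ℝ) ^ (c - 1) ≤ α * (c * (n₁ : ℝ) ^ (c - 1) * (n₁ - n₂)) * c * (b : ℝ) ^ (c - 1) := by
          rw [hβ]; gcongr
      _ = α * c ^ 2 * (n₁ - n₂ : ℝ) * ((n₁ * b : ℕ) : ℝ) ^ (c - 1) := by
          push_cast
          rw [Real.mul_rpow (by positivity) (by positivity)]; ring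
      _ ≤ α * c ^ 2 * (n₁ - n₂ : ℝ) * (2 * K : ℝ) ^ (c - 1) := by
          have h3 : ((n₁ * b : ℕ) : ℝ) ≤ 2 * K := by exact_mod_cast hb2
          have := Real.rpow_le_rpow (by positivity) h3 hc1
          gcongr
  · refine one_div_le_one_div_of_le (by positivity) ?_
    calc α * c ^ 2 * (Q : ℝ) ^ (c - 1) * (n₁ - n₂ : ℝ)
        ≤ α * c ^ 2 * ((n₂ * a : ℕ) : ℝ) ^ (c - 1) * (n₁ - n₂ : ℝ) := by
          have h3 : (Q : ℝ) ≤ ((n₂ * a : ℕ) : ℝ) := by exact_mod_cast ha2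
          have := Real.rpow_le_rpow (by positivity) h3 hc1
          gcongr
      _ = α * (c * (n₂ : ℝ) ^ (c - 1) * (n₁ - n₂)) * c * (a : ℝ) ^ (c - 1) := by
          push_cast
          rw [Real.mul_rpow (by positivity) (by positivity)]; ring
      _ ≤ β * c * (a : ℝ) ^ (c - 1) := by
          rw [hβ]; gcongr

lemma norm_colCorr_le {c α : ℝ} (hc : 1 < c) (hα : 0 < α) {Q K M M' n₁ n₂ H : ℕ} (hQ : 0 < Q)
    (hn : n₁ ≠ n₂) (h1 : n₁ < n₂ + H) (h2 : n₂ < n₁ + H)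
    (hK : α * c ^ 2 * H * (2 * K : ℝ) ^ (c - 1) ≤ 1 / 2) :
    ‖colCorr c α Q K M M' n₁ n₂‖ ≤ 1 / (α * c ^ 2 * (Q : ℝ) ^ (c - 1)) * (1 / |(n₁ : ℝ) - n₂|) := by
  wlog hlt : n₂ < n₁ generalizing n₁ n₂
  · rw [norm_colCorr_swap, abs_sub_comm]
    exact this hn.symm h2 h1 (by omega)
  have hlt' : (n₂ : ℝ) < n₁ := by exact_mod_cast hlt
  have h1' : (n₁ : ℝ) - n₂ ≤ H := by
    have : (n₁ : ℝ) < n₂ + H := by exact_mod_cast h1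
    linarith
  rw [one_div_mul_one_div, abs_of_pos (by linarith)]
  refine norm_colCorr_le_of_lt hc hα hQ hlt (le_trans ?_ hK)
  gcongr

lemma sum_norm_sq_block_le {c α L : ℝ} (hc : 1 < c) (hα : 0 < α) {Q K M M' H : ℕ} (hQ : 0 < Q)
    (hK : α * c ^ 2 * H * (2 * K : ℝ) ^ (c - 1) ≤ 1 / 2) {b : ℕ → ℂ} (hb : ∀ n, ‖b n‖ ≤ L)
    {B : Finset ℕ} (hB : ∀ n₁ ∈ B, ∀ n₂ ∈ B, n₁ < n₂ + H) :
    ∑ m ∈ Ico M M', ‖∑ n ∈ B, if Q < m * n ∧ m * n ≤ K then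
      b n * eC (α * ((m * n : ℕ) : ℝ) ^ c) else 0‖ ^ 2 ≤
    L ^ 2 * ∑ n₁ ∈ B, (((M' - M : ℕ) : ℝ) + 1 / (α * c ^ 2 * (Q : ℝ) ^ (c - 1)) *
      ∑ n₂ ∈ B.erase n₁, 1 / |(n₁ : ℝ) - n₂|) := by
  have hL : 0 ≤ L := (norm_nonneg _).trans (hb 0)
  set z : ℕ → ℕ → ℂ := fun m n => if Q < m * n ∧ m * n ≤ K then
      b n * eC (α * ((m * n : ℕ) : ℝ) ^ c) else 0 with hz
  have e : ((∑ m ∈ Ico M M', ‖∑ n ∈ B, z m n‖ ^ 2 : ℝ) : ℂ) =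
      ∑ n₁ ∈ B, ∑ n₂ ∈ B, b n₁ * (starRingEnd ℂ) (b n₂) * colCorr c α Q K M M' n₁ n₂ := by
    push_cast
    have h1 : ∀ m ∈ Ico M M', ((‖∑ n ∈ B, z m n‖ : ℂ)) ^ 2 =
        ∑ n₁ ∈ B, ∑ n₂ ∈ B, z m n₁ * (starRingEnd ℂ) (z m n₂) := by
      intro m _
      rw [← Complex.mul_conj', map_sum, sum_mul_sum]
    rw [sum_congr rfl h1, sum_comm]
    refine sum_congr rfl fun n₁ _ => ?_
    rw [sum_comm]
    refine sum_congr rfl fun n₂ _ => ?_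
    rw [colCorr, mul_sum, sum_filter]
    refine sum_congr rfl fun m _ => ?_
    simp only [hz]
    by_cases h3 : Q < m * n₁ ∧ m * n₁ ≤ K <;> by_cases h4 : Q < m * n₂ ∧ m * n₂ ≤ K
    · rw [if_pos h3, if_pos h4, if_pos ⟨h3, h4⟩, map_mul]; ring
    · have h5 : ¬((Q < m * n₁ ∧ m * n₁ ≤ K) ∧ (Q < m * n₂ ∧ m * n₂ ≤ K)) := fun h => h4 h.2
      rw [if_neg h4, if_neg h5, map_zero, mul_zero]
    · have h5 : ¬((Q < m * n₁ ∧ m * n₁ ≤ K) ∧ (Q < m * n₂ ∧ m * n₂ ≤ K)) := fun h => h3 h.1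
      rw [if_neg h3, if_neg h5, zero_mul]
    · have h5 : ¬((Q < m * n₁ ∧ m * n₁ ≤ K) ∧ (Q < m * n₂ ∧ m * n₂ ≤ K)) := fun h => h3 h.1
      rw [if_neg h3, if_neg h5, zero_mul]
  have h0 : 0 ≤ ∑ m ∈ Ico M M', ‖∑ n ∈ B, z m n‖ ^ 2 := sum_nonneg fun _ _ => by positivity
  rw [← abs_of_nonneg h0, ← Real.norm_eq_abs, ← Complex.norm_real, e, mul_sum]
  refine (norm_sum_le _ _).trans (sum_le_sum fun n₁ hn₁ => ?_)
  refine (norm_sum_le _ _).trans ?_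
  have hterm : ∀ n₂, ‖b n₁ * (starRingEnd ℂ) (b n₂) * colCorr c α Q K M M' n₁ n₂‖ ≤
      L ^ 2 * ‖colCorr c α Q K M M' n₁ n₂‖ := by
    intro n₂
    rw [norm_mul, norm_mul, Complex.norm_conj, sq]
    have := hb n₁
    have := hb n₂
    gcongr
  rw [← add_sum_erase _ _ hn₁, mul_add, mul_sum (s := B.erase n₁), mul_sum (s := B.erase n₁)]
  refine add_le_add ((hterm _).trans ?_) (sum_le_sum fun n₂ hn₂ => (hterm _).trans ?_)
  · gcongr
    exact norm_colCorr_le_card _ _ _ _ _ _ _ _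
  · rw [mem_erase] at hn₂
    gcongr
    exact norm_colCorr_le hc hα hQ (Ne.symm hn₂.1) (hB _ hn₁ _ hn₂.2) (hB _ hn₂.2 _ hn₁) hK

lemma sum_inv_le_log (N : ℕ) : ∑ h ∈ Icc 1 N, 1 / (h : ℝ) ≤ 1 + Real.log N := by
  have h := harmonic_le_one_add_log N
  rw [harmonic_eq_sum_Icc] at h
  push_cast at h
  simpa only [one_div] using h

lemma sum_inv_dist_le {N n : ℕ} (hn : n ≤ N) {B : Finset ℕ} (hB : ∀ k ∈ B, k ≤ N) :
    ∑ k ∈ B.erase n, 1 / |(n : ℝ) - k| ≤ 2 * (1 + Real.log N) := by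
  have h1 : ∑ k ∈ (B.erase n).filter (fun k => k < n), 1 / |(n : ℝ) - k| ≤
      ∑ h ∈ Icc 1 N, 1 / (h : ℝ) := by
    have e : ∑ k ∈ (B.erase n).filter (fun k => k < n), 1 / |(n : ℝ) - k| =
        ∑ h ∈ ((B.erase n).filter (fun k => k < n)).image (fun k => n - k), 1 / (h : ℝ) := by
      rw [sum_image]
      · refine sum_congr rfl fun k hk => ?_
        have hk' : k < n := (mem_filter.mp hk).2
        have : (k : ℝ) < n := by exact_mod_cast hk'
        rw [Nat.cast_sub hk'.le, abs_of_pos (by linarith)]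
      · intro k hk k' hk' h
        have h1 := (mem_filter.mp hk).2
        have h2 := (mem_filter.mp hk').2
        simp only at h
        omega
    rw [e]
    refine sum_le_sum_of_subset_of_nonneg ?_ fun _ _ _ => by positivity
    intro h hh
    obtain ⟨k, hk, rfl⟩ := mem_image.mp hh
    have h1 := (mem_filter.mp hk).2
    rw [mem_Icc]; omega
  have h2 : ∑ k ∈ (B.erase n).filter (fun k => ¬ k < n), 1 / |(n : ℝ) - k| ≤
      ∑ h ∈ Icc 1 N, 1 / (h : ℝ) := by
    have hgt : ∀ k ∈ (B.erase n).filter (fun k => ¬ k < n), n < k ∧ k ≤ N := by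
      intro k hk
      have h1 := (mem_filter.mp hk).2
      have h2 := mem_erase.mp (mem_filter.mp hk).1
      exact ⟨by omega, hB k h2.2⟩
    have e : ∑ k ∈ (B.erase n).filter (fun k => ¬ k < n), 1 / |(n : ℝ) - k| =
        ∑ h ∈ ((B.erase n).filter (fun k => ¬ k < n)).image (fun k => k - n), 1 / (h : ℝ) := by
      rw [sum_image]
      · refine sum_congr rfl fun k hk => ?_
        have hk' := (hgt k hk).1
        have : (n : ℝ) < k := by exact_mod_cast hk'
        rw [Nat.cast_sub hk'.le, abs_of_neg (by linarith), neg_sub]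
      · intro k hk k' hk' h
        have h1 := hgt k hk
        have h2 := hgt k' hk'
        simp only at h
        omega
    rw [e]
    refine sum_le_sum_of_subset_of_nonneg ?_ fun _ _ _ => by positivity
    intro h hh
    obtain ⟨k, hk, rfl⟩ := mem_image.mp hh
    have h1 := hgt k hk
    rw [mem_Icc]; omega
  rw [← sum_filter_add_sum_filter_not _ (fun k => k < n)]
  linarith [sum_inv_le_log N]

/-- The estimate for one dyadic range of a bilinear form with phase `α (m n) ^ c`. -/
lemma norm_sq_bilinear_le {c α L : ℝ} (hc : 1 < c) (hα : 0 < α) {Q K M M' N H : ℕ} (hQ : 0 < Q)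
    (hH : 0 < H) (hK : α * c ^ 2 * H * (2 * K : ℝ) ^ (c - 1) ≤ 1 / 2)
    {a b : ℕ → ℂ} (hb : ∀ n, ‖b n‖ ≤ L) :
    ‖∑ m ∈ Ico M M', a m * ∑ n ∈ Icc 1 N, if Q < m * n ∧ m * n ≤ K then
      b n * eC (α * ((m * n : ℕ) : ℝ) ^ c) else 0‖ ^ 2 ≤
    (∑ m ∈ Ico M M', ‖a m‖ ^ 2) * ((N / H + 1 : ℕ) * (L ^ 2 * (N * (((M' - M : ℕ) : ℝ) +
      1 / (α * c ^ 2 * (Q : ℝ) ^ (c - 1)) * (2 * (1 + Real.log N)))))) := by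
  set z : ℕ → ℕ → ℂ := fun m n => if Q < m * n ∧ m * n ≤ K then
      b n * eC (α * ((m * n : ℕ) : ℝ) ^ c) else 0 with hz
  set J := N / H + 1 with hJ
  have h1 : ‖∑ m ∈ Ico M M', a m * ∑ n ∈ Icc 1 N, z m n‖ ^ 2 ≤
      (∑ m ∈ Ico M M', ‖a m‖ ^ 2) * ∑ m ∈ Ico M M', ‖∑ n ∈ Icc 1 N, z m n‖ ^ 2 := by
    have h2 : ‖∑ m ∈ Ico M M', a m * ∑ n ∈ Icc 1 N, z m n‖ ≤
        ∑ m ∈ Ico M M', ‖a m‖ * ‖∑ n ∈ Icc 1 N, z m n‖ :=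
      (norm_sum_le _ _).trans (sum_le_sum fun m _ => (norm_mul _ _).le)
    calc _ ≤ (∑ m ∈ Ico M M', ‖a m‖ * ‖∑ n ∈ Icc 1 N, z m n‖) ^ 2 := by gcongr
      _ ≤ _ := sum_mul_sq_le_sq_mul_sq _ _ _
  refine h1.trans ?_
  gcongr
  have hblocks : ∀ m, ‖∑ n ∈ Icc 1 N, z m n‖ ^ 2 ≤
      J * ∑ j ∈ range J, ‖∑ n ∈ (Icc 1 N).filter (fun n => n / H = j), z m n‖ ^ 2 := by
    intro m
    have e : ∑ n ∈ Icc 1 N, z m n =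
        ∑ j ∈ range J, ∑ n ∈ (Icc 1 N).filter (fun n => n / H = j), z m n := by
      rw [sum_fiberwise_of_maps_to]
      intro n hn
      rw [mem_range, hJ, Nat.lt_succ_iff]
      exact Nat.div_le_div_right (mem_Icc.mp hn).2
    rw [e]
    calc _ ≤ (∑ j ∈ range J, ‖∑ n ∈ (Icc 1 N).filter (fun n => n / H = j), z m n‖) ^ 2 := by
          gcongr; exact norm_sum_le _ _
      _ ≤ _ := by
          have := sq_sum_le_card_mul_sum_sq (s := range J)
            (f := fun j => ‖∑ n ∈ (Icc 1 N).filter (fun n => n / H = j), z m n‖)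
          rwa [card_range] at this
  refine (sum_le_sum fun m _ => hblocks m).trans ?_
  rw [← mul_sum, sum_comm]
  gcongr
  have hj : ∀ j ∈ range J, ∑ m ∈ Ico M M',
      ‖∑ n ∈ (Icc 1 N).filter (fun n => n / H = j), z m n‖ ^ 2 ≤
      L ^ 2 * ∑ n ∈ (Icc 1 N).filter (fun n => n / H = j), (((M' - M : ℕ) : ℝ) +
      1 / (α * c ^ 2 * (Q : ℝ) ^ (c - 1)) * (2 * (1 + Real.log N))) := by
    intro j _
    refine (sum_norm_sq_block_le hc hα hQ hK hb ?_).trans ?_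
    · intro n₁ h₁ n₂ h₂
      have e1 := (mem_filter.mp h₁).2
      have e2 := (mem_filter.mp h₂).2
      have h3 := Nat.div_add_mod n₁ H
      have h4 := Nat.div_add_mod n₂ H
      have h5 := Nat.mod_lt n₁ hH
      rw [e1] at h3
      rw [e2] at h4
      omega
    · gcongr with n hn
      · exact sum_inv_dist_le (mem_Icc.mp (mem_filter.mp hn).1).2
          fun k hk => (mem_Icc.mp (mem_filter.mp hk).1).2
  refine (sum_le_sum hj).trans ?_
  rw [← mul_sum, sum_fiberwise_of_maps_to]
  · rw [sum_const, Nat.card_Icc, nsmul_eq_mul, Nat.add_sub_cancel]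
  · intro n hn
    rw [mem_range, hJ, Nat.lt_succ_iff]
    exact Nat.div_le_div_right (mem_Icc.mp hn).2

lemma sum_divisorsAntidiagonal_eq {R : Type*} [AddCommMonoid R] (K : ℕ) (F : ℕ → ℕ → R) :
    ∑ n ∈ Icc 1 K, ∑ p ∈ n.divisorsAntidiagonal, F p.1 p.2 =
      ∑ d ∈ Icc 1 K, ∑ m ∈ Icc 1 K, if d * m ≤ K then F d m else 0 := by
  rw [← sum_product', ← sum_filter,
    ← sum_fiberwise_of_maps_to (t := Icc 1 K) (g := fun p : ℕ × ℕ => p.1 * p.2)]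
  · refine sum_congr rfl fun n hn => sum_congr ?_ fun _ _ => rfl
    ext p
    simp only [Nat.mem_divisorsAntidiagonal, mem_filter, mem_product, mem_Icc] at hn ⊢
    constructor
    · rintro ⟨h1, h2⟩
      have h3 : 0 < p.1 := Nat.pos_of_ne_zero fun h => by simp [h] at h1; omega
      have h4 : 0 < p.2 := Nat.pos_of_ne_zero fun h => by simp [h] at h1; omega
      have h5 := Nat.le_mul_of_pos_right p.1 h4
      have h6 := Nat.le_mul_of_pos_left p.2 h3
      omega
    · rintro ⟨h1, h2⟩
      exact ⟨h2, by omega⟩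
  · intro p hp
    simp only [mem_filter, mem_product, mem_Icc] at hp ⊢
    exact ⟨Nat.mul_pos hp.1.1.1 hp.1.2.1, hp.2⟩

lemma card_divisors_eq_sum (n : ℕ) :
    ((n.divisors.card : ℕ) : ℝ) = ∑ _p ∈ n.divisorsAntidiagonal, (1 : ℝ) := by
  rw [sum_const, nsmul_eq_mul, mul_one]
  congr 1
  rw [← Nat.map_div_right_divisors, card_map]

lemma sum_card_divisors_le (K : ℕ) :
    ∑ k ∈ Icc 1 K, ((k.divisors.card : ℕ) : ℝ) ≤ K * (1 + Real.log K) := by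
  have h1 : ∀ d ∈ Icc 1 K, (∑ m ∈ Icc 1 K, if d * m ≤ K then (1 : ℝ) else 0) ≤ K * (1 / (d : ℝ)) := by
    intro d hd
    have hd1 : 0 < d := (mem_Icc.mp hd).1
    have h2 : (Icc 1 K).filter (fun m => d * m ≤ K) ⊆ Icc 1 (K / d) := by
      intro m hm
      rw [mem_filter, mem_Icc] at hm
      rw [mem_Icc, Nat.le_div_iff_mul_le hd1, mul_comm]
      exact ⟨hm.1.1, hm.2⟩
    rw [← sum_filter, sum_const, nsmul_eq_mul, mul_one]
    have h3 := card_le_card h2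
    rw [Nat.card_Icc, Nat.add_sub_cancel] at h3
    calc (((Icc 1 K).filter (fun m => d * m ≤ K)).card : ℝ) ≤ ((K / d : ℕ) : ℝ) := by exact_mod_cast h3
      _ ≤ (K : ℝ) / d := Nat.cast_div_le
      _ = _ := by ring
  rw [sum_congr rfl fun k _ => card_divisors_eq_sum k,
    sum_divisorsAntidiagonal_eq K fun _ _ => (1 : ℝ)]
  refine (sum_le_sum h1).trans ?_
  rw [← mul_sum]
  gcongr
  exact sum_inv_le_log K

lemma sum_card_divisors_div_le (K : ℕ) :
    ∑ k ∈ Icc 1 K, ((k.divisors.card : ℕ) : ℝ) / k ≤ (1 + Real.log K) ^ 2 := by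
  have h1 : ∀ k ∈ Icc 1 K, ((k.divisors.card : ℕ) : ℝ) / k =
      ∑ p ∈ k.divisorsAntidiagonal, (1 / (p.1 : ℝ)) * (1 / (p.2 : ℝ)) := by
    intro k _
    rw [card_divisors_eq_sum, sum_div]
    refine sum_congr rfl fun p hp => ?_
    rw [← (Nat.mem_divisorsAntidiagonal.mp hp).1, one_div_mul_one_div]
    push_cast; rfl
  rw [sum_congr rfl h1, sum_divisorsAntidiagonal_eq K fun a b => (1 / (a : ℝ)) * (1 / (b : ℝ))]
  have h2 : ∑ d ∈ Icc 1 K, (∑ m ∈ Icc 1 K, if d * m ≤ K then (1 / (d : ℝ)) * (1 / (m : ℝ)) else 0) ≤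
      (∑ d ∈ Icc 1 K, 1 / (d : ℝ)) * ∑ m ∈ Icc 1 K, 1 / (m : ℝ) := by
    rw [sum_mul_sum]
    refine sum_le_sum fun d _ => sum_le_sum fun m _ => ?_
    split_ifs
    · exact le_rfl
    · positivity
  refine h2.trans ?_
  rw [sq]
  have h3 := sum_inv_le_log K
  have h4 : 0 ≤ ∑ d ∈ Icc 1 K, 1 / (d : ℝ) := sum_nonneg fun _ _ => by positivity
  gcongr

lemma card_divisors_mul_le (d k : ℕ) : (d * k).divisors.card ≤ d.divisors.card * k.divisors.card := by
  rw [Nat.divisors_mul]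
  exact card_mul_le

lemma sum_card_divisors_sq_le (K : ℕ) :
    ∑ k ∈ Icc 1 K, ((k.divisors.card : ℕ) : ℝ) ^ 2 ≤ K * (1 + Real.log K) ^ 3 := by
  have h1 : ∀ k ∈ Icc 1 K, ((k.divisors.card : ℕ) : ℝ) ^ 2 ≤
      ∑ p ∈ k.divisorsAntidiagonal, ((p.1.divisors.card : ℕ) : ℝ) * ((p.2.divisors.card : ℕ) : ℝ) := by
    intro k _
    rw [sq]
    nth_rewrite 1 [card_divisors_eq_sum]
    rw [sum_mul]
    refine sum_le_sum fun p hp => ?_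
    rw [← (Nat.mem_divisorsAntidiagonal.mp hp).1, one_mul]
    exact_mod_cast card_divisors_mul_le p.1 p.2
  refine (sum_le_sum h1).trans ?_
  rw [sum_divisorsAntidiagonal_eq K
    fun a b => ((a.divisors.card : ℕ) : ℝ) * ((b.divisors.card : ℕ) : ℝ)]
  have h2 : ∀ d ∈ Icc 1 K, (∑ m ∈ Icc 1 K, if d * m ≤ K then
      ((d.divisors.card : ℕ) : ℝ) * ((m.divisors.card : ℕ) : ℝ) else 0) ≤
      K * (1 + Real.log K) * (((d.divisors.card : ℕ) : ℝ) / d) := by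
    intro d hd
    have hd1 : 0 < d := (mem_Icc.mp hd).1
    have hdK : d ≤ K := (mem_Icc.mp hd).2
    have h3 : (Icc 1 K).filter (fun m => d * m ≤ K) ⊆ Icc 1 (K / d) := by
      intro m hm
      rw [mem_filter, mem_Icc] at hm
      rw [mem_Icc, Nat.le_div_iff_mul_le hd1, mul_comm]
      exact ⟨hm.1.1, hm.2⟩
    have hKd : 0 < K / d := Nat.div_pos hdK hd1
    have hle : ((K / d : ℕ) : ℝ) ≤ (K : ℝ) / d := Nat.cast_div_le
    rw [← sum_filter, ← mul_sum]
    calc _ ≤ ((d.divisors.card : ℕ) : ℝ) * ∑ m ∈ Icc 1 (K / d), ((m.divisors.card : ℕ) : ℝ) := by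
          gcongr
      _ ≤ ((d.divisors.card : ℕ) : ℝ) * ((K / d : ℕ) * (1 + Real.log (K / d : ℕ))) := by
          gcongr
          exact sum_card_divisors_le _
      _ ≤ ((d.divisors.card : ℕ) : ℝ) * ((K : ℝ) / d * (1 + Real.log K)) := by
          have : Real.log (K / d : ℕ) ≤ Real.log K :=
            Real.log_le_log (by exact_mod_cast hKd) (by exact_mod_cast Nat.div_le_self K d)
          have : 0 ≤ Real.log (K / d : ℕ) := Real.log_natCast_nonneg _
          gcongr
      _ = _ := by ring
  refine (sum_le_sum h2).trans ?_
  rw [← mul_sum]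
  have h3 := sum_card_divisors_div_le K
  have h4 : 0 ≤ Real.log K := Real.log_natCast_nonneg _
  calc _ ≤ K * (1 + Real.log K) * (1 + Real.log K) ^ 2 := by gcongr
    _ = _ := by ring

lemma norm_sum_eC_smooth_le {c α : ℝ} (hc : 1 < c) (hα : 0 < α) {Q K d a b : ℕ} (hQ : 0 < Q)
    (hd : 0 < d) (ha : Q < d * a) (hb : d * b ≤ 2 * K)
    (hK : α * c * d * (2 * K : ℝ) ^ (c - 1) ≤ 1 / 2) :
    ‖∑ m ∈ Ico a b, eC (α * ((d * m : ℕ) : ℝ) ^ c)‖ ≤ 1 / (α * c * (Q : ℝ) ^ (c - 1)) * (1 / d) := by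
  have hc1 : 0 ≤ c - 1 := by linarith
  have hd' : (0 : ℝ) < d := by exact_mod_cast hd
  have hQ' : (0 : ℝ) < Q := by exact_mod_cast hQ
  have ha0 : 0 < a := Nat.pos_of_ne_zero fun h => by simp [h] at ha
  have hdc : (d : ℝ) ^ c = d * (d : ℝ) ^ (c - 1) := by
    rw [Real.rpow_sub_one hd'.ne']; field_simp
  have hphase : ∀ m ∈ Ico a b, eC (α * ((d * m : ℕ) : ℝ) ^ c) = eC (α * (d : ℝ) ^ c * (m : ℝ) ^ c) := by
    intro m _
    push_cast
    rw [Real.mul_rpow (by positivity) (by positivity), mul_assoc]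
  rw [sum_congr rfl hphase]
  refine (norm_sum_eC_mul_rpow_le hc (by positivity) ha0 ?_).trans ?_
  · refine le_trans ?_ hK
    have h1 : ((d * b : ℕ) : ℝ) ≤ 2 * K := by exact_mod_cast hb
    have h2 := Real.rpow_le_rpow (by positivity) h1 hc1
    calc α * (d : ℝ) ^ c * c * (b : ℝ) ^ (c - 1) = α * c * d * ((d * b : ℕ) : ℝ) ^ (c - 1) := by
          push_cast
          rw [Real.mul_rpow (by positivity) (by positivity), hdc]; ring
      _ ≤ _ := by gcongr
  · rw [one_div_mul_one_div]
    refine one_div_le_one_div_of_le (by positivity) ?_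
    have h1 : (Q : ℝ) ≤ ((d * a : ℕ) : ℝ) := by exact_mod_cast ha.le
    have h2 := Real.rpow_le_rpow (by positivity) h1 hc1
    calc α * c * (Q : ℝ) ^ (c - 1) * d ≤ α * c * ((d * a : ℕ) : ℝ) ^ (c - 1) * d := by gcongr
      _ = α * (d : ℝ) ^ c * c * (a : ℝ) ^ (c - 1) := by
          push_cast
          rw [Real.mul_rpow (by positivity) (by positivity), hdc]; ring

lemma sum_ite_eq_sum_Ico {R : Type*} [AddCommMonoid R] {Q K d : ℕ} (hd : 0 < d) (F : ℕ → R) :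
    ∑ m ∈ Icc 1 K, (if Q < d * m ∧ d * m ≤ K then F m else 0) =
      ∑ m ∈ Ico (Q / d + 1) (K / d + 1), F m := by
  rw [← sum_filter]
  refine sum_congr ?_ fun _ _ => rfl
  ext m
  simp only [mem_filter, mem_Icc, mem_Ico, Nat.succ_le_iff, Nat.div_lt_iff_lt_mul hd,
    Nat.lt_succ_iff, Nat.le_div_iff_mul_le hd]
  rw [mul_comm d m]
  constructor
  · rintro ⟨_, h⟩; exact h
  · rintro ⟨h1, h2⟩
    have h3 : 0 < m := Nat.pos_of_ne_zero fun h => by simp [h] at h1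
    have := Nat.le_mul_of_pos_right m hd
    exact ⟨⟨h3, by omega⟩, h1, h2⟩

lemma mul_div_add_one_le {K d : ℕ} (hdK : d ≤ K) : d * (K / d + 1) ≤ 2 * K := by
  have := Nat.mul_div_le K d
  rw [mul_add]; omega

lemma norm_sum_smooth_le {c α : ℝ} (hc : 1 < c) (hα : 0 < α) {Q K d : ℕ} (hQ : 0 < Q)
    (hd : 0 < d) (hdK : d ≤ K) (hK : α * c * d * (2 * K : ℝ) ^ (c - 1) ≤ 1 / 2) :
    ‖∑ m ∈ Icc 1 K, (if Q < d * m ∧ d * m ≤ K then eC (α * ((d * m : ℕ) : ℝ) ^ c) else 0)‖ ≤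
      1 / (α * c * (Q : ℝ) ^ (c - 1)) * (1 / d) := by
  rw [sum_ite_eq_sum_Ico hd]
  exact norm_sum_eC_smooth_le hc hα hQ hd (Nat.lt_mul_div_succ Q hd) (mul_div_add_one_le hdK) hK

lemma norm_sum_log_smooth_le {c α : ℝ} (hc : 1 < c) (hα : 0 < α) {Q K d : ℕ} (hQ : 0 < Q)
    (hd : 0 < d) (hdK : d ≤ K) (hK : α * c * d * (2 * K : ℝ) ^ (c - 1) ≤ 1 / 2) :
    ‖∑ m ∈ Icc 1 K, (if Q < d * m ∧ d * m ≤ K then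
      (Real.log m : ℂ) * eC (α * ((d * m : ℕ) : ℝ) ^ c) else 0)‖ ≤
      2 * Real.log K * (1 / (α * c * (Q : ℝ) ^ (c - 1)) * (1 / d)) := by
  have hQ' : (0 : ℝ) < Q := by exact_mod_cast hQ
  have hd' : (0 : ℝ) < d := by exact_mod_cast hd
  rw [sum_ite_eq_sum_Ico hd]
  set a := Q / d + 1
  have ha : 0 < a := Nat.succ_pos _
  set b := K / d + 1
  set Y := 1 / (α * c * (Q : ℝ) ^ (c - 1)) * (1 / d) with hY
  have hY0 : 0 ≤ Y := by positivity
  have hlK : 0 ≤ Real.log K := Real.log_natCast_nonneg _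
  have hpart : ∀ k, k ≤ b - a → ‖∑ i ∈ range k, eC (α * ((d * (a + i) : ℕ) : ℝ) ^ c)‖ ≤ Y := by
    intro k hk
    rcases Nat.eq_zero_or_pos k with rfl | hk0
    · simpa using hY0
    have h1 := norm_sum_eC_smooth_le hc hα hQ hd (a := a) (b := a + k) (Q := Q) (K := K)
      (Nat.lt_mul_div_succ Q hd) ?_ hK
    · rwa [sum_Ico_eq_sum_range, Nat.add_sub_cancel_left] at h1
    · exact (Nat.mul_le_mul_left d (by omega)).trans (mul_div_add_one_le hdK)
  rw [sum_Ico_eq_sum_range]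
  rcases Nat.eq_zero_or_pos (b - a) with h0 | h0
  · rw [h0]; simp; positivity
  have hlog : ∀ i, i < b - a → Real.log ((a + i : ℕ) : ℝ) ≤ Real.log K := by
    intro i hi
    refine Real.log_le_log ?_ ?_
    · exact Nat.cast_pos.mpr (by omega)
    · have : K / d ≤ K := Nat.div_le_self _ _
      exact Nat.cast_le.mpr (by omega)
  have e : ∑ i ∈ range (b - a), (Real.log ((a + i : ℕ) : ℝ) : ℂ) * eC (α * ((d * (a + i) : ℕ) : ℝ) ^ c) =
      (Real.log K : ℂ) * ∑ i ∈ range (b - a), eC (α * ((d * (a + i) : ℕ) : ℝ) ^ c) -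
      ∑ i ∈ range (b - a), ((Real.log K - Real.log ((a + i : ℕ) : ℝ) : ℝ) : ℂ) *
        eC (α * ((d * (a + i) : ℕ) : ℝ) ^ c) := by
    rw [mul_sum, ← sum_sub_distrib]
    refine sum_congr rfl fun i _ => ?_
    push_cast; ring
  rw [e]
  have h1 := norm_sum_antitone_mul_le
    (r := fun i => Real.log K - Real.log ((a + i : ℕ) : ℝ))
    (v := fun i => eC (α * ((d * (a + i) : ℕ) : ℝ) ^ c)) (n := b - a) (B := Y)
    (fun i hi => by
      have : Real.log ((a + i : ℕ) : ℝ) ≤ Real.log ((a + (i + 1) : ℕ) : ℝ) := by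
        refine Real.log_le_log ?_ ?_
        · exact Nat.cast_pos.mpr (by omega)
        · exact Nat.cast_le.mpr (by omega)
      linarith)
    (fun i hi => by linarith [hlog i hi]) hpart h0
  have h2 : Real.log K - Real.log ((a + 0 : ℕ) : ℝ) ≤ Real.log K := by
    linarith [Real.log_natCast_nonneg (a + 0)]
  have h3 : ‖(Real.log K : ℂ) * ∑ i ∈ range (b - a), eC (α * ((d * (a + i) : ℕ) : ℝ) ^ c)‖ ≤
      Real.log K * Y := by
    rw [norm_mul, Complex.norm_real, Real.norm_eq_abs, abs_of_nonneg hlK]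
    gcongr
    exact hpart _ le_rfl
  have h4 := mul_le_mul_of_nonneg_right h2 hY0
  refine (norm_sub_le _ _).trans ?_
  linarith

/-- The part of an arithmetic function supported on `n ≤ v`. -/
noncomputable def truncArith (f : ArithmeticFunction ℝ) (v : ℕ) : ArithmeticFunction ℝ :=
  ⟨fun n => if n ≤ v then f n else 0, by simp⟩

lemma truncArith_apply (f : ArithmeticFunction ℝ) (v n : ℕ) :
    truncArith f v n = if n ≤ v then f n else 0 := rfl

/-- The Möbius function with real values. -/
noncomputable def moebiusReal : ArithmeticFunction ℝ := (ArithmeticFunction.moebius : ArithmeticFunction ℝ)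

lemma abs_moebiusReal_le (n : ℕ) : |moebiusReal n| ≤ 1 := by
  have h := ArithmeticFunction.abs_moebius_le_one (n := n)
  rw [moebiusReal, ArithmeticFunction.intCoe_apply]
  exact_mod_cast h

/-- Vaughan's identity. -/
lemma vaughan_identity (v : ℕ) :
    ArithmeticFunction.vonMangoldt = truncArith ArithmeticFunction.vonMangoldt v +
      truncArith moebiusReal v * ArithmeticFunction.log -
      (truncArith moebiusReal v * truncArith ArithmeticFunction.vonMangoldt v) *
        ((ArithmeticFunction.zeta : ArithmeticFunction ℝ)) +
      ((moebiusReal - truncArith moebiusReal v) * ((ArithmeticFunction.zeta : ArithmeticFunction ℝ))) *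
        (ArithmeticFunction.vonMangoldt - truncArith ArithmeticFunction.vonMangoldt v) := by
  have h1 := ArithmeticFunction.vonMangoldt_mul_zeta
  have h2 : moebiusReal * ((ArithmeticFunction.zeta : ArithmeticFunction ℝ)) = 1 :=
    ArithmeticFunction.coe_moebius_mul_coe_zeta
  linear_combination (truncArith moebiusReal v) * h1 -
    (ArithmeticFunction.vonMangoldt - truncArith ArithmeticFunction.vonMangoldt v) * h2

/-- The sum of `f(n) e(α n ^ c)` over `Q < n ≤ K`. -/
noncomputable def expSum (c α : ℝ) (Q K : ℕ) (f : ℕ → ℝ) : ℂ :=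
  ∑ n ∈ Icc 1 K, if Q < n then (f n : ℂ) * eC (α * (n : ℝ) ^ c) else 0

lemma expSum_mul (c α : ℝ) (Q K : ℕ) (f g : ArithmeticFunction ℝ) :
    expSum c α Q K ⇑(f * g) = ∑ d ∈ Icc 1 K, (f d : ℂ) * ∑ m ∈ Icc 1 K,
      if Q < d * m ∧ d * m ≤ K then (g m : ℂ) * eC (α * ((d * m : ℕ) : ℝ) ^ c) else 0 := by
  have h1 : expSum c α Q K ⇑(f * g) = ∑ n ∈ Icc 1 K, ∑ p ∈ n.divisorsAntidiagonal,
      if Q < p.1 * p.2 then (f p.1 : ℂ) * (g p.2 : ℂ) * eC (α * ((p.1 * p.2 : ℕ) : ℝ) ^ c) else 0 := by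
    refine sum_congr rfl fun n _ => ?_
    have h2 : ∀ p ∈ n.divisorsAntidiagonal,
        (if Q < p.1 * p.2 then (f p.1 : ℂ) * (g p.2 : ℂ) * eC (α * ((p.1 * p.2 : ℕ) : ℝ) ^ c) else 0) =
        if Q < n then (f p.1 : ℂ) * (g p.2 : ℂ) * eC (α * (n : ℝ) ^ c) else 0 := by
      intro p hp
      rw [(Nat.mem_divisorsAntidiagonal.mp hp).1]
    rw [sum_congr rfl h2]
    split_ifs
    · rw [ArithmeticFunction.mul_apply, ← sum_mul]
      push_cast; rfl
    · simp
  rw [h1, sum_divisorsAntidiagonal_eq K fun d m =>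
    if Q < d * m then (f d : ℂ) * (g m : ℂ) * eC (α * ((d * m : ℕ) : ℝ) ^ c) else 0]
  refine sum_congr rfl fun d _ => ?_
  rw [mul_sum]
  refine sum_congr rfl fun m _ => ?_
  by_cases h2 : d * m ≤ K <;> by_cases h3 : Q < d * m <;> simp [h2, h3, mul_assoc]

lemma expSum_add (c α : ℝ) (Q K : ℕ) (f g : ArithmeticFunction ℝ) :
    expSum c α Q K ⇑(f + g) = expSum c α Q K f + expSum c α Q K g := by
  rw [expSum, expSum, expSum, ← sum_add_distrib]
  refine sum_congr rfl fun n _ => ?_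
  split_ifs
  · rw [ArithmeticFunction.add_apply]; push_cast; ring
  · simp

lemma expSum_sub (c α : ℝ) (Q K : ℕ) (f g : ArithmeticFunction ℝ) :
    expSum c α Q K ⇑(f - g) = expSum c α Q K f - expSum c α Q K g := by
  have h := expSum_add c α Q K (f - g) g
  rw [sub_add_cancel] at h
  rw [h]; ring

lemma expSum_truncArith_eq_zero (c α : ℝ) {Q K v : ℕ} (hv : v ≤ Q) (f : ArithmeticFunction ℝ) :
    expSum c α Q K (truncArith f v) = 0 := by
  refine sum_eq_zero fun n _ => ?_
  split_ifs with h
  · rw [truncArith_apply, if_neg (by omega)]; simp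
  · rfl

lemma abs_truncArith_mul_le (v d : ℕ) :
    |(truncArith moebiusReal v * truncArith ArithmeticFunction.vonMangoldt v) d| ≤ Real.log d := by
  rw [ArithmeticFunction.mul_apply]
  refine (abs_sum_le_sum_abs _ _).trans ?_
  rw [← ArithmeticFunction.vonMangoldt_sum,
    ← Nat.sum_divisorsAntidiagonal' (f := fun _ j => ArithmeticFunction.vonMangoldt j)]
  refine sum_le_sum fun p _ => ?_
  have h0 : 0 ≤ ArithmeticFunction.vonMangoldt p.2 := ArithmeticFunction.vonMangoldt_nonneg
  rw [abs_mul]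
  have h1 : |truncArith moebiusReal v p.1| ≤ 1 := by
    rw [truncArith_apply]; split_ifs
    · exact abs_moebiusReal_le _
    · simp
  have h2 : |truncArith ArithmeticFunction.vonMangoldt v p.2| ≤ ArithmeticFunction.vonMangoldt p.2 := by
    rw [truncArith_apply]; split_ifs
    · rw [abs_of_nonneg h0]
    · simp [h0]
  calc _ ≤ 1 * ArithmeticFunction.vonMangoldt p.2 := by gcongr
    _ = _ := one_mul _

lemma truncArith_mul_eq_zero (f g : ArithmeticFunction ℝ) {v d : ℕ} (hd : v ^ 2 < d) :
    (truncArith f v * truncArith g v) d = 0 := by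
  rw [ArithmeticFunction.mul_apply]
  refine sum_eq_zero fun p hp => ?_
  have h := (Nat.mem_divisorsAntidiagonal.mp hp).1
  rw [truncArith_apply, truncArith_apply]
  by_cases h1 : p.1 ≤ v
  · by_cases h2 : p.2 ≤ v
    · have := Nat.mul_le_mul h1 h2
      rw [← sq] at this; omega
    · simp [h2]
  · simp [h1]

lemma abs_sub_truncArith_moebius_le (v n : ℕ) : |(moebiusReal - truncArith moebiusReal v) n| ≤ 1 := by
  have : (moebiusReal - truncArith moebiusReal v) n = moebiusReal n - truncArith moebiusReal v n := rfl
  rw [this, truncArith_apply]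
  split_ifs
  · simp
  · simpa using abs_moebiusReal_le n

lemma abs_moebius_tail_mul_zeta_le (v m : ℕ) :
    |((moebiusReal - truncArith moebiusReal v) * ((ArithmeticFunction.zeta : ArithmeticFunction ℝ))) m| ≤
      m.divisors.card := by
  rw [ArithmeticFunction.coe_mul_zeta_apply]
  refine (abs_sum_le_sum_abs _ _).trans ?_
  refine (sum_le_sum fun i _ => abs_sub_truncArith_moebius_le v i).trans ?_
  simp

lemma moebius_tail_mul_zeta_eq_zero {v m : ℕ} (hm : m ≤ v) :
    ((moebiusReal - truncArith moebiusReal v) * ((ArithmeticFunction.zeta : ArithmeticFunction ℝ))) m = 0 := by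
  rw [ArithmeticFunction.coe_mul_zeta_apply]
  refine sum_eq_zero fun i hi => ?_
  have : (moebiusReal - truncArith moebiusReal v) i = moebiusReal i - truncArith moebiusReal v i := rfl
  rw [this, truncArith_apply, if_pos ((Nat.divisor_le hi).trans hm), sub_self]

lemma vonMangoldt_tail_apply (v n : ℕ) :
    (ArithmeticFunction.vonMangoldt - truncArith ArithmeticFunction.vonMangoldt v) n =
      if n ≤ v then 0 else ArithmeticFunction.vonMangoldt n := by
  have : (ArithmeticFunction.vonMangoldt - truncArith ArithmeticFunction.vonMangoldt v) n =
    ArithmeticFunction.vonMangoldt n - truncArith ArithmeticFunction.vonMangoldt v n := rfl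
  rw [this, truncArith_apply]
  split_ifs <;> simp

lemma sum_Ico_two_pow {R : Type*} [AddCommMonoid R] (F : ℕ → R) (J : ℕ) :
    ∑ d ∈ Ico 1 (2 ^ J), F d = ∑ j ∈ range J, ∑ d ∈ Ico (2 ^ j) (2 ^ (j + 1)), F d := by
  induction J with
  | zero => simp
  | succ J ih =>
    rw [sum_range_succ, ← ih, sum_Ico_consecutive _ Nat.one_le_two_pow
      (Nat.pow_le_pow_right (by norm_num) (Nat.le_succ J))]

lemma natLog_two_add_one_le {K : ℕ} (hK : 0 < K) : ((Nat.log 2 K + 1 : ℕ) : ℝ) ≤ 2 * (1 + Real.log K) := by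
  have h1 : (2 : ℝ) ^ Nat.log 2 K ≤ K := by exact_mod_cast Nat.pow_log_le_self 2 hK.ne'
  have h2 := Real.log_le_log (by positivity) h1
  rw [Real.log_pow] at h2
  have h3 := Real.log_two_gt_d9
  have h4 : (0 : ℝ) ≤ Nat.log 2 K := Nat.cast_nonneg _
  push_cast
  nlinarith

/-- Type I sums. -/
lemma norm_sum_typeI_le {A L : ℝ} {K D : ℕ} {f : ℕ → ℝ} {w : ℕ → ℂ} (hL : 0 ≤ L) (hA : 0 ≤ A)
    (hf : ∀ d ∈ Icc 1 K, |f d| ≤ L) (hf0 : ∀ d, D < d → f d = 0)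
    (hw : ∀ d ∈ Icc 1 K, d ≤ D → ‖w d‖ ≤ A * (1 / d)) :
    ‖∑ d ∈ Icc 1 K, (f d : ℂ) * w d‖ ≤ L * A * (1 + Real.log K) := by
  refine (norm_sum_le _ _).trans ?_
  have h : ∀ d ∈ Icc 1 K, ‖(f d : ℂ) * w d‖ ≤ L * A * (1 / (d : ℝ)) := by
    intro d hd
    by_cases h1 : d ≤ D
    · rw [norm_mul, Complex.norm_real, Real.norm_eq_abs, mul_assoc]
      exact mul_le_mul (hf d hd) (hw d hd h1) (norm_nonneg _) hL
    · rw [hf0 d (by omega)]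
      simp; positivity
  refine (sum_le_sum h).trans ?_
  rw [← mul_sum]
  exact mul_le_mul_of_nonneg_left (sum_inv_le_log K) (by positivity)

lemma norm_sq_sum_typeII_le {c α : ℝ} (hc : 1 < c) (hα : 0 < α) {Q K M H v : ℕ} (hQ : 0 < Q)
    (hH : 0 < H) (hv : 0 < v) (hvM : v < 2 * M) (hMK : M * v < K)
    (hK : α * c ^ 2 * H * (2 * K : ℝ) ^ (c - 1) ≤ 1 / 2) {a b : ℕ → ℝ}
    (ha : ∀ m, |a m| ≤ m.divisors.card) (hb : ∀ n ≤ K, |b n| ≤ 1 + Real.log K) :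
    ‖∑ m ∈ Ico M (2 * M), (a m : ℂ) * ∑ n ∈ Icc 1 K,
      if Q < m * n ∧ m * n ≤ K then (b n : ℂ) * eC (α * ((m * n : ℕ) : ℝ) ^ c) else 0‖ ^ 2 ≤
      32 * (1 + Real.log K) ^ 6 * (K * (K / H + K / v +
        2 * (1 / (α * c * (Q : ℝ) ^ (c - 1))) * K / (v * H) + 1 / (α * c * (Q : ℝ) ^ (c - 1)))) := by
  set ℓ := 1 + Real.log K with hℓ
  set Z := 1 / (α * c * (Q : ℝ) ^ (c - 1)) with hZ
  set Y := 1 / (α * c ^ 2 * (Q : ℝ) ^ (c - 1)) with hY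
  have hQ' : (0 : ℝ) < Q := by exact_mod_cast hQ
  have hH' : (0 : ℝ) < H := by exact_mod_cast hH
  have hv' : (0 : ℝ) < v := by exact_mod_cast hv
  have hM0 : 0 < M := by omega
  have hM' : (0 : ℝ) < M := by exact_mod_cast hM0
  have hK0 : 0 < K := by omega
  have hK' : (0 : ℝ) < K := by exact_mod_cast hK0
  have hℓ1 : 1 ≤ ℓ := by linarith [Real.log_natCast_nonneg K]
  have hYZ : Y ≤ Z := by
    refine one_div_le_one_div_of_le (by positivity) ?_
    have : c ≤ c ^ 2 := by nlinarith
    gcongr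
  have hY0 : 0 ≤ Y := by positivity
  have hMK' : M ≤ K := (Nat.le_mul_of_pos_right M hv).trans hMK.le
  set b' : ℕ → ℂ := fun n => if n ≤ K then (b n : ℂ) else 0
  have hb' : ∀ n, ‖b' n‖ ≤ ℓ := by
    intro n
    simp only [b']
    split_ifs with h
    · rw [Complex.norm_real]; exact hb n h
    · simp; linarith
  have key := norm_sq_bilinear_le hc hα (M := M) (M' := 2 * M) (N := K / M) hQ hH hK
    (a := fun m => (a m : ℂ)) hb'
  have e : ∀ m ∈ Ico M (2 * M), (a m : ℂ) * (∑ n ∈ Icc 1 K,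
      if Q < m * n ∧ m * n ≤ K then (b n : ℂ) * eC (α * ((m * n : ℕ) : ℝ) ^ c) else 0) =
      (a m : ℂ) * ∑ n ∈ Icc 1 (K / M),
      if Q < m * n ∧ m * n ≤ K then b' n * eC (α * ((m * n : ℕ) : ℝ) ^ c) else 0 := by
    intro m hm
    have hm1 := (mem_Ico.mp hm).1
    congr 1
    symm
    have h1 : ∀ n ∈ Icc 1 (K / M),
        (if Q < m * n ∧ m * n ≤ K then b' n * eC (α * ((m * n : ℕ) : ℝ) ^ c) else 0) =
        if Q < m * n ∧ m * n ≤ K then (b n : ℂ) * eC (α * ((m * n : ℕ) : ℝ) ^ c) else 0 := by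
      intro n hn
      simp only [b']
      rw [if_pos ((mem_Icc.mp hn).2.trans (Nat.div_le_self _ _))]
    rw [sum_congr rfl h1]
    refine sum_subset (Icc_subset_Icc_right (Nat.div_le_self _ _)) fun n hn hn' => ?_
    rw [if_neg]
    rintro ⟨_, h2⟩
    refine hn' (mem_Icc.mpr ⟨(mem_Icc.mp hn).1, ?_⟩)
    rw [Nat.le_div_iff_mul_le hM0, mul_comm]
    exact (Nat.mul_le_mul_right n hm1).trans h2
  rw [sum_congr rfl e]
  refine key.trans ?_
  have hMsub : ((2 * M - M : ℕ) : ℝ) = M := by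
    rw [two_mul, Nat.add_sub_cancel]
  rw [hMsub]
  have hA : ∑ m ∈ Ico M (2 * M), ‖(a m : ℂ)‖ ^ 2 ≤ 16 * M * ℓ ^ 3 := by
    have h1 : ∑ m ∈ Ico M (2 * M), ‖(a m : ℂ)‖ ^ 2 ≤ ∑ m ∈ Icc 1 (2 * M), (m.divisors.card : ℝ) ^ 2 := by
      have hs : Ico M (2 * M) ⊆ Icc 1 (2 * M) := by
        intro m hm
        rw [mem_Ico] at hm; rw [mem_Icc]; omega
      refine (sum_le_sum fun m _ => ?_).trans
        (sum_le_sum_of_subset_of_nonneg hs fun m _ _ => by positivity)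
      rw [Complex.norm_real, Real.norm_eq_abs]
      exact pow_le_pow_left₀ (abs_nonneg _) (ha m) 2
    refine (h1.trans (sum_card_divisors_sq_le _)).trans ?_
    have h2 : 1 + Real.log ((2 * M : ℕ) : ℝ) ≤ 2 * ℓ := by
      push_cast
      rw [Real.log_mul (by norm_num) hM'.ne']
      have := Real.log_le_log hM' (Nat.cast_le.mpr hMK' : (M : ℝ) ≤ K)
      have := Real.log_two_lt_d9
      linarith [Real.log_natCast_nonneg K]
    have h3 : 0 ≤ 1 + Real.log ((2 * M : ℕ) : ℝ) := by
      linarith [Real.log_natCast_nonneg (2 * M)]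
    calc ((2 * M : ℕ) : ℝ) * (1 + Real.log ((2 * M : ℕ) : ℝ)) ^ 3 ≤ ((2 * M : ℕ) : ℝ) * (2 * ℓ) ^ 3 := by
          gcongr
      _ = _ := by push_cast; ring
  have hN : ((K / M : ℕ) : ℝ) ≤ K / M := Nat.cast_div_le
  have hNH : ((K / M / H + 1 : ℕ) : ℝ) ≤ K / (M * H) + 1 := by
    push_cast
    gcongr
    refine Nat.cast_div_le.trans ?_
    rw [← div_div]
    gcongr
  have hlogN : 1 + Real.log ((K / M : ℕ) : ℝ) ≤ ℓ := by
    rcases Nat.eq_zero_or_pos (K / M) with h | h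
    · rw [h]; simp; exact hℓ1
    · have := Real.log_le_log (Nat.cast_pos.mpr h : (0 : ℝ) < (K / M : ℕ))
        (Nat.cast_le.mpr (Nat.div_le_self K M))
      linarith
  have hlogN0 : 0 ≤ 1 + Real.log ((K / M : ℕ) : ℝ) := by
    linarith [Real.log_natCast_nonneg (K / M)]
  have hMv1 : (M : ℝ) ≤ K / v := by
    rw [le_div_iff₀ hv']; exact_mod_cast hMK.le
  have hMv2 : 1 / (M : ℝ) ≤ 2 / v := by
    rw [div_le_div_iff₀ hM' hv', one_mul]; exact_mod_cast hvM.le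
  calc _ ≤ (16 * M * ℓ ^ 3) * ((K / (M * H) + 1) * (ℓ ^ 2 * (K / M * (M + Z * (2 * ℓ))))) := by
        gcongr
    _ ≤ (16 * M * ℓ ^ 3) * ((K / (M * H) + 1) * (ℓ ^ 2 * (K / M * (2 * ℓ * (M + Z))))) := by
        have : 0 ≤ Z := hY0.trans hYZ
        gcongr
        nlinarith
    _ = 32 * ℓ ^ 6 * (K * (K / H + M + Z * K / H * (1 / M) + Z)) := by
        field_simp; ring
    _ ≤ 32 * ℓ ^ 6 * (K * (K / H + K / v + Z * K / H * (2 / v) + Z)) := by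
        have : 0 ≤ Z := hY0.trans hYZ
        gcongr
    _ = _ := by
        field_simp

lemma norm_expSum_typeII_le {c α : ℝ} (hc : 1 < c) (hα : 0 < α) {Q K H v : ℕ} (hQ : 0 < Q)
    (hH : 0 < H) (hv : 0 < v) (hK0 : 0 < K)
    (hK : α * c ^ 2 * H * (2 * K : ℝ) ^ (c - 1) ≤ 1 / 2) {a b : ArithmeticFunction ℝ}
    (ha : ∀ m, |a m| ≤ m.divisors.card) (ha0 : ∀ m ≤ v, a m = 0)
    (hb : ∀ n ≤ K, |b n| ≤ 1 + Real.log K) (hb0 : ∀ n ≤ v, b n = 0) :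
    ‖expSum c α Q K ⇑(a * b)‖ ≤
      12 * (1 + Real.log K) ^ 4 * √(K * (K / H + K / v +
        2 * (1 / (α * c * (Q : ℝ) ^ (c - 1))) * K / (v * H) + 1 / (α * c * (Q : ℝ) ^ (c - 1)))) := by
  rw [expSum_mul]
  set F : ℕ → ℂ := fun m => (a m : ℂ) * ∑ n ∈ Icc 1 K,
      if Q < m * n ∧ m * n ≤ K then (b n : ℂ) * eC (α * ((m * n : ℕ) : ℝ) ^ c) else 0 with hF
  set R := K * (K / H + K / v +
        2 * (1 / (α * c * (Q : ℝ) ^ (c - 1))) * K / (v * H) + 1 / (α * c * (Q : ℝ) ^ (c - 1))) with hR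
  have hℓ1 : 1 ≤ 1 + Real.log K := by linarith [Real.log_natCast_nonneg K]
  have hR0 : 0 ≤ R := by positivity
  have hdyad : ∀ M : ℕ, ‖∑ m ∈ Ico M (2 * M), F m‖ ≤ 6 * (1 + Real.log K) ^ 3 * √R := by
    intro M
    by_cases h1 : v < 2 * M
    · by_cases h2 : M * v < K
      · have h := norm_sq_sum_typeII_le hc hα hQ hH hv h1 h2 hK ha hb
        refine le_of_sq_le_sq ?_ (by positivity)
        refine h.trans ?_
        rw [mul_pow, mul_pow, Real.sq_sqrt hR0, ← pow_mul]
        have : 0 ≤ (1 + Real.log K) ^ 6 * R := by positivity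
        rw [← hR, show 3 * 2 = 6 from rfl]
        linarith
      · rw [sum_eq_zero]
        · simp; positivity
        intro m hm
        have hm1 := (mem_Ico.mp hm).1
        simp only [hF]
        rw [sum_eq_zero, mul_zero]
        intro n hn
        split_ifs with h3
        · rcases le_or_gt n v with h4 | h4
          · rw [hb0 n h4]; simp
          · exfalso
            have h5 : m * v < m * n := Nat.mul_lt_mul_of_pos_left h4 (by
              rcases Nat.eq_zero_or_pos m with h | h
              · simp [h] at h3
              · exact h)
            have h6 := Nat.mul_le_mul_right v hm1
            omega
        · rfl
    · rw [sum_eq_zero]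
      · simp; positivity
      intro m hm
      have hm1 := (mem_Ico.mp hm).2
      simp only [hF]
      rw [ha0 m (by omega)]; simp
  have hext : ∑ d ∈ Icc 1 K, F d = ∑ d ∈ Ico 1 (2 ^ (Nat.log 2 K + 1)), F d := by
    refine sum_subset (fun d hd => ?_) fun d hd hd' => ?_
    · rw [mem_Icc] at hd
      exact mem_Ico.mpr ⟨hd.1, hd.2.trans_lt (Nat.lt_pow_succ_log_self (by norm_num) K)⟩
    · rw [mem_Ico] at hd
      rw [mem_Icc] at hd'
      have hKd : K < d := by omega
      simp only [hF]
      rw [sum_eq_zero, mul_zero]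
      intro n hn
      rw [if_neg]
      rintro ⟨_, h⟩
      have := Nat.le_mul_of_pos_right d (mem_Icc.mp hn).1
      omega
  rw [hext, sum_Ico_two_pow]
  refine (norm_sum_le _ _).trans ?_
  have h1 : ∀ j ∈ range (Nat.log 2 K + 1), ‖∑ d ∈ Ico (2 ^ j) (2 ^ (j + 1)), F d‖ ≤
      6 * (1 + Real.log K) ^ 3 * √R := by
    intro j _
    rw [pow_succ, mul_comm]
    exact hdyad _
  refine (sum_le_sum h1).trans ?_
  rw [sum_const, card_range, nsmul_eq_mul]
  calc _ ≤ (2 * (1 + Real.log K)) * (6 * (1 + Real.log K) ^ 3 * √R) := by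
        gcongr
        exact natLog_two_add_one_le hK0
    _ = _ := by ring

lemma norm_expSum_vonMangoldt_le {c α : ℝ} (hc : 1 < c) (hα : 0 < α) {Q K H v : ℕ} (hQ : 0 < Q)
    (hH : 0 < H) (hv : 0 < v) (hvQ : v ≤ Q) (hvK : v ^ 2 ≤ K)
    (hK : α * c ^ 2 * H * (2 * K : ℝ) ^ (c - 1) ≤ 1 / 2)
    (hKv : α * c * (v : ℝ) ^ 2 * (2 * K : ℝ) ^ (c - 1) ≤ 1 / 2) :
    ‖expSum c α Q K ArithmeticFunction.vonMangoldt‖ ≤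
      3 * (1 + Real.log K) ^ 2 * (1 / (α * c * (Q : ℝ) ^ (c - 1))) +
      12 * (1 + Real.log K) ^ 4 * √(K * (K / H + K / v +
        2 * (1 / (α * c * (Q : ℝ) ^ (c - 1))) * K / (v * H) + 1 / (α * c * (Q : ℝ) ^ (c - 1)))) := by
  have hK0 : 0 < K := (pow_pos hv 2).trans_le hvK
  have hQ' : (0 : ℝ) < Q := by exact_mod_cast hQ
  have hℓ0 : 0 ≤ Real.log K := Real.log_natCast_nonneg K
  have hlog : ∀ d ∈ Icc 1 K, Real.log d ≤ Real.log K := fun d hd =>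
    Real.log_le_log (Nat.cast_pos.mpr (mem_Icc.mp hd).1) (Nat.cast_le.mpr (mem_Icc.mp hd).2)
  set Z := 1 / (α * c * (Q : ℝ) ^ (c - 1)) with hZ
  have hZ0 : 0 ≤ Z := by positivity
  have hphase : ∀ d, d ≤ v ^ 2 → α * c * d * (2 * K : ℝ) ^ (c - 1) ≤ 1 / 2 := by
    intro d hd
    refine le_trans ?_ hKv
    have : (d : ℝ) ≤ (v : ℝ) ^ 2 := by exact_mod_cast hd
    gcongr
  have hvv : v ≤ v ^ 2 := Nat.le_self_pow (by norm_num) v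
  have h1 : ‖expSum c α Q K ⇑(truncArith moebiusReal v * ArithmeticFunction.log)‖ ≤
      2 * (1 + Real.log K) ^ 2 * Z := by
    rw [expSum_mul]
    refine (norm_sum_typeI_le (A := 2 * Real.log K * Z) (L := 1) (D := v) zero_le_one (by positivity)
      (fun d _ => ?_) (fun d hd => ?_) fun d hd hdv => ?_).trans ?_
    · rw [truncArith_apply]; split_ifs
      · exact abs_moebiusReal_le _
      · simp
    · rw [truncArith_apply, if_neg (by omega)]
    · rw [mem_Icc] at hd
      have := norm_sum_log_smooth_le hc hα hQ hd.1 hd.2 (hphase d (hdv.trans hvv))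
      simp only [ArithmeticFunction.log_apply]
      rw [← mul_assoc] at this
      exact this
    · have : 0 ≤ Z * (1 + Real.log K) := by positivity
      nlinarith
  have h2 : ‖expSum c α Q K ⇑((truncArith moebiusReal v * truncArith ArithmeticFunction.vonMangoldt v) *
      ((ArithmeticFunction.zeta : ArithmeticFunction ℝ)))‖ ≤ (1 + Real.log K) ^ 2 * Z := by
    rw [expSum_mul]
    refine (norm_sum_typeI_le (A := Z) (L := Real.log K) (D := v ^ 2) hℓ0 hZ0
      (fun d hd => (abs_truncArith_mul_le v d).trans (hlog d hd))
      (fun d hd => truncArith_mul_eq_zero _ _ hd) fun d hd hdv => ?_).trans ?_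
    · rw [mem_Icc] at hd
      refine le_trans (le_of_eq ?_) (norm_sum_smooth_le hc hα hQ hd.1 hd.2 (hphase d hdv))
      congr 1
      refine sum_congr rfl fun m hm => ?_
      have hm0 : m ≠ 0 := by have := (mem_Icc.mp hm).1; omega
      rw [ArithmeticFunction.natCoe_apply, ArithmeticFunction.zeta_apply_ne hm0]
      simp
    · have : 0 ≤ Z * (1 + Real.log K) := by positivity
      nlinarith
  have h3 := norm_expSum_typeII_le hc hα hQ hH hv hK0 hK
    (a := (moebiusReal - truncArith moebiusReal v) * ((ArithmeticFunction.zeta : ArithmeticFunction ℝ)))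
    (b := ArithmeticFunction.vonMangoldt - truncArith ArithmeticFunction.vonMangoldt v)
    (abs_moebius_tail_mul_zeta_le v) (fun m hm => moebius_tail_mul_zeta_eq_zero hm)
    (fun n hn => by
      rw [vonMangoldt_tail_apply]
      split_ifs with h
      · simp; linarith
      · rw [abs_of_nonneg ArithmeticFunction.vonMangoldt_nonneg]
        have := hlog n (mem_Icc.mpr ⟨by omega, hn⟩)
        linarith [ArithmeticFunction.vonMangoldt_le_log (n := n)])
    (fun n hn => by rw [vonMangoldt_tail_apply, if_pos hn])
  rw [vaughan_identity v, expSum_add, expSum_sub, expSum_add, expSum_truncArith_eq_zero c α hvQ, zero_add]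
  refine (norm_add_le _ _).trans ?_
  have := norm_sub_le (expSum c α Q K ⇑(truncArith moebiusReal v * ArithmeticFunction.log))
    (expSum c α Q K ⇑((truncArith moebiusReal v * truncArith ArithmeticFunction.vonMangoldt v) *
      ((ArithmeticFunction.zeta : ArithmeticFunction ℝ))))
  linarith

lemma norm_sum_Icc_le_expSum {c α : ℝ} {Q K : ℕ} :
    ‖∑ n ∈ Icc 1 K, (ArithmeticFunction.vonMangoldt n : ℂ) * eC (α * (n : ℝ) ^ c)‖ ≤
      Q * (1 + Real.log K) + ‖expSum c α Q K ArithmeticFunction.vonMangoldt‖ := by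
  have e : ∑ n ∈ Icc 1 K, (ArithmeticFunction.vonMangoldt n : ℂ) * eC (α * (n : ℝ) ^ c) =
      ∑ n ∈ Icc 1 K, (if n ≤ Q then (ArithmeticFunction.vonMangoldt n : ℂ) * eC (α * (n : ℝ) ^ c) else 0) +
      expSum c α Q K ArithmeticFunction.vonMangoldt := by
    rw [expSum, ← sum_add_distrib]
    refine sum_congr rfl fun n _ => ?_
    by_cases h : n ≤ Q
    · simp [h, not_lt.mpr h]
    · simp [h, not_le.mp h]
  rw [e]
  refine (norm_add_le _ _).trans (add_le_add_left ?_ _)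
  rw [← sum_filter]
  refine (norm_sum_le _ _).trans ?_
  have h1 : ∀ n ∈ (Icc 1 K).filter (· ≤ Q),
      ‖(ArithmeticFunction.vonMangoldt n : ℂ) * eC (α * (n : ℝ) ^ c)‖ ≤ 1 + Real.log K := by
    intro n hn
    rw [mem_filter, mem_Icc] at hn
    rw [norm_mul, norm_eC, mul_one, Complex.norm_real, Real.norm_eq_abs,
      abs_of_nonneg ArithmeticFunction.vonMangoldt_nonneg]
    have := Real.log_le_log (Nat.cast_pos.mpr hn.1.1 : (0 : ℝ) < n) (Nat.cast_le.mpr hn.1.2)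
    linarith [ArithmeticFunction.vonMangoldt_le_log (n := n)]
  refine (sum_le_card_nsmul _ _ _ h1).trans ?_
  rw [nsmul_eq_mul]
  have h2 : ((Icc 1 K).filter (· ≤ Q)).card ≤ Q := by
    have : (Icc 1 K).filter (· ≤ Q) ⊆ Icc 1 Q := by
      intro n hn
      rw [mem_filter, mem_Icc] at hn
      exact mem_Icc.mpr ⟨hn.1.1, hn.2⟩
    simpa using card_le_card this
  have : 0 ≤ 1 + Real.log K := by linarith [Real.log_natCast_nonneg K]
  gcongr

lemma half_le_floor {x : ℝ} (hx : 1 ≤ x) : x / 2 ≤ (⌊x⌋₊ : ℝ) := by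
  have h1 := Nat.lt_floor_add_one x
  have h2 : (1 : ℝ) ≤ (⌊x⌋₊ : ℝ) := by exact_mod_cast (Nat.one_le_floor_iff x).mpr hx
  linarith

set_option maxHeartbeats 1000000 in
lemma norm_sum_vonMangoldt_mul_eC_le {c ε α : ℝ} (hc : 1 < c) (hc3 : c ≤ 3) (hε : 0 < ε) (hε1 : ε ≤ 1)
    {K : ℕ} (hK : 0 < K) (hKε : 72 ≤ (K : ℝ) ^ (3 * ε / 4)) (hα : α ≤ (K : ℝ) ^ (1 - c - ε))
    (hX : 1 ≤ α * (K : ℝ) ^ c) :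
    ‖∑ n ∈ Icc 1 K, (ArithmeticFunction.vonMangoldt n : ℂ) * eC (α * (n : ℝ) ^ c)‖ ≤
      329 * (1 + Real.log K) ^ 4 * (K * (α * (K : ℝ) ^ c) ^ (-(ε / 32))) := by
  have hk : (0 : ℝ) < K := by exact_mod_cast hK
  have hk1 : (1 : ℝ) ≤ K := by exact_mod_cast hK
  set ℓ := 1 + Real.log K with hℓ
  have hℓ1 : 1 ≤ ℓ := by linarith [Real.log_natCast_nonneg K]
  set k : ℝ := (K : ℝ) with hkdef
  set X := α * k ^ c with hXdef
  have hX0 : 0 < X := by linarith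
  have hkc : 0 < k ^ c := by positivity
  have hα0 : 0 < α := pos_of_mul_pos_left hX0 hkc.le
  have hXk : X ≤ k ^ (1 - ε) := by
    calc X ≤ k ^ (1 - c - ε) * k ^ c := by rw [hXdef]; gcongr
      _ = k ^ (1 - ε) := by rw [← Real.rpow_add hk]; congr 1; ring
  have hXk1 : X ≤ k := hXk.trans (by
    calc k ^ (1 - ε) ≤ k ^ (1 : ℝ) := Real.rpow_le_rpow_of_exponent_le hk1 (by linarith)
      _ = k := Real.rpow_one k)
  have hkpow : α * k ^ (c - 1) = X / k := by
    rw [hXdef, Real.rpow_sub_one hk.ne']; ring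
  have hneg : ∀ s : ℝ, 0 ≤ s → k ^ (-s) ≤ X ^ (-s) := fun s hs =>
    Real.rpow_le_rpow_of_nonpos hX0 hXk1 (by linarith)
  have hXmono : ∀ s t : ℝ, s ≤ t → X ^ s ≤ X ^ t := fun s t => Real.rpow_le_rpow_of_exponent_le hX
  -- the three parameters
  set Q := ⌈k * X ^ (-(ε / 32))⌉₊ with hQdef
  set v := ⌊k ^ (ε / 8)⌋₊ with hvdef
  set H := ⌊k / (72 * X)⌋₊ with hHdef
  have hkX : k * k ^ (-(ε / 32)) ≤ k * X ^ (-(ε / 32)) := by exact mul_le_mul_of_nonneg_left (hneg (ε / 32) (by linarith)) hk.le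
  have hkk : k * k ^ (-(ε / 32)) = k ^ (1 - ε / 32) := by
    rw [sub_eq_add_neg, Real.rpow_add hk, Real.rpow_one]
  have hone : 1 ≤ k * X ^ (-(ε / 32)) := by
    refine le_trans ?_ hkX
    rw [hkk]
    exact Real.one_le_rpow hk1 (by linarith)
  have hQge : k * X ^ (-(ε / 32)) ≤ Q := Nat.le_ceil _
  have hQle : (Q : ℝ) ≤ 2 * (k * X ^ (-(ε / 32))) := by
    have := (Nat.ceil_lt_add_one (by positivity : 0 ≤ k * X ^ (-(ε / 32)))).le
    linarith
  have hQ0 : 0 < Q := Nat.ceil_pos.mpr (by linarith)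
  have hQ' : (0 : ℝ) < Q := by exact_mod_cast hQ0
  have hv1 : 1 ≤ k ^ (ε / 8) := Real.one_le_rpow hk1 (by linarith)
  have hvge : k ^ (ε / 8) / 2 ≤ v := half_le_floor hv1
  have hvle : (v : ℝ) ≤ k ^ (ε / 8) := Nat.floor_le (by positivity)
  have hv0 : 0 < v := (Nat.one_le_floor_iff _).mpr hv1
  have hv' : (0 : ℝ) < v := by exact_mod_cast hv0
  have hkε : 72 ≤ k ^ ε := hKε.trans (Real.rpow_le_rpow_of_exponent_le hk1 (by linarith))
  have hH1 : 1 ≤ k / (72 * X) := by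
    rw [le_div_iff₀ (by positivity), one_mul]
    calc 72 * X ≤ k ^ ε * k ^ (1 - ε) := by gcongr
      _ = k := by rw [← Real.rpow_add hk]; simp
  have hHge : k / (72 * X) / 2 ≤ H := half_le_floor hH1
  have hHle : (H : ℝ) ≤ k / (72 * X) := Nat.floor_le (by positivity)
  have hH0 : 0 < H := (Nat.one_le_floor_iff _).mpr hH1
  have hH' : (0 : ℝ) < H := by exact_mod_cast hH0
  have hvQ : v ≤ Q := by
    have : (v : ℝ) ≤ Q := by
      refine hvle.trans (le_trans ?_ (hkX.trans hQge))
      rw [hkk]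
      exact Real.rpow_le_rpow_of_exponent_le hk1 (by linarith)
    exact_mod_cast this
  have hvsq : (v : ℝ) ^ 2 ≤ k ^ (ε / 4) := by
    calc (v : ℝ) ^ 2 ≤ (k ^ (ε / 8)) ^ 2 := by gcongr
      _ = k ^ (ε / 4) := by
        rw [← Real.rpow_natCast, ← Real.rpow_mul hk.le]; congr 1; push_cast; ring
  have hvK : v ^ 2 ≤ K := by
    have : (v : ℝ) ^ 2 ≤ K := hvsq.trans (by
      calc k ^ (ε / 4) ≤ k ^ (1 : ℝ) := Real.rpow_le_rpow_of_exponent_le hk1 (by linarith)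
        _ = k := Real.rpow_one k)
    exact_mod_cast this
  have h2c : (2 : ℝ) ^ (c - 1) ≤ 4 := by
    calc (2 : ℝ) ^ (c - 1) ≤ 2 ^ (2 : ℝ) := Real.rpow_le_rpow_of_exponent_le (by norm_num) (by linarith)
      _ = 4 := by norm_num
  have h2k : α * (2 * k) ^ (c - 1) ≤ 4 * (X / k) := by
    rw [Real.mul_rpow (by norm_num) hk.le]
    calc α * (2 ^ (c - 1) * k ^ (c - 1)) = 2 ^ (c - 1) * (α * k ^ (c - 1)) := by ring
      _ ≤ 4 * (X / k) := by rw [hkpow]; gcongr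
  have hcond1 : α * c ^ 2 * H * (2 * k) ^ (c - 1) ≤ 1 / 2 := by
    have hc9 : c ^ 2 ≤ 9 := by nlinarith
    calc α * c ^ 2 * H * (2 * k) ^ (c - 1) = c ^ 2 * H * (α * (2 * k) ^ (c - 1)) := by ring
      _ ≤ 9 * (k / (72 * X)) * (4 * (X / k)) := by gcongr
      _ = 1 / 2 := by field_simp; norm_num
  have hcond2 : α * c * (v : ℝ) ^ 2 * (2 * k) ^ (c - 1) ≤ 1 / 2 := by
    calc α * c * (v : ℝ) ^ 2 * (2 * k) ^ (c - 1) = c * (v : ℝ) ^ 2 * (α * (2 * k) ^ (c - 1)) := by ring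
      _ ≤ 3 * k ^ (ε / 4) * (4 * (k ^ (1 - ε) / k)) := by
        refine mul_le_mul (by gcongr) (h2k.trans ?_) (by positivity) (by positivity)
        gcongr
      _ = 12 * k ^ (-(3 * ε / 4)) := by
        rw [show -(3 * ε / 4) = ε / 4 + (1 - ε) - 1 by ring, Real.rpow_sub_one hk.ne',
          Real.rpow_add hk]; ring
      _ ≤ 1 / 2 := by
        rw [Real.rpow_neg hk.le]
        have : (k ^ (3 * ε / 4))⁻¹ ≤ 72⁻¹ := inv_anti₀ (by norm_num) hKε
        linarith
  set Z := 1 / (α * c * (Q : ℝ) ^ (c - 1)) with hZdef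
  have hZ0 : 0 ≤ Z := by positivity
  have hZ : Z ≤ k * X ^ (-1 + ε / 16) := by
    have h1 : (k * X ^ (-(ε / 32))) ^ (c - 1) ≤ (Q : ℝ) ^ (c - 1) :=
      Real.rpow_le_rpow (by positivity) hQge (by linarith)
    have h2 : α * (k * X ^ (-(ε / 32))) ^ (c - 1) = X / k * X ^ (-(ε / 32) * (c - 1)) := by
      rw [Real.mul_rpow hk.le (by positivity), ← Real.rpow_mul hX0.le, ← mul_assoc, hkpow]
    have h3 : X ^ (-(ε / 16)) ≤ X ^ (-(ε / 32) * (c - 1)) := hXmono _ _ (by nlinarith)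
    have h4 : X / k * X ^ (-(ε / 16)) ≤ α * c * (Q : ℝ) ^ (c - 1) := by
      calc X / k * X ^ (-(ε / 16)) ≤ α * (k * X ^ (-(ε / 32))) ^ (c - 1) := by rw [h2]; gcongr
        _ ≤ α * (Q : ℝ) ^ (c - 1) := by gcongr
        _ ≤ α * c * (Q : ℝ) ^ (c - 1) := by
          have : 0 ≤ α * (Q : ℝ) ^ (c - 1) := by positivity
          nlinarith
    calc Z ≤ 1 / (X / k * X ^ (-(ε / 16))) := one_div_le_one_div_of_le (by positivity) h4
      _ = k * X ^ (-1 + ε / 16) := by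
        rw [Real.rpow_add hX0, Real.rpow_neg_one, Real.rpow_neg hX0.le]; field_simp
  have hkH : k / H ≤ 144 * X := by
    rw [div_le_iff₀ hH']
    calc k = 144 * X * (k / (72 * X) / 2) := by field_simp; norm_num
      _ ≤ _ := by gcongr
  have hkv : 1 / (v : ℝ) ≤ 2 * X ^ (-(ε / 8)) := by
    calc 1 / (v : ℝ) ≤ 1 / (k ^ (ε / 8) / 2) := one_div_le_one_div_of_le (by positivity) hvge
      _ = 2 * k ^ (-(ε / 8)) := by rw [Real.rpow_neg hk.le]; field_simp
      _ ≤ _ := by exact mul_le_mul_of_nonneg_left (hneg (ε / 8) (by linarith)) zero_le_two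
  set U := X ^ (-(ε / 16)) with hUdef
  have hU0 : 0 < U := by positivity
  have hXU : X ≤ k * U := by
    calc X ≤ k ^ (1 - ε) := hXk
      _ ≤ k ^ (1 + -(ε / 16)) := Real.rpow_le_rpow_of_exponent_le hk1 (by linarith)
      _ = k * k ^ (-(ε / 16)) := by rw [Real.rpow_add hk, Real.rpow_one]
      _ ≤ k * U := by exact mul_le_mul_of_nonneg_left (hneg (ε / 16) (by linarith)) hk.le
  have hsum : k * (k / H + k / v + 2 * Z * k / (v * H) + Z) ≤ (27 * (k * X ^ (-(ε / 32)))) ^ 2 := by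
    have hU2 : (X ^ (-(ε / 32))) ^ 2 = U := by
      rw [hUdef, ← Real.rpow_natCast, ← Real.rpow_mul hX0.le]; congr 1; push_cast; ring
    have t2 : k / v ≤ 2 * (k * U) := by
      calc k / v = k * (1 / v) := by ring
        _ ≤ k * (2 * X ^ (-(ε / 8))) := by gcongr
        _ ≤ k * (2 * U) := by
          have : X ^ (-(ε / 8)) ≤ U := hXmono _ _ (by linarith)
          gcongr
        _ = _ := by ring
    have t4 : Z ≤ k * U := hZ.trans (mul_le_mul_of_nonneg_left (hXmono _ _ (by linarith)) hk.le)
    have t3 : 2 * Z * k / (v * H) ≤ 576 * (k * U) := by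
      calc 2 * Z * k / (v * H) = 2 * Z * (k / H) * (1 / v) := by field_simp
        _ ≤ 2 * (k * X ^ (-1 + ε / 16)) * (144 * X) * (2 * X ^ (-(ε / 8))) := by gcongr
        _ = 576 * (k * (X ^ (-1 + ε / 16) * X * X ^ (-(ε / 8)))) := by ring
        _ = 576 * (k * U) := by
          rw [← Real.rpow_add_one hX0.ne', ← Real.rpow_add hX0, hUdef]
          congr 3; ring
    calc k * (k / H + k / v + 2 * Z * k / (v * H) + Z) ≤
          k * (144 * (k * U) + 2 * (k * U) + 576 * (k * U) + k * U) := by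
          gcongr
          exact hkH.trans (by linarith)
      _ = 723 * (k ^ 2 * U) := by ring
      _ ≤ 729 * (k ^ 2 * U) := by gcongr; norm_num
      _ = _ := by rw [← hU2]; ring
  have key := norm_expSum_vonMangoldt_le hc hα0 hQ0 hH0 hv0 hvQ hvK hcond1 hcond2
  have hsq : √(k * (k / H + k / v + 2 * Z * k / (v * H) + Z)) ≤ 27 * (k * X ^ (-(ε / 32))) :=
    (Real.sqrt_le_sqrt hsum).trans_eq (Real.sqrt_sq (by positivity))
  have hZ' : Z ≤ k * X ^ (-(ε / 32)) := hZ.trans (mul_le_mul_of_nonneg_left (hXmono _ _ (by linarith)) hk.le)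
  refine (norm_sum_Icc_le_expSum (Q := Q)).trans ?_
  set E := k * X ^ (-(ε / 32)) with hE
  have hE0 : 0 < E := by positivity
  have hp1 : ℓ ≤ ℓ ^ 4 := le_self_pow₀ hℓ1 (by norm_num)
  have hp2 : ℓ ^ 2 ≤ ℓ ^ 4 := pow_le_pow_right₀ hℓ1 (by norm_num)
  calc (Q : ℝ) * ℓ + ‖expSum c α Q K ArithmeticFunction.vonMangoldt‖ ≤
        2 * E * ℓ ^ 4 + (3 * ℓ ^ 4 * E + 12 * ℓ ^ 4 * (27 * E)) := by
        refine add_le_add (by gcongr) (key.trans ?_)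
        refine add_le_add (by gcongr) (by gcongr)
    _ = _ := by ring

lemma norm_eC_sub_eC_le (x y : ℝ) : ‖eC x - eC y‖ ≤ 2 * π * |x - y| := by
  have h : eC x - eC y = (eC (x - y) - 1) * eC y := by
    rw [sub_mul, ← eC_add, sub_add_cancel, one_mul]
  rw [h, norm_mul, norm_eC, mul_one, eC, mul_comm]
  refine (Real.norm_exp_I_mul_ofReal_sub_one_le (x := 2 * π * (x - y))).trans_eq ?_
  rw [Real.norm_eq_abs, abs_mul, abs_of_pos Real.two_pi_pos]

lemma norm_sum_mul_eC_le {a : ℕ → ℝ} {N : ℕ} {α B : ℝ}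
    (hB : ∀ m ≤ N, |∑ j ∈ Icc 1 m, a j| ≤ B) :
    ‖∑ m ∈ Icc 1 N, (a m : ℂ) * eC (m * α)‖ ≤ B * (1 + N * (2 * π * |α|)) := by
  have e : ∀ n, ∑ m ∈ Icc 1 n, (a m : ℂ) * eC (m * α) =
      ((∑ j ∈ Icc 1 n, a j : ℝ) : ℂ) * eC (n * α) +
      ∑ m ∈ range n, ((∑ j ∈ Icc 1 m, a j : ℝ) : ℂ) * (eC (m * α) - eC ((m + 1 : ℕ) * α)) := by
    intro n
    induction n with
    | zero => simp
    | succ n ih =>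
      rw [sum_Icc_succ_top (by omega), ih, sum_range_succ, sum_Icc_succ_top (by omega)]
      push_cast
      ring
  have hB0 : 0 ≤ B := (abs_nonneg _).trans (hB 0 (Nat.zero_le _))
  rw [e N]
  refine (norm_add_le _ _).trans ?_
  rw [mul_add, mul_one]
  refine add_le_add ?_ ?_
  · rw [norm_mul, norm_eC, mul_one, Complex.norm_real]
    exact hB N le_rfl
  · have h : ∀ m ∈ range N, ‖((∑ j ∈ Icc 1 m, a j : ℝ) : ℂ) * (eC (m * α) - eC ((m + 1 : ℕ) * α))‖ ≤
        B * (2 * π * |α|) := by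
      intro m hm
      rw [norm_mul, Complex.norm_real]
      refine mul_le_mul (hB m (mem_range.mp hm).le) ?_ (norm_nonneg _) hB0
      refine (norm_eC_sub_eC_le _ _).trans_eq ?_
      congr 1
      rw [← abs_neg]; congr 1; push_cast; ring
    refine (norm_sum_le_of_le _ h).trans_eq ?_
    rw [sum_const, card_range, nsmul_eq_mul]; ring

lemma inv_mul_rpow_bounds {c : ℝ} (hc : 1 < c) {j : ℕ} (hj : 0 < j) :
    ((j + 1 : ℕ) : ℝ) ^ (1 / c) - (j : ℝ) ^ (1 / c) ≤ 1 / c * (j : ℝ) ^ (1 / c - 1) ∧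
      1 / c * (j : ℝ) ^ (1 / c - 1) ≤ (j : ℝ) ^ (1 / c) - ((j - 1 : ℕ) : ℝ) ^ (1 / c) := by
  have hc0 : 0 < c := by linarith
  have hj' : (0 : ℝ) < j := by exact_mod_cast hj
  have hpow : ∀ n : ℕ, (((n : ℝ) ^ (1 / c)) ^ c) = n := by
    intro n
    rw [← Real.rpow_mul (Nat.cast_nonneg n), one_div_mul_cancel hc0.ne', Real.rpow_one]
  have hmono : ∀ m n : ℕ, m ≤ n → (m : ℝ) ^ (1 / c) ≤ (n : ℝ) ^ (1 / c) := fun m n h =>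
    Real.rpow_le_rpow (Nat.cast_nonneg m) (Nat.cast_le.mpr h) (by positivity)
  have hcoef : (1 / c * (j : ℝ) ^ (1 / c - 1)) * (c * ((j : ℝ) ^ (1 / c)) ^ (c - 1)) = 1 := by
    rw [Real.rpow_sub_one (by positivity : (j : ℝ) ^ (1 / c) ≠ 0), hpow, Real.rpow_sub_one hj'.ne']
    field_simp
  have hpos : 0 < c * ((j : ℝ) ^ (1 / c)) ^ (c - 1) := by positivity
  constructor
  · have h := (mul_rpow_le_sub hc.le (by positivity) (hmono j (j + 1) (Nat.le_succ j))).1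
    rw [hpow, hpow] at h
    refine le_of_mul_le_mul_right ?_ hpos
    rw [hcoef, mul_comm]
    refine h.trans_eq ?_
    push_cast; ring
  · have h := (mul_rpow_le_sub hc.le (by positivity) (hmono (j - 1) j (Nat.sub_le j 1))).2
    rw [hpow, hpow] at h
    refine le_of_mul_le_mul_right ?_ hpos
    rw [hcoef, mul_comm]
    refine le_trans (le_of_eq ?_) h
    rw [Nat.cast_sub hj]; push_cast; ring

lemma sum_inv_mul_rpow_bounds {c : ℝ} (hc : 1 < c) (k : ℕ) :
    ((k + 1 : ℕ) : ℝ) ^ (1 / c) - 1 ≤ ∑ j ∈ Icc 1 k, 1 / c * (j : ℝ) ^ (1 / c - 1) ∧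
      ∑ j ∈ Icc 1 k, 1 / c * (j : ℝ) ^ (1 / c - 1) ≤ (k : ℝ) ^ (1 / c) := by
  induction k with
  | zero =>
    have : (1 / c) ≠ 0 := by positivity
    simp [Real.zero_rpow (inv_ne_zero (by positivity : c ≠ 0))]
  | succ k ih =>
    rw [sum_Icc_succ_top (by omega)]
    have h := inv_mul_rpow_bounds hc (j := k + 1) (Nat.succ_pos k)
    rw [Nat.add_sub_cancel] at h
    exact ⟨by linarith [h.1, ih.1], by linarith [h.2, ih.2]⟩

/-- The coefficient of `e(mα)` in `SS c P α`. -/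
noncomputable def primeWeight (c P : ℝ) (m : ℕ) : ℝ :=
  ∑ p ∈ (range (⌊P⌋₊ + 1)).filter Nat.Prime, if ⌊(p : ℝ) ^ c⌋₊ = m then Real.log p else 0

lemma SS_eq_sum_primeWeight {c P : ℝ} (hc : 1 < c) (hP : 0 ≤ P) {N : ℕ} (hN : P ^ c = N) (α : ℝ) :
    SS c P α = ∑ m ∈ Icc 1 N, (primeWeight c P m : ℂ) * eC (m * α) := by
  have h1 : ∀ m ∈ Icc 1 N, (primeWeight c P m : ℂ) * eC (m * α) =
      ∑ p ∈ (range (⌊P⌋₊ + 1)).filter Nat.Prime,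
        if ⌊(p : ℝ) ^ c⌋₊ = m then (Real.log p : ℂ) * eC (m * α) else 0 := by
    intro m _
    rw [primeWeight, Complex.ofReal_sum, sum_mul]
    refine sum_congr rfl fun p _ => ?_
    split_ifs <;> simp
  rw [sum_congr rfl h1, sum_comm, SS]
  refine sum_congr rfl fun p hp => ?_
  rw [mem_filter, mem_range, Nat.lt_succ_iff, Nat.le_floor_iff hP] at hp
  have hp1 : (1 : ℝ) ≤ p := by exact_mod_cast hp.2.one_lt.le
  rw [sum_ite_eq, if_pos]
  · rw [← natCast_floor_eq_intCast_floor (by positivity : (0 : ℝ) ≤ (p : ℝ) ^ c)]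
  · rw [mem_Icc]
    refine ⟨(Nat.one_le_floor_iff _).mpr (Real.one_le_rpow hp1 (by linarith)), ?_⟩
    refine Nat.floor_le_of_le ?_
    rw [← hN]
    exact Real.rpow_le_rpow (by positivity) hp.1 (by linarith)

lemma sum_primeWeight_bounds {c P : ℝ} (hc : 1 < c) (hP : 0 ≤ P) {N k : ℕ} (hN : P ^ c = N) (hk : k ≤ N) :
    Chebyshev.theta ((k : ℝ) ^ (1 / c)) ≤ ∑ m ∈ Icc 1 k, primeWeight c P m ∧
      ∑ m ∈ Icc 1 k, primeWeight c P m ≤ Chebyshev.theta (((k + 1 : ℕ) : ℝ) ^ (1 / c)) := by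
  have hc0 : 0 < c := by linarith
  have e : ∑ m ∈ Icc 1 k, primeWeight c P m =
      ∑ p ∈ ((range (⌊P⌋₊ + 1)).filter Nat.Prime).filter (fun p : ℕ => ⌊(p : ℝ) ^ c⌋₊ ∈ Icc 1 k),
        Real.log p := by
    unfold primeWeight
    rw [sum_comm, sum_filter (fun p : ℕ => ⌊(p : ℝ) ^ c⌋₊ ∈ Icc 1 k)]
    refine sum_congr rfl fun p _ => ?_
    rw [sum_ite_eq]
  have hle : ∀ p n : ℕ, (p : ℝ) ≤ (n : ℝ) ^ (1 / c) ↔ (p : ℝ) ^ c ≤ n := by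
    intro p n
    rw [one_div, Real.le_rpow_inv_iff_of_pos (Nat.cast_nonneg p) (Nat.cast_nonneg n) hc0]
  rw [e, Chebyshev.theta, Chebyshev.theta]
  constructor
  · refine sum_le_sum_of_subset_of_nonneg (fun p hp => ?_) fun p _ _ => Real.log_natCast_nonneg p
    rw [mem_filter, mem_Ioc, Nat.le_floor_iff (by positivity), hle] at hp
    obtain ⟨⟨_, hp1⟩, hp2⟩ := hp
    have hp3 : (1 : ℝ) ≤ p := by exact_mod_cast hp2.one_lt.le
    simp only [mem_filter, mem_range, Nat.lt_succ_iff, Nat.le_floor_iff hP, mem_Icc]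
    refine ⟨⟨?_, hp2⟩, (Nat.one_le_floor_iff _).mpr (Real.one_le_rpow hp3 hc0.le), Nat.floor_le_of_le hp1⟩
    rw [← Real.rpow_le_rpow_iff (Nat.cast_nonneg p) hP hc0, hN]
    exact hp1.trans (Nat.cast_le.mpr hk)
  · refine sum_le_sum_of_subset_of_nonneg (fun p hp => ?_) fun p _ _ => Real.log_natCast_nonneg p
    simp only [mem_filter, mem_range, mem_Icc] at hp
    obtain ⟨⟨_, hp2⟩, _, hp1⟩ := hp
    rw [mem_filter, mem_Ioc, Nat.le_floor_iff (by positivity), hle]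
    refine ⟨⟨hp2.pos, ?_⟩, hp2⟩
    have := Nat.lt_floor_add_one ((p : ℝ) ^ c)
    have h2 : ((⌊(p : ℝ) ^ c⌋₊ : ℕ) : ℝ) ≤ k := Nat.cast_le.mpr hp1
    push_cast
    linarith

lemma mul_exp_neg_sqrt_log_le {b x y : ℝ} (hb : 0 ≤ b) (hb1 : b ≤ 1) (hx : 1 ≤ x) (hxy : x ≤ y)
    (hy : 1 ≤ Real.log y) :
    x * Real.exp (-(b * √(Real.log x))) ≤ y * Real.exp (-(b / 2 * √(Real.log y))) := by
  have hx0 : 0 < x := by linarith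
  have hy0 : 0 < y := by linarith
  have e : ∀ z u : ℝ, 0 < z → z * Real.exp u = Real.exp (Real.log z + u) := fun z u hz => by
    rw [Real.exp_add, Real.exp_log hz]
  rw [e x _ hx0, e y _ hy0]
  refine Real.exp_le_exp.mpr ?_
  have h1 := Real.sq_sqrt (Real.log_nonneg hx)
  have h2 := Real.sq_sqrt (zero_le_one.trans hy)
  have h3 := Real.sqrt_nonneg (Real.log x)
  have h4 : 1 ≤ √(Real.log y) := Real.one_le_sqrt.mpr hy
  have h5 : √(Real.log x) ≤ √(Real.log y) := Real.sqrt_le_sqrt (Real.log_le_log hx0 hxy)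
  set s := √(Real.log x)
  set t := √(Real.log y)
  rw [← h1, ← h2]
  rcases le_or_gt (t / 2) s with h | h
  · nlinarith [mul_nonneg hb (sub_nonneg.mpr h)]
  · nlinarith [mul_le_mul_of_nonneg_right hb1 (by linarith : 0 ≤ t / 2 - s)]

lemma norm_SS_sub_G_le : ∃ b > 0, b ≤ 1 ∧ ∃ C > 0, ∀ c P α : ℝ, ∀ N : ℕ, 1 < c → 3 ≤ P → P ^ c = N →
    ‖SS c P α - G c N α‖ ≤
      C * (P * Real.exp (-(b * √(Real.log P))) + 1) * (1 + N * (2 * π * |α|)) := by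
  obtain ⟨b, hb, hb1, C, hC, h⟩ := exists_theta_sub_le
  refine ⟨b / 2, by positivity, by linarith, 2 * C + 2, by positivity, ?_⟩
  intro c P α N hc hP hN
  have hc0 : 0 < c := by linarith
  have hP0 : 0 ≤ P := by linarith
  have e : SS c P α - G c N α =
      ∑ m ∈ Icc 1 N, ((primeWeight c P m - 1 / c * (m : ℝ) ^ (1 / c - 1) : ℝ) : ℂ) * eC (m * α) := by
    rw [SS_eq_sum_primeWeight hc hP0 hN, G, ← sum_sub_distrib]
    refine sum_congr rfl fun m _ => ?_
    push_cast; ring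
  rw [e]
  have hPN : (N : ℝ) ^ (1 / c) = P := by
    rw [← hN, ← Real.rpow_mul hP0, mul_one_div_cancel hc0.ne', Real.rpow_one]
  have hsucc : ∀ k : ℕ, ((k + 1 : ℕ) : ℝ) ^ (1 / c) ≤ (k : ℝ) ^ (1 / c) + 1 := by
    intro k
    have h1 := (sum_inv_mul_rpow_bounds hc k).1.trans (sum_inv_mul_rpow_bounds hc k).2
    linarith
  have hlogP : 1 ≤ Real.log P := by
    rw [Real.le_log_iff_exp_le (by linarith)]
    linarith [Real.exp_one_lt_d9]
  refine norm_sum_mul_eC_le fun k hk => ?_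
  have hkP : (k : ℝ) ^ (1 / c) ≤ P := by
    rw [← hPN]
    exact Real.rpow_le_rpow (Nat.cast_nonneg k) (Nat.cast_le.mpr hk) (by positivity)
  set W := P * Real.exp (-(b / 2 * √(Real.log P))) with hW
  have hW0 : 0 < W := by positivity
  have hWP : (P + 1) * Real.exp (-(b / 2 * √(Real.log (P + 1)))) ≤ 2 * W := by
    have : Real.exp (-(b / 2 * √(Real.log (P + 1)))) ≤ Real.exp (-(b / 2 * √(Real.log P))) := by
      refine Real.exp_le_exp.mpr (neg_le_neg ?_)
      gcongr
      linarith
    calc _ ≤ (2 * P) * Real.exp (-(b / 2 * √(Real.log P))) := by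
          refine mul_le_mul (by linarith) this (by positivity) (by linarith)
      _ = _ := by rw [hW]; ring
  have hθ : ∀ x, 1 ≤ x → x ≤ P + 1 → |Chebyshev.theta x - x| ≤ C * (2 * W) := by
    intro x hx hxP
    refine (h x hx).trans (mul_le_mul_of_nonneg_left ?_ hC.le)
    refine (mul_exp_neg_sqrt_log_le hb.le hb1 hx hxP ?_).trans hWP
    exact hlogP.trans (Real.log_le_log (by linarith) (by linarith))
  have hpw := sum_primeWeight_bounds hc hP0 hN hk
  have hG := sum_inv_mul_rpow_bounds hc k
  rw [sum_sub_distrib]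
  have hup : Chebyshev.theta (((k + 1 : ℕ) : ℝ) ^ (1 / c)) ≤ ((k + 1 : ℕ) : ℝ) ^ (1 / c) + C * (2 * W) := by
    have h1 : (1 : ℝ) ≤ ((k + 1 : ℕ) : ℝ) ^ (1 / c) :=
      Real.one_le_rpow (by exact_mod_cast Nat.succ_pos k) (by positivity)
    have := abs_le.mp (hθ _ h1 (by linarith [hsucc k]))
    linarith [this.2]
  have hlow : (k : ℝ) ^ (1 / c) - C * (2 * W) - 1 ≤ Chebyshev.theta ((k : ℝ) ^ (1 / c)) := by
    rcases le_or_gt 1 ((k : ℝ) ^ (1 / c)) with h1 | h1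
    · have := abs_le.mp (hθ _ h1 (by linarith))
      linarith [this.1]
    · have := Chebyshev.theta_nonneg ((k : ℝ) ^ (1 / c))
      have : 0 ≤ C * (2 * W) := by positivity
      linarith
  have hCW : 0 ≤ C * W := by positivity
  rw [abs_le]
  constructor
  · nlinarith [hpw.1, hG.2]
  · nlinarith [hpw.2, hG.1]

lemma norm_G_le {c α : ℝ} (hc : 1 < c) (hα : 0 < α) (hα2 : α ≤ 1 / 2) (N : ℕ) :
    ‖G c N α‖ ≤ 4 * α ^ (-(1 / c)) := by
  have hc0 : 0 < c := by linarith
  have hcinv : 1 / c ≤ 1 := by rw [div_le_one hc0]; linarith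
  have hcinv0 : 0 < 1 / c := by positivity
  set M := ⌈1 / α⌉₊ with hM
  have hM1 : 1 / α ≤ M := Nat.le_ceil _
  have hα1 : 1 ≤ 1 / α := by rw [le_div_iff₀ hα]; linarith
  have hM2 : (M : ℝ) ≤ 2 * (1 / α) := by
    have := (Nat.ceil_lt_add_one (by positivity : 0 ≤ 1 / α)).le
    linarith
  have hM0 : 0 < M := Nat.ceil_pos.mpr (by positivity)
  have hM' : (0 : ℝ) < M := by exact_mod_cast hM0
  have htriv : ∀ k : ℕ, k ≤ M → ‖∑ m ∈ Icc 1 k, ((1 / c * (m : ℝ) ^ (1 / c - 1) : ℝ) : ℂ) * eC (m * α)‖ ≤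
      (M : ℝ) ^ (1 / c) := by
    intro k hk
    have h1 : ∀ m ∈ Icc 1 k, ‖((1 / c * (m : ℝ) ^ (1 / c - 1) : ℝ) : ℂ) * eC (m * α)‖ ≤
        1 / c * (m : ℝ) ^ (1 / c - 1) := by
      intro m _
      rw [norm_mul, norm_eC, mul_one, Complex.norm_real, Real.norm_of_nonneg (by positivity)]
    refine (norm_sum_le_of_le _ h1).trans ((sum_inv_mul_rpow_bounds hc k).2.trans ?_)
    exact Real.rpow_le_rpow (Nat.cast_nonneg k) (Nat.cast_le.mpr hk) hcinv0.le
  have hMα : (M : ℝ) ^ (1 / c) ≤ 2 * α ^ (-(1 / c)) := by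
    calc (M : ℝ) ^ (1 / c) ≤ (2 * (1 / α)) ^ (1 / c) := Real.rpow_le_rpow hM'.le hM2 hcinv0.le
      _ = 2 ^ (1 / c) * α ^ (-(1 / c)) := by
        rw [Real.mul_rpow (by norm_num) (by positivity), one_div α, Real.inv_rpow hα.le, Real.rpow_neg hα.le]
      _ ≤ 2 ^ (1 : ℝ) * α ^ (-(1 / c)) := by
        gcongr
        norm_num
      _ = _ := by rw [Real.rpow_one]
  have hαpos : 0 < α ^ (-(1 / c)) := by positivity
  rcases le_or_gt N M with h | h
  · exact (htriv N h).trans (by linarith)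
  · have hsplit : G c N α = ∑ m ∈ Icc 1 M, ((1 / c * (m : ℝ) ^ (1 / c - 1) : ℝ) : ℂ) * eC (m * α) +
        ∑ i ∈ range (N - M), ((1 / c * ((M + 1 + i : ℕ) : ℝ) ^ (1 / c - 1) : ℝ) : ℂ) *
          eC ((M + 1 + i : ℕ) * α) := by
      have e : ∀ k : ℕ, Icc 1 k = Ico 1 (k + 1) := fun k => by ext; simp
      rw [G, e, e, ← sum_Ico_consecutive _ (by omega : 1 ≤ M + 1) (by omega : M + 1 ≤ N + 1),
        sum_Ico_eq_sum_range _ (M + 1), Nat.add_sub_add_right]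
    have htail := norm_sum_antitone_mul_le
      (r := fun i => 1 / c * ((M + 1 + i : ℕ) : ℝ) ^ (1 / c - 1))
      (v := fun i => eC ((M + 1 + i : ℕ) * α)) (n := N - M) (B := 1 / α)
      (fun i _ => by
        refine mul_le_mul_of_nonneg_left ?_ hcinv0.le
        refine Real.rpow_le_rpow_of_nonpos (Nat.cast_pos.mpr (by omega)) (Nat.cast_le.mpr (by omega))
          (by linarith))
      (fun i _ => by positivity)
      (fun k _ => by
        have hdiff : ∀ i : ℕ, ((M + 1 + (i + 1) : ℕ) : ℝ) * α - ((M + 1 + i : ℕ) : ℝ) * α = α := by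
          intro i; push_cast; ring
        exact norm_sum_eC_le (f := fun i => ((M + 1 + i : ℕ) : ℝ) * α) hα (fun i _ => (hdiff i).ge)
          (fun i _ => (hdiff i).le.trans hα2) (fun i _ => ((hdiff i).trans (hdiff (i + 1)).symm).le))
      (by omega)
    have hr : 1 / c * ((M + 1 + 0 : ℕ) : ℝ) ^ (1 / c - 1) * (1 / α) ≤ (M : ℝ) ^ (1 / c) := by
      have h1 : ((M + 1 + 0 : ℕ) : ℝ) ^ (1 / c - 1) ≤ (M : ℝ) ^ (1 / c - 1) :=
        Real.rpow_le_rpow_of_nonpos hM' (Nat.cast_le.mpr (by omega)) (by linarith)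
      calc _ ≤ 1 * (M : ℝ) ^ (1 / c - 1) * M := by gcongr
        _ = (M : ℝ) ^ (1 / c) := by
          rw [one_mul, Real.rpow_sub_one hM'.ne']; field_simp
    rw [hsplit]
    refine (norm_add_le _ _).trans ?_
    linarith [htriv M le_rfl, htail.trans hr]

lemma norm_SS_sub_le {c P α : ℝ} (hP : 1 ≤ P) :
    ‖SS c P α - ∑ n ∈ Icc 1 ⌊P⌋₊, (ArithmeticFunction.vonMangoldt n : ℂ) * eC (α * (n : ℝ) ^ c)‖ ≤
      2 * π * |α| * (Real.log 4 * P) + 2 * √P * Real.log P := by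
  set T : ℂ := ∑ p ∈ (range (⌊P⌋₊ + 1)).filter Nat.Prime, (Real.log p : ℂ) * eC (α * (p : ℝ) ^ c) with hT
  have hIoc : Icc 1 ⌊P⌋₊ = Ioc 0 ⌊P⌋₊ := by ext; simp; omega
  have hfil : (range (⌊P⌋₊ + 1)).filter Nat.Prime = (Ioc 0 ⌊P⌋₊).filter Nat.Prime := by
    ext p
    simp only [mem_filter, mem_range, mem_Ioc]
    constructor
    · rintro ⟨h1, h2⟩; exact ⟨⟨h2.pos, by omega⟩, h2⟩
    · rintro ⟨h1, h2⟩; exact ⟨by omega, h2⟩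
  have h1 : ‖SS c P α - T‖ ≤ 2 * π * |α| * (Real.log 4 * P) := by
    rw [SS, hT, ← sum_sub_distrib]
    have hterm : ∀ p ∈ (range (⌊P⌋₊ + 1)).filter Nat.Prime,
        ‖(Real.log p : ℂ) * eC ((⌊(p : ℝ) ^ c⌋ : ℝ) * α) - (Real.log p : ℂ) * eC (α * (p : ℝ) ^ c)‖ ≤
        2 * π * |α| * Real.log p := by
      intro p _
      rw [← mul_sub, norm_mul, Complex.norm_real, Real.norm_of_nonneg (Real.log_natCast_nonneg p), mul_comm]
      refine mul_le_mul_of_nonneg_right ?_ (Real.log_natCast_nonneg p)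
      refine (norm_eC_sub_eC_le _ _).trans ?_
      refine mul_le_mul_of_nonneg_left ?_ Real.two_pi_pos.le
      rw [mul_comm α, ← sub_mul, abs_mul]
      have h2 : |(⌊(p : ℝ) ^ c⌋ : ℝ) - (p : ℝ) ^ c| ≤ 1 := by
        rw [abs_le]
        constructor
        · linarith [Int.lt_floor_add_one ((p : ℝ) ^ c)]
        · linarith [Int.floor_le ((p : ℝ) ^ c)]
      calc _ ≤ 1 * |α| := by gcongr
        _ = _ := one_mul _
    refine (norm_sum_le_of_le _ hterm).trans ?_
    rw [← mul_sum, hfil]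
    exact mul_le_mul_of_nonneg_left (Chebyshev.theta_le_log4_mul_x (by linarith)) (by positivity)
  have h2 : ‖T - ∑ n ∈ Icc 1 ⌊P⌋₊, (ArithmeticFunction.vonMangoldt n : ℂ) * eC (α * (n : ℝ) ^ c)‖ ≤
      2 * √P * Real.log P := by
    rw [← norm_neg, neg_sub, hT, hfil, sum_filter, hIoc, ← sum_sub_distrib]
    have hterm : ∀ n ∈ Ioc 0 ⌊P⌋₊, ‖(ArithmeticFunction.vonMangoldt n : ℂ) * eC (α * (n : ℝ) ^ c) -
        (if n.Prime then (Real.log n : ℂ) * eC (α * (n : ℝ) ^ c) else 0)‖ ≤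
        ArithmeticFunction.vonMangoldt n - if n.Prime then Real.log n else 0 := by
      intro n _
      split_ifs with hn
      · rw [ArithmeticFunction.vonMangoldt_apply_prime hn]; simp
      · rw [sub_zero, sub_zero, norm_mul, norm_eC, mul_one, Complex.norm_real,
          Real.norm_of_nonneg ArithmeticFunction.vonMangoldt_nonneg]
    refine (norm_sum_le_of_le _ hterm).trans ?_
    rw [sum_sub_distrib, ← sum_filter]
    exact (le_abs_self _).trans (Chebyshev.abs_psi_sub_theta_le_sqrt_mul_log hP)
  calc _ ≤ ‖SS c P α - T‖ + ‖T - ∑ n ∈ Icc 1 ⌊P⌋₊,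
        (ArithmeticFunction.vonMangoldt n : ℂ) * eC (α * (n : ℝ) ^ c)‖ := norm_sub_le_norm_sub_add_norm_sub _ _ _
    _ ≤ _ := add_le_add h1 h2

lemma SS_neg (c P α : ℝ) : SS c P (-α) = (starRingEnd ℂ) (SS c P α) := by
  simp only [SS, map_sum, map_mul, Complex.conj_ofReal, ← eC_neg, mul_neg]

lemma G_neg (c : ℝ) (N : ℕ) (α : ℝ) : G c N (-α) = (starRingEnd ℂ) (G c N α) := by
  simp only [G, map_sum, map_mul, Complex.conj_ofReal, ← eC_neg, mul_neg]

lemma norm_SS_sub_G_abs (c P α : ℝ) (N : ℕ) : ‖SS c P |α| - G c N |α|‖ = ‖SS c P α - G c N α‖ := by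
  rcases abs_cases α with h | h
  · rw [h.1]
  · rw [h.1, SS_neg, G_neg, ← map_sub, RCLike.norm_conj]

open Filter

lemma eventually_rpow_le_mul_rpow {s t κ : ℝ} (hst : s < t) (hκ : 0 < κ) :
    ∀ᶠ L : ℝ in atTop, L ^ s ≤ κ * L ^ t := by
  filter_upwards [(tendsto_rpow_atTop (sub_pos.mpr hst)).eventually_ge_atTop κ⁻¹, eventually_gt_atTop 0]
    with L h1 h2
  have h3 : L ^ t = L ^ s * L ^ (t - s) := by rw [← Real.rpow_add h2]; congr 1; ring
  have h4 : 1 ≤ κ * L ^ (t - s) := by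
    rw [inv_le_iff_one_le_mul₀ hκ] at h1; linarith
  have h5 : 0 < L ^ s := by positivity
  rw [h3]
  nlinarith

lemma eventually_sum_rpow_le {b : ℝ} (hb : 0 < b) :
    ∀ᶠ L : ℝ in atTop, L ^ ((2 : ℝ) / 5) + L ^ ((1 : ℝ) / 3) ≤ b * √L := by
  filter_upwards [eventually_rpow_le_mul_rpow (s := 2 / 5) (t := 1 / 2) (by norm_num) (half_pos hb),
    eventually_rpow_le_mul_rpow (s := 1 / 3) (t := 1 / 2) (by norm_num) (half_pos hb)] with L h1 h2
  rw [Real.sqrt_eq_rpow]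
  linarith

lemma eventually_pow_mul_exp_le {κ : ℝ} (hκ : 0 < κ) :
    ∀ᶠ L : ℝ in atTop, (1 + L) ^ 4 * Real.exp (-(κ * L ^ ((2 : ℝ) / 5))) ≤
      Real.exp (-L ^ ((1 : ℝ) / 3)) := by
  have hlog := (isLittleO_log_rpow_atTop (by norm_num : (0 : ℝ) < 2 / 5)).bound
    (by positivity : 0 < κ / 16)
  filter_upwards [eventually_rpow_le_mul_rpow (s := 1 / 3) (t := 2 / 5) (by norm_num) (half_pos hκ),
    hlog, eventually_ge_atTop 2] with L h1 h2 h3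
  have h4 : (1 + L) ^ 4 ≤ Real.exp (8 * Real.log L) := by
    calc (1 + L) ^ 4 ≤ (L ^ 2) ^ 4 := by
          gcongr
          nlinarith
      _ = L ^ 8 := by ring
      _ = Real.exp (8 * Real.log L) := by
        rw [← Real.exp_log (by positivity : 0 < L ^ 8), Real.log_pow]; norm_num
  have h5 : 0 ≤ L ^ ((2 : ℝ) / 5) := by positivity
  rw [Real.norm_eq_abs, Real.norm_of_nonneg h5] at h2
  have h6 := (le_abs_self _).trans h2
  calc _ ≤ Real.exp (8 * Real.log L) * Real.exp (-(κ * L ^ ((2 : ℝ) / 5))) := by gcongr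
    _ = Real.exp (8 * Real.log L - κ * L ^ ((2 : ℝ) / 5)) := by rw [← Real.exp_add]; ring_nf
    _ ≤ _ := Real.exp_le_exp.mpr (by linarith)

lemma norm_SS_sub_G_le_of_small : ∃ C > 0, ∀ᶠ P : ℝ in atTop, ∀ c α : ℝ, ∀ N : ℕ, 1 < c → P ^ c = N →
    N * |α| ≤ Real.exp (Real.log P ^ ((2 : ℝ) / 5)) →
    ‖SS c P α - G c N α‖ ≤ C * P * Real.exp (-Real.log P ^ ((1 : ℝ) / 3)) := by
  obtain ⟨b, hb, hb1, C, hC, h⟩ := norm_SS_sub_G_le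
  refine ⟨C * 16, by positivity, ?_⟩
  filter_upwards [eventually_ge_atTop 3, Real.tendsto_log_atTop.eventually (eventually_sum_rpow_le hb),
    Real.tendsto_log_atTop.eventually_ge_atTop 1] with P hP hL hL1 c α N hc hN hX
  refine (h c P α N hc hP hN).trans ?_
  have hP0 : 0 < P := by linarith
  set L := Real.log P with hLdef
  have h1 : 1 ≤ P * Real.exp (-(b * √L)) := by
    have : b * √L ≤ L := by
      have h2 := Real.sq_sqrt (zero_le_one.trans hL1)
      have h3 : 1 ≤ √L := Real.one_le_sqrt.mpr hL1
      nlinarith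
    nth_rewrite 1 [← Real.exp_log hP0]
    rw [← Real.exp_add]
    exact Real.one_le_exp (by linarith)
  have h2 : 1 + N * (2 * π * |α|) ≤ 8 * Real.exp (L ^ ((2 : ℝ) / 5)) := by
    have h3 : 1 ≤ Real.exp (L ^ ((2 : ℝ) / 5)) := Real.one_le_exp (by positivity)
    have h4 : 2 * π ≤ 7 := by linarith [Real.pi_lt_d2]
    have h5 : N * (2 * π * |α|) ≤ 7 * (N * |α|) := by
      have : 0 ≤ N * |α| := by positivity
      nlinarith
    linarith
  calc C * (P * Real.exp (-(b * √L)) + 1) * (1 + N * (2 * π * |α|)) ≤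
        C * (P * Real.exp (-(b * √L)) + P * Real.exp (-(b * √L))) * (8 * Real.exp (L ^ ((2 : ℝ) / 5))) := by
        gcongr
    _ = C * 16 * P * Real.exp (-(b * √L) + L ^ ((2 : ℝ) / 5)) := by rw [Real.exp_add]; ring
    _ ≤ _ := by
      refine mul_le_mul_of_nonneg_left (Real.exp_le_exp.mpr (by linarith)) (by positivity)

set_option maxHeartbeats 1000000 in
lemma norm_SS_sub_G_le_of_large {c ε : ℝ} (hc : 1 < c) (hc3 : c ≤ 3) (hε : 0 < ε) (hε1 : ε ≤ 1) :
    ∀ᶠ P : ℝ in atTop, ∀ α : ℝ, ∀ N : ℕ, P ^ c = N → 0 ≤ α → α ≤ P ^ (1 - c - ε) →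
    Real.exp (Real.log P ^ ((2 : ℝ) / 5)) ≤ N * α →
    ‖SS c P α - G c N α‖ ≤ 2700 * P * Real.exp (-Real.log P ^ ((1 : ℝ) / 3)) := by
  have hc0 : 0 < c := by linarith
  have hhalf : Tendsto (fun P : ℝ => (P / 2) ^ (3 * ε / 4)) atTop atTop :=
    (tendsto_rpow_atTop (by positivity)).comp (tendsto_id.atTop_div_const (by norm_num))
  filter_upwards [eventually_ge_atTop 3,
    Real.tendsto_log_atTop.eventually (eventually_pow_mul_exp_le (by positivity : 0 < ε / 32)),
    Real.tendsto_log_atTop.eventually_ge_atTop 1,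
    ((tendsto_rpow_atTop (by norm_num : (0 : ℝ) < 2 / 5)).comp Real.tendsto_log_atTop).eventually_ge_atTop 3,
    hhalf.eventually_ge_atTop 72] with P hP hL hL1 hL3 hP72 α N hN hα0 hα hX
  have hP0 : 0 < P := by linarith
  have hP1 : 1 ≤ P := by linarith
  set L := Real.log P with hLdef
  have hL3' : 3 ≤ L ^ ((2 : ℝ) / 5) := hL3
  set X := (N : ℝ) * α with hXdef
  set V := Real.exp (-(ε / 32 * L ^ ((2 : ℝ) / 5))) with hV
  have hexp8 : 8 ≤ Real.exp (L ^ ((2 : ℝ) / 5)) := by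
    have h1 : (2 : ℝ) ≤ Real.exp 1 := by linarith [Real.exp_one_gt_d9]
    calc (8 : ℝ) = 2 ^ 3 := by norm_num
      _ ≤ Real.exp 1 ^ 3 := by gcongr
      _ = Real.exp 3 := by rw [← Real.exp_nat_mul]; norm_num
      _ ≤ _ := Real.exp_le_exp.mpr hL3'
  have hX8 : 8 ≤ X := hexp8.trans hX
  have hX0 : 0 < X := by linarith
  have hα' : 0 < α := lt_of_le_of_ne hα0 fun h => by simp [hXdef, ← h] at hX8; linarith
  have hXV : X ^ (-(ε / 32)) ≤ V := by
    calc X ^ (-(ε / 32)) ≤ (Real.exp (L ^ ((2 : ℝ) / 5))) ^ (-(ε / 32)) :=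
          Real.rpow_le_rpow_of_nonpos (Real.exp_pos _) hX (by linarith)
      _ = V := by rw [hV, ← Real.exp_mul]; congr 1; ring
  -- the integer part of `P`
  set K := ⌊P⌋₊ with hK
  have hKP : (K : ℝ) ≤ P := Nat.floor_le hP0.le
  have hPK : P / 2 ≤ K := half_le_floor hP1
  have hK0 : 0 < K := (Nat.one_le_floor_iff _).mpr hP1
  have hK' : (0 : ℝ) < K := by exact_mod_cast hK0
  have hKε : 72 ≤ (K : ℝ) ^ (3 * ε / 4) :=
    hP72.trans (Real.rpow_le_rpow (by positivity) hPK (by positivity))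
  have hαK : α ≤ (K : ℝ) ^ (1 - c - ε) :=
    hα.trans (Real.rpow_le_rpow_of_nonpos hK' hKP (by linarith))
  have hXK : X / 8 ≤ α * (K : ℝ) ^ c := by
    have h1 : (P / 2) ^ c ≤ (K : ℝ) ^ c := Real.rpow_le_rpow (by positivity) hPK hc0.le
    have h2 : (2 : ℝ) ^ c ≤ 8 := by
      calc (2 : ℝ) ^ c ≤ 2 ^ (3 : ℝ) := Real.rpow_le_rpow_of_exponent_le (by norm_num) hc3
        _ = 8 := by norm_num
    calc X / 8 = α * (P ^ c / 8) := by rw [hN]; ring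
      _ ≤ α * (P ^ c / 2 ^ c) := by gcongr
      _ = α * (P / 2) ^ c := by rw [Real.div_rpow hP0.le (by norm_num)]
      _ ≤ _ := by gcongr
  have hB := norm_sum_vonMangoldt_mul_eC_le hc hc3 hε hε1 hK0 hKε hαK (by linarith)
  have hXKV : (α * (K : ℝ) ^ c) ^ (-(ε / 32)) ≤ 8 * V := by
    calc (α * (K : ℝ) ^ c) ^ (-(ε / 32)) ≤ (X / 8) ^ (-(ε / 32)) :=
          Real.rpow_le_rpow_of_nonpos (by positivity) hXK (by linarith)
      _ = 8 ^ (ε / 32) * X ^ (-(ε / 32)) := by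
        rw [Real.div_rpow hX0.le (by norm_num), Real.rpow_neg (by norm_num : (0 : ℝ) ≤ 8)]
        field_simp
      _ ≤ 8 ^ (1 : ℝ) * V := by
        gcongr
        · norm_num
        · linarith
      _ = _ := by rw [Real.rpow_one]
  have hlogK : 0 ≤ 1 + Real.log K := by linarith [Real.log_natCast_nonneg K]
  have hlogKL : 1 + Real.log K ≤ 1 + L := by linarith [Real.log_le_log hK' hKP]
  set R := (1 + L) ^ 4 with hR
  have hR1 : 1 ≤ R := one_le_pow₀ (by linarith)
  have hRL : L ≤ R := by
    have : 1 + L ≤ R := le_self_pow₀ (by linarith) (by norm_num)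
    linarith
  have hV0 : 0 < V := Real.exp_pos _
  have hlogR : (1 + Real.log K) ^ 4 ≤ R := pow_le_pow_left₀ hlogK hlogKL 4
  have hB' : 329 * (1 + Real.log K) ^ 4 * (K * (α * (K : ℝ) ^ c) ^ (-(ε / 32))) ≤ 2632 * (P * (R * V)) := by
    calc _ ≤ 329 * R * (P * (8 * V)) := by gcongr
      _ = _ := by ring
  -- the remaining error terms
  have hLpow : L ^ ((2 : ℝ) / 5) ≤ L := by
    calc L ^ ((2 : ℝ) / 5) ≤ L ^ (1 : ℝ) := Real.rpow_le_rpow_of_exponent_le hL1 (by norm_num)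
      _ = L := Real.rpow_one L
  have hPexp : ∀ s : ℝ, ε / 32 ≤ s → P ^ (-s) ≤ V := by
    intro s hs
    rw [Real.rpow_def_of_pos hP0, hV]
    refine Real.exp_le_exp.mpr ?_
    have hs0 : 0 ≤ s := by linarith
    have : ε / 32 * L ^ ((2 : ℝ) / 5) ≤ s * L := by gcongr
    linarith
  have hαε : α ≤ P ^ (-ε) := hα.trans (Real.rpow_le_rpow_of_exponent_le hP1 (by linarith))
  have hαV : α ≤ V := hαε.trans (hPexp ε (by linarith))
  have hα2 : α ≤ 1 / 2 := by
    have h1 : 72 ≤ P ^ ε := (hP72.trans (Real.rpow_le_rpow (by positivity) (by linarith) (by positivity))).trans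
      (Real.rpow_le_rpow_of_exponent_le hP1 (by linarith))
    rw [Real.rpow_neg hP0.le] at hαε
    have : (P ^ ε)⁻¹ ≤ 72⁻¹ := inv_anti₀ (by norm_num) h1
    linarith
  have h1 := norm_SS_sub_le (c := c) (α := α) hP1
  have ha : 2 * π * |α| * (Real.log 4 * P) ≤ 14 * (P * (R * V)) := by
    have hl4 : Real.log 4 ≤ 2 := by
      rw [show (4 : ℝ) = 2 ^ 2 by norm_num, Real.log_pow]
      push_cast
      linarith [Real.log_two_lt_d9]
    have hl40 : 0 ≤ Real.log 4 := Real.log_nonneg (by norm_num)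
    have hπ : 2 * π ≤ 7 := by linarith [Real.pi_lt_d2]
    rw [abs_of_pos hα']
    calc _ ≤ 7 * V * (2 * P) := by gcongr
      _ = 14 * (P * (1 * V)) := by ring
      _ ≤ _ := by gcongr
  have hb : 2 * √P * L ≤ 2 * (P * (R * V)) := by
    have hs : √P ≤ P * V := by
      calc √P = P * P ^ (-(1 / 2) : ℝ) := by
            rw [Real.sqrt_eq_rpow, ← Real.rpow_one_add' hP0.le (by norm_num)]; norm_num
        _ ≤ P * V := by
          have := hPexp (1 / 2) (by linarith)
          gcongr
    calc _ ≤ 2 * (P * V) * R := by gcongr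
      _ = _ := by ring
  have hG : ‖G c N α‖ ≤ 4 * (P * (R * V)) := by
    refine (norm_G_le hc hα' hα2 N).trans ?_
    have e : α ^ (-(1 / c)) = P * X ^ (-(1 / c)) := by
      have : α = X * P ^ (-c) := by
        rw [hXdef, ← hN, Real.rpow_neg hP0.le]; field_simp
      conv_lhs => rw [this]
      rw [Real.mul_rpow hX0.le (by positivity), ← Real.rpow_mul hP0.le,
        show -c * -(1 / c) = 1 by field_simp, Real.rpow_one, mul_comm]
    have hcε : -(1 / c) ≤ -(ε / 32) := by
      have : 1 / 3 ≤ 1 / c := one_div_le_one_div_of_le hc0 hc3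
      linarith
    have h2 : X ^ (-(1 / c)) ≤ V :=
      (Real.rpow_le_rpow_of_exponent_le (by linarith) hcε).trans hXV
    rw [e]
    calc 4 * (P * X ^ (-(1 / c))) ≤ 4 * (P * (1 * V)) := by rw [one_mul]; gcongr
      _ ≤ _ := by gcongr
  set T := ∑ n ∈ Icc 1 K, (ArithmeticFunction.vonMangoldt n : ℂ) * eC (α * (n : ℝ) ^ c)
  have htri : ‖SS c P α - G c N α‖ ≤ ‖SS c P α - T‖ + ‖T‖ + ‖G c N α‖ := by
    have e : SS c P α - G c N α = (SS c P α - T) + T - G c N α := by ring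
    rw [e]
    exact (norm_sub_le _ _).trans (add_le_add_left (norm_add_le _ _) _)
  have hPRV : 0 < P * (R * V) := by positivity
  calc ‖SS c P α - G c N α‖ ≤ 2700 * (P * (R * V)) := by linarith
    _ ≤ 2700 * (P * Real.exp (-L ^ ((1 : ℝ) / 3))) := by gcongr
    _ = _ := by ring

end PrimeExp

theorem stmt_16 (c : ℝ) (hc1 : 1 < c) (hc2 : c < 4109054 / 1999527) (hc3 : c ≠ 2) :
    ∃ ε₀ > 0, ∀ ε : ℝ, 0 < ε → ε ≤ ε₀ →
      ∃ C > 0, ∃ N₀ : ℕ, ∀ N : ℕ, N₀ ≤ N →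
        ∀ P τ : ℝ, P = (N : ℝ) ^ (1 / c) → τ = P ^ (1 - c - ε) →
          ∀ α : ℝ, |α| ≤ τ →
            ‖SS c P α - G c N α‖ ≤ C * P * Real.exp (-Real.log P ^ ((1 : ℝ) / 3)) := by
  refine ⟨1, one_pos, fun ε hε hε1 => ?_⟩
  have hc0 : 0 < c := by linarith
  obtain ⟨C, hC, hsmall⟩ := PrimeExp.norm_SS_sub_G_le_of_small
  have hlarge := PrimeExp.norm_SS_sub_G_le_of_large hc1 (by linarith) hε hε1
  have htend : Filter.Tendsto (fun N : ℕ => (N : ℝ) ^ (1 / c)) Filter.atTop Filter.atTop :=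
    (tendsto_rpow_atTop (by positivity)).comp tendsto_natCast_atTop_atTop
  obtain ⟨N₀, hN₀⟩ := Filter.eventually_atTop.mp (htend.eventually (hsmall.and hlarge))
  refine ⟨C + 2700, by positivity, N₀, fun N hN P τ hP hτ α hα => ?_⟩
  obtain ⟨h1, h2⟩ := hN₀ N hN
  rw [← hP] at h1 h2
  have hP0 : 0 ≤ P := by rw [hP]; positivity
  have hPc : P ^ c = N := by
    rw [hP, ← Real.rpow_mul (Nat.cast_nonneg N), one_div_mul_cancel hc0.ne', Real.rpow_one]
  have hE := Real.exp_pos (-Real.log P ^ ((1 : ℝ) / 3))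
  have hPE : 0 ≤ P * Real.exp (-Real.log P ^ ((1 : ℝ) / 3)) := by positivity
  rw [hτ] at hα
  rcases le_total (N * |α|) (Real.exp (Real.log P ^ ((2 : ℝ) / 5))) with h | h
  · have := h1 c α N hc1 hPc h
    nlinarith
  · have := h2 |α| N hPc (abs_nonneg α) hα h
    rw [PrimeExp.norm_SS_sub_G_abs] at this
    nlinarith [mul_nonneg hC.le hPE]
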